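/- Let g : (ℂⁿ, 0) → (ℂⁿ, 0) be a germ of a finite holomorphic map. Then the following are equivalent: (a) there exists a germ of an irreducible analytic hypersurface X that is singular at 0 such that g⁻¹(X) is smooth at 0; (b) there exists a germ of a singular codimension one holomorphic foliation F that is singular at 0 such that g*F is nonsingular at 0. (Consequently, Theorem A — preimages of singular hypersurfaces under finite germs are singular — holds if and only if Theorem B — pullbacks of singular codimension one foliations under finite germs are singular — holds.) -/

import Mathlib

open Set Filter Topology

noncomputable section

/-- `ℂⁿ`, modeled as the space of functions `Fin n → ℂ`. -/
abbrev Cn (n : ℕ) : Type := Fin n → ℂ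

/-- `X` is an analytic hypersurface in the open set `W`, with its reduced structure:
near every point of `W` it is the zero set of a holomorphic function that does not
vanish identically on a connected neighborhood (hence every irreducible component of
`X` has codimension one). -/
def IsHypersurfaceIn {n : ℕ} (W X : Set (Cn n)) : Prop :=
  X ⊆ W ∧ ∀ p ∈ W, ∃ V : Set (Cn n), IsOpen V ∧ IsPreconnected V ∧ p ∈ V ∧ V ⊆ W ∧
    ∃ ψ : Cn n → ℂ, AnalyticOnNhd ℂ ψ V ∧ (∃ x ∈ V, ψ x ≠ 0) ∧ X ∩ V = {x ∈ V | ψ x = 0}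

/-- A hypersurface `X` is smooth at `p` if near `p` it is a codimension-one complex
submanifold of `ℂⁿ`, i.e. the zero set of a holomorphic function submersive at `p`.
"`X` is singular at `p`" is the negation of this. -/
def SmoothPointAt {n : ℕ} (X : Set (Cn n)) (p : Cn n) : Prop :=
  ∃ (V : Set (Cn n)) (φ : Cn n → ℂ), IsOpen V ∧ p ∈ V ∧ AnalyticOnNhd ℂ φ V ∧
    fderiv ℂ φ p ≠ 0 ∧ X ∩ V = {x ∈ V | φ x = 0}

/-- A one-form on (a subset of) `ℂⁿ`: a field of continuous `ℂ`-linear functionals. -/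
abbrev OneForm (n : ℕ) : Type := Cn n → (Cn n →L[ℂ] ℂ)

/-- The exterior derivative `dω` of a one-form, evaluated at `x` on vectors `u, v`. -/
def extd {n : ℕ} (ω : OneForm n) (x u v : Cn n) : ℂ :=
  fderiv ℂ ω x u v - fderiv ℂ ω x v u

/-- The integrability condition `ω ∧ dω = 0` on `U`, written out on triples of vectors. -/
def FormIntegrableOn {n : ℕ} (ω : OneForm n) (U : Set (Cn n)) : Prop :=
  ∀ x ∈ U, ∀ u v w : Cn n,
    ω x u * extd ω x v w + ω x v * extd ω x w u + ω x w * extd ω x u v = 0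

/-- `Z` has codimension at least two: it contains no nonempty local analytic
hypersurface (the zero set of a holomorphic function, not identically zero, on a
connected open set). -/
def CodimAtLeastTwo {n : ℕ} (Z : Set (Cn n)) : Prop :=
  ¬ ∃ (q : Cn n) (V : Set (Cn n)) (ψ : Cn n → ℂ), IsOpen V ∧ IsPreconnected V ∧ q ∈ V ∧
      AnalyticOnNhd ℂ ψ V ∧ ψ q = 0 ∧ (∃ x ∈ V, ψ x ≠ 0) ∧ {x ∈ V | ψ x = 0} ⊆ Z

/-- `ω` defines a singular codimension-one holomorphic foliation on the open set `W`:
it is holomorphic, integrable (`ω ∧ dω = 0`), and its zero set has codimension `≥ 2`.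
The foliation is singular at a point `x ∈ W` iff `ω x = 0`. -/
structure IsFoliationOn {n : ℕ} (ω : OneForm n) (W : Set (Cn n)) : Prop where
  isOpen : IsOpen W
  holo : AnalyticOnNhd ℂ ω W
  integrable : FormIntegrableOn ω W
  codim : CodimAtLeastTwo {x ∈ W | ω x = 0}

/-- The germ of the hypersurface `X` at `p` is irreducible: whenever `X` agrees, on a
neighborhood of `p`, with a union of two hypersurfaces, one of them is contained in the
other near `p` (so there are not two distinct irreducible components through `p`). -/
def GermIrreducibleAt {n : ℕ} (X : Set (Cn n)) (p : Cn n) : Prop :=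
  ∀ (V X₁ X₂ : Set (Cn n)), IsOpen V → p ∈ V →
    IsHypersurfaceIn V X₁ → IsHypersurfaceIn V X₂ → p ∈ X₁ → p ∈ X₂ →
    X ∩ V = X₁ ∪ X₂ →
    (∃ V' : Set (Cn n), IsOpen V' ∧ p ∈ V' ∧ X₁ ∩ V' ⊆ X₂) ∨
    (∃ V' : Set (Cn n), IsOpen V' ∧ p ∈ V' ∧ X₂ ∩ V' ⊆ X₁)

/-! ### Osgood's lemma -/

/-- Complex differentiability along complex lines through the points of `U`. -/
def LineHolomorphic {E F : Type*} [NormedAddCommGroup E] [NormedSpace ℂ E]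
    [NormedAddCommGroup F] [NormedSpace ℂ F] (f : E → F) (U : Set E) : Prop :=
  ∀ x ∈ U, ∀ v : E, DifferentiableAt ℂ (fun t : ℂ => f (x + t • v)) 0

section Kernel

open MeasureTheory

/-- The interval parametrizing circles. -/
abbrev CircleParam : Type := Icc (0 : ℝ) (2 * Real.pi)

/-- The circle `|z - c| = R` as a continuous function of its parameter. -/
def circlePath (c : ℂ) (R : ℝ) : C(CircleParam, ℂ) :=
  ⟨fun θ => circleMap c R θ, (continuous_circleMap c R).comp continuous_subtype_val⟩

/-- The Cauchy kernel as a function with values in functions on the circle. -/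
def cauchyKernel (c : ℂ) (R : ℝ) (z : ℂ) : C(CircleParam, ℂ) :=
  ⟨fun θ => (2 * Real.pi * Complex.I)⁻¹ * deriv (circleMap c R) θ, by
    simp only [deriv_circleMap]
    fun_prop⟩ * Ring.inverse (circlePath c R - algebraMap ℂ _ z)

attribute [local instance] Measure.Subtype.measureSpace

lemma volume_circleParam : (volume : Measure CircleParam) univ = ENNReal.ofReal (2 * Real.pi) := by
  rw [Measure.Subtype.volume_univ measurableSet_Icc.nullMeasurableSet]
  simp

instance isFiniteMeasure_circleParam : IsFiniteMeasure (volume : Measure CircleParam) :=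
  ⟨by rw [volume_circleParam]; exact ENNReal.ofReal_lt_top⟩

variable {c z : ℂ} {R : ℝ}

lemma isUnit_circlePath_sub (hz : z ∈ Metric.ball c R) :
    IsUnit (circlePath c R - algebraMap ℂ C(CircleParam, ℂ) z) := by
  rw [ContinuousMap.isUnit_iff_forall_ne_zero]
  intro θ h
  have h1 : circleMap c R θ = z := by
    simpa [circlePath, sub_eq_zero] using h
  exact circleMap_ne_mem_ball hz θ h1

lemma analyticAt_cauchyKernel (hz : z ∈ Metric.ball c R) :
    AnalyticAt ℂ (cauchyKernel c R) z := by
  obtain ⟨u, hu⟩ := isUnit_circlePath_sub hz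
  have h1 : AnalyticAt ℂ (fun z : ℂ => circlePath c R - algebraMap ℂ C(CircleParam, ℂ) z) z :=
    analyticAt_const.sub ((algebraMapCLM ℂ C(CircleParam, ℂ)).analyticAt z)
  have h2 : AnalyticAt ℂ (Ring.inverse : C(CircleParam, ℂ) → _)
      (circlePath c R - algebraMap ℂ C(CircleParam, ℂ) z) := hu ▸ analyticAt_inverse u
  exact analyticAt_const.mul (AnalyticAt.comp (g := Ring.inverse)
    (f := fun z : ℂ => circlePath c R - algebraMap ℂ C(CircleParam, ℂ) z) h2 h1)

lemma cauchyKernel_apply (hz : z ∈ Metric.ball c R) (θ : CircleParam) :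
    cauchyKernel c R z θ =
      (2 * Real.pi * Complex.I)⁻¹ * deriv (circleMap c R) θ * (circleMap c R θ - z)⁻¹ := by
  obtain ⟨u, hu⟩ := isUnit_circlePath_sub hz
  have h : (circlePath c R - algebraMap ℂ C(CircleParam, ℂ) z) θ *
      Ring.inverse (circlePath c R - algebraMap ℂ C(CircleParam, ℂ) z) θ = 1 := by
    rw [← ContinuousMap.mul_apply, Ring.mul_inverse_cancel _ ⟨u, hu⟩]; rfl
  have h2 : (circlePath c R - algebraMap ℂ C(CircleParam, ℂ) z) θ = circleMap c R θ - z := by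
    simp [circlePath]
  rw [h2] at h
  simp only [cauchyKernel, ContinuousMap.mul_apply, ContinuousMap.coe_mk]
  congr 1
  exact eq_inv_of_mul_eq_one_right h

/-- Integration of a product over the circle as a continuous bilinear map. -/
def circlePairing (F : Type) [NormedAddCommGroup F] [NormedSpace ℂ F] [CompleteSpace F] :
    C(CircleParam, ℂ) →L[ℂ] C(CircleParam, F) →L[ℂ] F :=
  LinearMap.mkContinuous₂
    (LinearMap.mk₂ ℂ (fun (k : C(CircleParam, ℂ)) (h : C(CircleParam, F)) => ∫ θ, k θ • h θ)
      (by
        intro k k' h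
        simp only [ContinuousMap.add_apply, add_smul]
        exact integral_add ((by fun_prop : Continuous fun θ => k θ • h θ).integrable_of_hasCompactSupport
          (HasCompactSupport.of_compactSpace _))
          ((by fun_prop : Continuous fun θ => k' θ • h θ).integrable_of_hasCompactSupport
          (HasCompactSupport.of_compactSpace _)))
      (by
        intro a k h
        simp only [ContinuousMap.smul_apply, smul_assoc, integral_smul])
      (by
        intro k h h'
        simp only [ContinuousMap.add_apply, smul_add]
        exact integral_add ((by fun_prop : Continuous fun θ => k θ • h θ).integrable_of_hasCompactSupport
          (HasCompactSupport.of_compactSpace _))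
          ((by fun_prop : Continuous fun θ => k θ • h' θ).integrable_of_hasCompactSupport
          (HasCompactSupport.of_compactSpace _)))
      (by
        intro a k h
        simp only [ContinuousMap.smul_apply, smul_comm _ a, integral_smul]))
    (2 * Real.pi) (by
      intro k h
      simp only [LinearMap.mk₂_apply]
      have := norm_integral_le_of_norm_le_const (μ := (volume : Measure CircleParam))
        (f := fun θ => k θ • h θ) (C := ‖k‖ * ‖h‖)
        (Eventually.of_forall fun θ => by
          rw [norm_smul]
          exact mul_le_mul (k.norm_coe_le_norm θ) (h.norm_coe_le_norm θ) (norm_nonneg _)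
            (norm_nonneg _))
      have hv : (volume : Measure CircleParam).real univ = 2 * Real.pi := by
        rw [Measure.real, volume_circleParam]
        simp [Real.pi_pos.le]
      rw [hv] at this
      linarith)

lemma circlePairing_apply (F : Type) [NormedAddCommGroup F] [NormedSpace ℂ F] [CompleteSpace F]
    (k : C(CircleParam, ℂ)) (h : C(CircleParam, F)) :
    circlePairing F k h = ∫ θ, k θ • h θ := rfl

lemma circlePairing_cauchyKernel {F : Type} [NormedAddCommGroup F] [NormedSpace ℂ F]
    [CompleteSpace F] {f : ℂ → F} (hc : ContinuousOn f (Metric.closedBall c R))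
    (hd : DifferentiableOn ℂ f (Metric.ball c R)) (hz : z ∈ Metric.ball c R)
    {h : C(CircleParam, F)} (hh : ∀ θ, h θ = f (circleMap c R θ)) :
    circlePairing F (cauchyKernel c R z) h = f z := by
  have hR : 0 < R := Metric.pos_of_mem_ball hz
  have hdc : DiffContOnCl ℂ f (Metric.ball c R) :=
    ⟨hd, by rwa [closure_ball c hR.ne']⟩
  have h1 := hdc.circleIntegral_sub_inv_smul hz
  rw [circleIntegral_def_Icc] at h1
  rw [circlePairing_apply]
  have h2 : ∀ θ : CircleParam, cauchyKernel c R z θ • h θ =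
      (fun θ : ℝ => (2 * Real.pi * Complex.I)⁻¹ •
        (deriv (circleMap c R) θ • (circleMap c R θ - z)⁻¹ • f (circleMap c R θ))) θ := by
    intro θ
    rw [cauchyKernel_apply hz, hh]
    simp only [smul_smul, mul_assoc]
  simp only [h2]
  rw [integral_subtype measurableSet_Icc
    (fun θ : ℝ => (2 * Real.pi * Complex.I)⁻¹ •
        (deriv (circleMap c R) θ • (circleMap c R θ - z)⁻¹ • f (circleMap c R θ))),
    integral_smul, h1, smul_smul, inv_mul_cancel₀, one_smul]
  exact Complex.two_pi_I_ne_zero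

lemma differentiableAt_of_eval {T F : Type} [TopologicalSpace T] [CompactSpace T] [NormedAddCommGroup F] [NormedSpace ℂ F]
    [CompleteSpace F] {H : ℂ → C(T, F)} {ρ : ℝ} (hρ : 0 < ρ)
    (hc : ContinuousOn H (Metric.closedBall 0 ρ))
    (hd : ∀ θ, DifferentiableOn ℂ (fun t => H t θ) (Metric.ball 0 ρ)) :
    DifferentiableAt ℂ H 0 := by
  let h : C(CircleParam, C(T, F)) :=
    ⟨fun θ => H (circleMap 0 ρ θ), hc.comp_continuous
      ((continuous_circleMap 0 ρ).comp continuous_subtype_val)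
      fun θ => circleMap_mem_closedBall _ hρ.le _⟩
  have key : ∀ t ∈ Metric.ball (0 : ℂ) ρ,
      H t = circlePairing C(T, F) (cauchyKernel 0 ρ t) h := by
    intro t ht
    ext θ
    rw [circlePairing_apply, ← ContinuousMap.evalCLM_apply ℂ θ (∫ _, _),
      ← ContinuousLinearMap.integral_comp_comm]
    · refine (circlePairing_cauchyKernel (f := fun t => H t θ) ?_ (hd θ) ht
        (h := ((ContinuousMap.evalCLM ℂ θ : C(T, F) →L[ℂ] F) : C(_, _)).comp h)
        fun _ => rfl).symm
      exact ((ContinuousMap.evalCLM ℂ θ).continuous.comp_continuousOn hc)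
    · exact (by fun_prop : Continuous fun θ => cauchyKernel 0 ρ t θ • h θ)
        |>.integrable_of_hasCompactSupport (HasCompactSupport.of_compactSpace _)
  have h0 : (0 : ℂ) ∈ Metric.ball (0 : ℂ) ρ := Metric.mem_ball_self hρ
  have : DifferentiableAt ℂ
      (fun t => circlePairing C(T, F) (cauchyKernel 0 ρ t) h) 0 := by
    have h1 := (analyticAt_cauchyKernel h0).differentiableAt
    exact ((circlePairing C(T, F)).flip h).differentiableAt.comp (0 : ℂ) h1
  refine this.congr_of_eventuallyEq ?_
  filter_upwards [Metric.ball_mem_nhds (0 : ℂ) hρ] with t ht using key t ht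

end Kernel

/-- The property that Osgood's lemma holds for functions on `E`. -/
def OsgoodSpace (E : Type) [NormedAddCommGroup E] [NormedSpace ℂ E] : Prop :=
  ∀ (F : Type) [NormedAddCommGroup F] [NormedSpace ℂ F] [CompleteSpace F] (f : E → F) (U : Set E),
    IsOpen U → ContinuousOn f U → LineHolomorphic f U → AnalyticOnNhd ℂ f U

lemma OsgoodSpace.congr {E E' : Type} [NormedAddCommGroup E] [NormedSpace ℂ E]
    [NormedAddCommGroup E'] [NormedSpace ℂ E'] (e : E ≃L[ℂ] E') (h : OsgoodSpace E) :
    OsgoodSpace E' := by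
  intro F _ _ _ f U hU hc hl
  have h1 := h F (f ∘ e) (e ⁻¹' U) (hU.preimage e.continuous)
    (hc.comp e.continuous.continuousOn fun _ hx => hx) (by
      intro x hx v
      have := hl (e x) hx (e v)
      simpa using this)
  intro x hx
  have h2 : AnalyticAt ℂ (f ∘ e) (e.symm x) := h1 (e.symm x) (by simpa using hx)
  have h3 := h2.comp ((e.symm : E' →L[ℂ] E).analyticAt x)
  simpa [Function.comp_def] using h3

lemma OsgoodSpace.of_subsingleton {E : Type} [NormedAddCommGroup E] [NormedSpace ℂ E]
    [Subsingleton E] : OsgoodSpace E := by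
  intro F _ _ _ f U hU hc hl x hx
  have : f = fun _ => f x := by
    funext y; rw [Subsingleton.elim y x]
  rw [this]
  exact analyticAt_const

lemma LineHolomorphic.differentiableOn {E F : Type*} [NormedAddCommGroup E] [NormedSpace ℂ E]
    [NormedAddCommGroup F] [NormedSpace ℂ F] {f : E → F} {U : Set E} (h : LineHolomorphic f U)
    (x v : E) : DifferentiableOn ℂ (fun t : ℂ => f (x + t • v)) {t | x + t • v ∈ U} := by
  intro t ht
  have h1 := h _ ht v
  have h2 : DifferentiableAt ℂ (fun s : ℂ => s - t) t := by fun_prop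
  have h3 : DifferentiableAt ℂ (fun s : ℂ => f (x + t • v + (s - t) • v)) t :=
    DifferentiableAt.comp (g := fun s : ℂ => f (x + t • v + s • v)) t (by simpa using h1) h2
  refine DifferentiableAt.differentiableWithinAt ?_
  convert h3 using 3 with s
  rw [add_assoc, ← add_smul]; simp

lemma OsgoodSpace.prod {E : Type} [NormedAddCommGroup E] [NormedSpace ℂ E] (h : OsgoodSpace E) :
    OsgoodSpace (ℂ × E) := by
  intro F _ _ _ f U hU hc hl p hp
  obtain ⟨r, hr, hrU⟩ := Metric.nhds_basis_closedBall.mem_iff.1 (hU.mem_nhds hp)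
  obtain ⟨c, w₀⟩ := p
  have hsub : ∀ z ∈ Metric.closedBall c r, ∀ w ∈ Metric.closedBall w₀ r, (z, w) ∈ U :=
    fun z hz w hw => hrU (by rw [← closedBall_prod_same]; exact ⟨hz, hw⟩)
  have hcirc : ∀ θ : ℝ, circleMap c r θ ∈ Metric.closedBall c r :=
    fun θ => circleMap_mem_closedBall _ hr.le _
  have hcont : ∀ w ∈ Metric.closedBall w₀ r,
      Continuous fun θ : CircleParam => f (circleMap c r θ, w) := fun w hw =>
    hc.comp_continuous ((((continuous_circleMap c r).comp continuous_subtype_val)).prodMk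
      continuous_const) fun θ => hsub _ (hcirc θ) _ hw
  classical
  let H : E → C(CircleParam, F) := fun w =>
    if hw : w ∈ Metric.closedBall w₀ r then ⟨_, hcont w hw⟩ else 0
  have hH : ∀ w ∈ Metric.closedBall w₀ r, ∀ θ, H w θ = f (circleMap c r θ, w) := by
    intro w hw θ
    simp only [H, dif_pos hw, ContinuousMap.coe_mk]
  have hHc : ContinuousOn H (Metric.closedBall w₀ r) := by
    rw [continuousOn_iff_continuous_domRestrict]
    refine ContinuousMap.continuous_of_continuous_uncurry _ ?_
    have : Function.uncurry (fun (x : Metric.closedBall w₀ r) y =>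
        ((Metric.closedBall w₀ r).domRestrict H x) y) =
        fun q : Metric.closedBall w₀ r × CircleParam => f (circleMap c r q.2, q.1) := by
      funext q
      exact hH q.1 q.1.2 q.2
    rw [this]
    refine hc.comp_continuous (Continuous.prodMk ((continuous_circleMap c r).comp
      (continuous_subtype_val.comp continuous_snd))
      (continuous_subtype_val.comp continuous_fst)) fun q => hsub _ (hcirc _) _ q.1.2
  have hHl : LineHolomorphic H (Metric.ball w₀ r) := by
    intro w hw v
    have hcl : Continuous fun t : ℂ => w + t • v := by fun_prop
    have hn : (fun t : ℂ => w + t • v) ⁻¹' Metric.ball w₀ r ∈ 𝓝 (0 : ℂ) :=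
      hcl.continuousAt.preimage_mem_nhds (Metric.isOpen_ball.mem_nhds (by simpa using hw))
    obtain ⟨ρ, hρ, hρs⟩ := Metric.nhds_basis_closedBall.mem_iff.1 hn
    refine differentiableAt_of_eval hρ ?_ ?_
    · exact hHc.comp hcl.continuousOn fun t ht => Metric.ball_subset_closedBall (hρs ht)
    · intro θ t ht
      have ht' := Metric.ball_subset_closedBall (hρs (Metric.ball_subset_closedBall ht))
      have h1 := (hl.differentiableOn (circleMap c r θ, w) (0, v)) t (by
        simpa using hsub _ (hcirc θ) _ ht')
      have h2 : {t : ℂ | (circleMap c r θ, w) + t • ((0 : ℂ), v) ∈ U} ∈ 𝓝 t := by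
        refine (hU.preimage (by fun_prop)).mem_nhds ?_
        simpa using hsub _ (hcirc θ) _ ht'
      refine ((h1.differentiableAt h2).congr_of_eventuallyEq ?_).differentiableWithinAt
      filter_upwards [Metric.isOpen_ball.mem_nhds ht] with s hs
      rw [hH _ (Metric.ball_subset_closedBall (hρs (Metric.ball_subset_closedBall hs)))]
      simp
  have hHa := h C(CircleParam, F) H _ Metric.isOpen_ball
    (hHc.mono Metric.ball_subset_closedBall) hHl
  have hza := analyticAt_cauchyKernel (Metric.mem_ball_self hr : c ∈ Metric.ball c r)
  have hcomb : AnalyticAt ℂ (fun q : ℂ × E =>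
      circlePairing F (cauchyKernel c r q.1) (H q.2)) (c, w₀) := by
    have := (circlePairing F).analyticAt_bilinear (cauchyKernel c r c, H w₀)
    refine this.comp_of_eq (AnalyticAt.prod (hza.comp_of_eq analyticAt_fst rfl)
      ((hHa w₀ (Metric.mem_ball_self hr)).comp_of_eq analyticAt_snd rfl)) rfl
  refine hcomb.congr ?_
  have hmem : Metric.ball c r ×ˢ Metric.ball w₀ r ∈ 𝓝 (c, w₀) :=
    prod_mem_nhds (Metric.ball_mem_nhds _ hr) (Metric.ball_mem_nhds _ hr)
  filter_upwards [hmem] with q hq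
  obtain ⟨z, w⟩ := q
  have hw := Metric.ball_subset_closedBall hq.2
  refine circlePairing_cauchyKernel (f := fun z => f (z, w)) ?_ ?_ hq.1 (hH w hw)
  · exact hc.comp (by fun_prop) fun z hz => hsub z hz w hw
  · intro z hz
    have h1 := (hl.differentiableOn (0, w) (1, 0)) z (by
        simpa using hsub _ (Metric.ball_subset_closedBall hz) _ hw)
    have h2 : {t : ℂ | ((0 : ℂ), w) + t • ((1 : ℂ), (0 : E)) ∈ U} ∈ 𝓝 z := by
      refine (hU.preimage (by fun_prop)).mem_nhds ?_
      simpa using hsub _ (Metric.ball_subset_closedBall hz) _ hw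
    simpa using (h1.differentiableAt h2).differentiableWithinAt

lemma osgoodSpace_of_finiteDimensional (E : Type) [NormedAddCommGroup E] [NormedSpace ℂ E]
    [FiniteDimensional ℂ E] : OsgoodSpace E := by
  have hpi : ∀ N : ℕ, OsgoodSpace (Fin N → ℂ) := by
    intro N
    induction N with
    | zero => exact OsgoodSpace.of_subsingleton
    | succ N ih =>
      refine OsgoodSpace.congr (E := ℂ × (Fin N → ℂ)) ?_ ih.prod
      exact ContinuousLinearEquiv.ofFinrankEq (by simp [add_comm])
  exact OsgoodSpace.congr (ContinuousLinearEquiv.ofFinrankEq (by simp)) (hpi (Module.finrank ℂ E))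

section FiniteDimensionalDomain

variable {E F : Type} [NormedAddCommGroup E] [NormedSpace ℂ E] [FiniteDimensional ℂ E]
  [NormedAddCommGroup F] [NormedSpace ℂ F] [CompleteSpace F]

/-- Osgood's lemma: a continuous function, holomorphic along complex lines, is analytic. -/
lemma LineHolomorphic.analyticOnNhd {f : E → F} {U : Set E} (hl : LineHolomorphic f U)
    (hU : IsOpen U) (hc : ContinuousOn f U) : AnalyticOnNhd ℂ f U :=
  osgoodSpace_of_finiteDimensional E F f U hU hc hl

lemma analyticOnNhd_of_differentiableOn {f : E → F} {U : Set E} (hU : IsOpen U)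
    (hd : DifferentiableOn ℂ f U) : AnalyticOnNhd ℂ f U := by
  refine LineHolomorphic.analyticOnNhd ?_ hU hd.continuousOn
  intro x hx v
  have h1 : DifferentiableAt ℂ f (x + (0 : ℂ) • v) := by
    simpa using (hd x hx).differentiableAt (hU.mem_nhds hx)
  exact h1.comp (0 : ℂ) (by fun_prop)

end FiniteDimensionalDomain

/-! ### Holomorphic dependence on parameters -/

section Parameters

open MeasureTheory

variable {E F : Type} [NormedAddCommGroup E] [NormedSpace ℂ E] [FiniteDimensional ℂ E]
  [NormedAddCommGroup F] [NormedSpace ℂ F] [CompleteSpace F]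
  {T : Type} [TopologicalSpace T] [CompactSpace T]

/-- A jointly continuous family of holomorphic functions, indexed by a compact space, is a
holomorphic function with values in the continuous functions of the index. -/
lemma exists_analyticOnNhd_continuousMap {H : T → E → F} {U : Set E} (hU : IsOpen U)
    (hc : ContinuousOn (fun q : T × E => H q.1 q.2) (univ ×ˢ U))
    (hd : ∀ t, DifferentiableOn ℂ (H t) U) :
    ∃ G : E → C(T, F), AnalyticOnNhd ℂ G U ∧ ∀ z ∈ U, ∀ t, G z t = H t z := by
  classical
  have hcont : ∀ z ∈ U, Continuous fun t => H t z := fun z hz =>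
    hc.comp_continuous (by fun_prop : Continuous fun t : T => (t, z)) fun t => ⟨mem_univ _, hz⟩
  let G : E → C(T, F) := fun z => if hz : z ∈ U then ⟨_, hcont z hz⟩ else 0
  have hG : ∀ z ∈ U, ∀ t, G z t = H t z := by
    intro z hz t
    simp only [G, dif_pos hz, ContinuousMap.coe_mk]
  refine ⟨G, ?_, hG⟩
  have hGc : ContinuousOn G U := by
    rw [continuousOn_iff_continuous_domRestrict]
    refine ContinuousMap.continuous_of_continuous_uncurry _ ?_
    have : Function.uncurry (fun (x : U) y => (U.domRestrict G x) y) =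
        fun q : U × T => H q.2 q.1 := by
      funext q
      exact hG q.1 q.1.2 q.2
    rw [this]
    exact hc.comp_continuous (continuous_snd.prodMk (continuous_subtype_val.comp continuous_fst))
      fun q => ⟨mem_univ _, q.1.2⟩
  refine LineHolomorphic.analyticOnNhd ?_ hU hGc
  intro z hz v
  have hcl : Continuous fun t : ℂ => z + t • v := by fun_prop
  have hn : (fun t : ℂ => z + t • v) ⁻¹' U ∈ 𝓝 (0 : ℂ) :=
    hcl.continuousAt.preimage_mem_nhds (hU.mem_nhds (by simpa using hz))
  obtain ⟨ρ, hρ, hρs⟩ := Metric.nhds_basis_closedBall.mem_iff.1 hn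
  refine differentiableAt_of_eval hρ (hGc.comp hcl.continuousOn fun t ht => hρs ht) ?_
  intro θ t ht
  have ht' : z + t • v ∈ U := hρs (Metric.ball_subset_closedBall ht)
  have h1 : DifferentiableAt ℂ (fun s : ℂ => H θ (z + s • v)) t :=
    ((hd θ _ ht').differentiableAt (hU.mem_nhds ht')).comp t (by fun_prop)
  refine (h1.congr_of_eventuallyEq ?_).differentiableWithinAt
  filter_upwards [Metric.isOpen_ball.mem_nhds ht] with s hs
  exact hG _ (hρs (Metric.ball_subset_closedBall hs)) θ

/-- Integration against a finite measure on a compact space, as a continuous linear map. -/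
def integralCM (F : Type) [NormedAddCommGroup F] [NormedSpace ℂ F] [MeasurableSpace T]
    [OpensMeasurableSpace T] (μ : Measure T) [IsFiniteMeasure μ] : C(T, F) →L[ℂ] F :=
  LinearMap.mkContinuous
    { toFun := fun h => ∫ t, h t ∂μ
      map_add' := fun h k => by
        simp only [ContinuousMap.add_apply]
        exact integral_add
          (h.continuous.integrable_of_hasCompactSupport (HasCompactSupport.of_compactSpace _))
          (k.continuous.integrable_of_hasCompactSupport (HasCompactSupport.of_compactSpace _))
      map_smul' := fun a h => by
        simp only [ContinuousMap.smul_apply, integral_smul, RingHom.id_apply] }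
    (μ.real univ) (by
      intro h
      have := norm_integral_le_of_norm_le_const (μ := μ) (f := fun t => h t) (C := ‖h‖)
        (Eventually.of_forall fun t => h.norm_coe_le_norm t)
      simpa [mul_comm] using this)

lemma analyticOnNhd_integral_of_compactSpace [MeasurableSpace T] [OpensMeasurableSpace T]
    (μ : Measure T) [IsFiniteMeasure μ] {H : T → E → F} {U : Set E} (hU : IsOpen U)
    (hc : ContinuousOn (fun q : T × E => H q.1 q.2) (univ ×ˢ U))
    (hd : ∀ t, DifferentiableOn ℂ (H t) U) :
    AnalyticOnNhd ℂ (fun z => ∫ t, H t z ∂μ) U := by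
  obtain ⟨G, hG, hGH⟩ := exists_analyticOnNhd_continuousMap hU hc hd
  have h1 : AnalyticOnNhd ℂ (fun z => integralCM F μ (G z)) U := fun z hz =>
    ((integralCM F μ).analyticAt _).comp (hG z hz)
  refine h1.congr hU ?_
  intro z hz
  show ∫ t, G z t ∂μ = _
  simp only [hGH z hz]

lemma integral_unitInterval_eq {G : Type} [NormedAddCommGroup G] [NormedSpace ℝ G]
    (f : ℝ → G) :
    ∫ s : unitInterval, f s = ∫ s in (0:ℝ)..1, f s := by
  rw [intervalIntegral.integral_of_le zero_le_one, ← integral_Icc_eq_integral_Ioc]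
  exact integral_subtype measurableSet_Icc f

end Parameters

/-! ### Zeros in one variable, and division -/

section OneVariable

variable {E : Type} [NormedAddCommGroup E] [NormedSpace ℂ E]

/-- Persistence of an isolated zero in a family of holomorphic functions of one variable. -/
lemma eventually_exists_zero {Φ : ℂ × E → ℂ} {p : ℂ × E} (hΦ : AnalyticAt ℂ Φ p)
    (h0 : Φ p = 0) (hne : ¬ ∀ᶠ c in 𝓝 p.1, Φ (c, p.2) = 0) {ε : ℝ} (hε : 0 < ε) :
    ∀ᶠ x in 𝓝 p.2, ∃ c ∈ Metric.ball p.1 ε, Φ (c, x) = 0 := by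
  obtain ⟨c₀, x₀⟩ := p
  have h1 : AnalyticAt ℂ (fun c => Φ (c, x₀)) c₀ :=
    hΦ.comp_of_eq (analyticAt_id.prod analyticAt_const) rfl
  have h2 := h1.eventually_eq_zero_or_eventually_ne_zero.resolve_left hne
  rw [eventually_nhdsWithin_iff] at h2
  obtain ⟨r₁, hr₁, h3⟩ := Metric.eventually_nhds_iff.1 h2
  obtain ⟨r₂, hr₂, h4⟩ := Metric.eventually_nhds_iff.1 hΦ.eventually_analyticAt
  set r := min (min r₁ r₂) ε / 2 with hr
  have hm : 0 < min (min r₁ r₂) ε := lt_min (lt_min hr₁ hr₂) hε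
  have hr0 : 0 < r := by positivity
  have hrr₁ : r < r₁ := by
    have := (min_le_left (min r₁ r₂) ε).trans (min_le_left _ _); linarith
  have hrr₂ : r < r₂ := by
    have := (min_le_left (min r₁ r₂) ε).trans (min_le_right _ _); linarith
  have hrε : r < ε := by
    have := min_le_right (min r₁ r₂) ε; linarith
  have hsph : IsCompact (Metric.sphere c₀ r) := isCompact_sphere _ _
  have hcs : ∀ c ∈ Metric.sphere c₀ r, Φ (c, x₀) ≠ 0 := by
    intro c hc
    refine h3 ?_ ?_
    · rw [Metric.mem_sphere.1 hc]; exact hrr₁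
    · rintro rfl; simp at hc; linarith
  have hca : ∀ c ∈ Metric.closedBall c₀ r, AnalyticAt ℂ Φ (c, x₀) := by
    intro c hc
    refine h4 ?_
    rw [Prod.dist_eq, dist_self, max_eq_left dist_nonneg]
    exact (Metric.mem_closedBall.1 hc).trans_lt hrr₂
  obtain ⟨c₁, hc₁, hmin⟩ := hsph.exists_isMinOn
    (NormedSpace.sphere_nonempty.2 hr0.le) (f := fun c => ‖Φ (c, x₀)‖) (by
      intro c hc
      exact ((hca c (Metric.sphere_subset_closedBall hc)).continuousAt.comp_of_eq
        (by fun_prop : ContinuousAt (fun c => (c, x₀)) c) rfl).norm.continuousWithinAt)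
  set δ := ‖Φ (c₁, x₀)‖ with hδ
  have hδ0 : 0 < δ := norm_pos_iff.2 (hcs c₁ hc₁)
  have e1 : ∀ᶠ x in 𝓝 x₀, ∀ c ∈ Metric.sphere c₀ r, δ / 2 < ‖Φ (c, x)‖ := by
    refine hsph.eventually_forall_of_forall_eventually fun c hc => ?_
    have : ContinuousAt (fun z : E × ℂ => ‖Φ (z.2, z.1)‖) (x₀, c) :=
      ((hca c (Metric.sphere_subset_closedBall hc)).continuousAt.comp_of_eq
        (by fun_prop : ContinuousAt (fun z : E × ℂ => (z.2, z.1)) (x₀, c)) rfl).norm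
    refine this.eventually_const_lt ?_
    have : δ ≤ ‖Φ (c, x₀)‖ := hmin hc
    simp only; linarith
  have e2 : ∀ᶠ x in 𝓝 x₀, ∀ c ∈ Metric.closedBall c₀ r, AnalyticAt ℂ Φ (c, x) := by
    refine (isCompact_closedBall c₀ r).eventually_forall_of_forall_eventually fun c hc => ?_
    exact (by fun_prop : ContinuousAt (fun z : E × ℂ => (z.2, z.1)) (x₀, c)).eventually
      (hca c hc).eventually_analyticAt
  have e3 : ∀ᶠ x in 𝓝 x₀, ‖Φ (c₀, x)‖ < δ / 2 := by
    have : ContinuousAt (fun x : E => ‖Φ (c₀, x)‖) x₀ :=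
      (hΦ.continuousAt.comp_of_eq (by fun_prop : ContinuousAt (fun x : E => (c₀, x)) x₀) rfl).norm
    refine this.eventually_lt_const ?_
    simp only [h0]; simpa using half_pos hδ0
  filter_upwards [e1, e2, e3] with x hx1 hx2 hx3
  by_contra! hcon
  have hnz : ∀ c ∈ Metric.closedBall c₀ r, Φ (c, x) ≠ 0 := fun c hc =>
    hcon c (Metric.closedBall_subset_ball hrε hc)
  have hdiff : DifferentiableOn ℂ (fun c => Φ (c, x)) (Metric.closedBall c₀ r) := fun c hc =>
    ((hx2 c hc).differentiableAt.comp c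
      (by fun_prop : DifferentiableAt ℂ (fun c => (c, x)) c)).differentiableWithinAt
  have hdc : DiffContOnCl ℂ (fun c => (Φ (c, x))⁻¹) (Metric.ball c₀ r) := by
    refine DifferentiableOn.diffContOnCl ?_
    rw [closure_ball c₀ hr0.ne']
    exact hdiff.inv hnz
  have := Complex.norm_le_of_forall_mem_frontier_norm_le Metric.isBounded_ball hdc
    (C := (δ / 2)⁻¹) (by
      intro c hc
      rw [frontier_ball c₀ hr0.ne'] at hc
      rw [norm_inv]
      exact inv_anti₀ (half_pos hδ0) (hx1 c hc).le)
    (subset_closure (Metric.mem_ball_self hr0))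
  rw [norm_inv] at this
  have h5 : 0 < ‖Φ (c₀, x)‖ := norm_pos_iff.2 (hnz c₀ (Metric.mem_closedBall_self hr0.le))
  have := (inv_le_inv₀ h5 (half_pos hδ0)).1 this
  linarith

variable [FiniteDimensional ℂ E]

/-- Division of a function vanishing on `{c = 0}` by the coordinate `c`. -/
lemma exists_eq_fst_mul {Φ : ℂ × E → ℂ} (hΦ : AnalyticAt ℂ Φ 0)
    (h0 : ∀ᶠ x in 𝓝 (0 : E), Φ (0, x) = 0) :
    ∃ Ψ : ℂ × E → ℂ, AnalyticAt ℂ Ψ 0 ∧ ∀ᶠ p in 𝓝 (0 : ℂ × E), Φ p = p.1 * Ψ p := by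
  obtain ⟨r₁, hr₁, h1⟩ := Metric.eventually_nhds_iff.1 hΦ.eventually_analyticAt
  obtain ⟨r₂, hr₂, h2⟩ := Metric.eventually_nhds_iff.1 h0
  set r := min r₁ r₂
  have hr : 0 < r := lt_min hr₁ hr₂
  set D : ℂ × E → ℂ := fun p => fderiv ℂ Φ p (1, 0)
  have hball : ∀ p ∈ Metric.ball (0 : ℂ × E) r, ∀ s ∈ Icc (0:ℝ) 1,
      (((s:ℂ) * p.1, p.2) : ℂ × E) ∈ Metric.ball (0 : ℂ × E) r := by
    intro p hp s hs
    rw [mem_ball_zero_iff, Prod.norm_def, max_lt_iff] at hp ⊢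
    refine ⟨?_, hp.2⟩
    simp only [norm_mul, Complex.norm_real, Real.norm_eq_abs, abs_of_nonneg hs.1]
    nlinarith [norm_nonneg p.1, hs.2, hp.1]
  have hA : ∀ p ∈ Metric.ball (0 : ℂ × E) r, AnalyticAt ℂ Φ p := fun p hp =>
    h1 ((Metric.mem_ball.1 hp).trans_le (min_le_left _ _))
  have hD : ∀ p ∈ Metric.ball (0 : ℂ × E) r, AnalyticAt ℂ D p := fun p hp =>
    ((ContinuousLinearMap.apply ℂ ℂ ((1, 0) : ℂ × E)).analyticAt _).comp (hA p hp).fderiv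
  refine ⟨fun p => ∫ s : unitInterval, D ((s : ℂ) * p.1, p.2), ?_, ?_⟩
  · refine analyticOnNhd_integral_of_compactSpace (T := unitInterval)
      MeasureTheory.volume (H := fun s p => D ((s : ℂ) * p.1, p.2))
      (Metric.isOpen_ball (x := (0 : ℂ × E)) (ε := r)) ?_ ?_ 0 (Metric.mem_ball_self hr)
    · have hDc : ContinuousOn D (Metric.ball 0 r) := fun p hp =>
        (hD p hp).continuousAt.continuousWithinAt
      refine hDc.comp (f := fun q : unitInterval × (ℂ × E) => ((((q.1 : ℝ) : ℂ) * q.2.1, q.2.2) : ℂ × E))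
        (Continuous.continuousOn (by fun_prop)) fun q hq => hball _ hq.2 _ q.1.2
    · intro s p hp
      refine DifferentiableAt.differentiableWithinAt ?_
      exact (hD _ (hball p hp s s.2)).differentiableAt.comp p
        (by fun_prop : DifferentiableAt ℂ
          (fun p : ℂ × E => (((s : ℝ) : ℂ) * p.1, p.2)) p)
  · filter_upwards [Metric.ball_mem_nhds (0 : ℂ × E) hr] with p hp
    have hcomp : ∀ s ∈ Icc (0:ℝ) 1, HasDerivAt (fun c => Φ (c, p.2))
        (D ((0:ℂ) + s • p.1, p.2)) ((0:ℂ) + s • p.1) := by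
      intro s hs
      have hm := hball p hp s hs
      have h3 := (hA _ hm).differentiableAt.hasFDerivAt
      have h4 : HasDerivAt (fun c : ℂ => (c, p.2)) ((1 : ℂ), (0 : E)) ((s : ℂ) * p.1) :=
        (hasDerivAt_id _).prodMk (hasDerivAt_const _ _)
      have := h3.comp_hasDerivAt _ h4
      have e : ((0 : ℂ) + s • p.1) = (s : ℂ) * p.1 := by simp
      rw [e]
      exact this
    have key := intervalIntegral.integral_unitInterval_deriv_eq_sub (𝕜 := ℂ)
      (f := fun c => Φ (c, p.2)) (f' := fun c => D (c, p.2)) (z₀ := 0) (z₁ := p.1) (by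
        intro s hs
        have hm := hball p hp s hs
        refine ContinuousAt.continuousWithinAt ?_
        refine ContinuousAt.comp_of_eq (hD _ hm).continuousAt
          (f := fun s : ℝ => ((((0 : ℂ) + s • p.1), p.2) : ℂ × E)) (by fun_prop) ?_
        simp) hcomp
    have hp2 : Φ (0, p.2) = 0 := by
      refine h2 ?_
      have : dist p 0 < r := hp
      rw [Prod.dist_eq] at this
      exact ((le_max_right _ _).trans_lt this).trans_le (min_le_right _ _)
    have := integral_unitInterval_eq (fun s : ℝ => D ((0:ℂ) + s • p.1, p.2))
    simp only [zero_add, Complex.real_smul] at this key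
    simp only [hp2, sub_zero] at key
    rw [← this, smul_eq_mul] at key
    exact key.symm

/-- A function whose zeros lie on `{c = 0}` is a unit times a power of `c`. -/
lemma exists_eq_fst_pow_mul {Φ : ℂ × E → ℂ} (hΦ : AnalyticAt ℂ Φ 0)
    (hz : ∀ᶠ p in 𝓝 (0 : ℂ × E), Φ p = 0 → p.1 = 0) :
    ∃ (k : ℕ) (u : ℂ × E → ℂ), AnalyticAt ℂ u 0 ∧ u 0 ≠ 0 ∧
      ∀ᶠ p in 𝓝 (0 : ℂ × E), Φ p = p.1 ^ k * u p := by
  have slice : ∀ {Ψ : ℂ × E → ℂ}, AnalyticAt ℂ Ψ 0 → AnalyticAt ℂ (fun c => Ψ (c, 0)) 0 :=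
    fun h => h.comp_of_eq (analyticAt_id.prod analyticAt_const) rfl
  have tend : Tendsto (fun c : ℂ => (c, (0 : E))) (𝓝 0) (𝓝 0) :=
    (by fun_prop : Continuous fun c : ℂ => (c, (0 : E))).tendsto' 0 0 rfl
  have hnz : ∀ {Ψ : ℂ × E → ℂ}, (∀ᶠ p in 𝓝 (0 : ℂ × E), Ψ p = 0 → p.1 = 0) →
      ¬ ∀ᶠ c in 𝓝 (0 : ℂ), Ψ (c, 0) = 0 := by
    intro Ψ h hcon
    have h1 : ∀ᶠ c in 𝓝 (0:ℂ), c = 0 := by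
      filter_upwards [tend.eventually h, hcon] with c h1 h2 using h1 h2
    have h2 := h1.filter_mono (nhdsWithin_le_nhds (s := {0}ᶜ))
    obtain ⟨c, hc1, hc2⟩ := (h2.and self_mem_nhdsWithin).exists
    exact hc2 hc1
  have main : ∀ (N : ℕ) (Ψ : ℂ × E → ℂ), AnalyticAt ℂ Ψ 0 →
      (∀ᶠ p in 𝓝 (0 : ℂ × E), Ψ p = 0 → p.1 = 0) →
      analyticOrderAt (fun c => Ψ (c, 0)) 0 = N →
      ∃ (k : ℕ) (u : ℂ × E → ℂ), AnalyticAt ℂ u 0 ∧ u 0 ≠ 0 ∧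
      ∀ᶠ p in 𝓝 (0 : ℂ × E), Ψ p = p.1 ^ k * u p := by
    intro N
    induction N with
    | zero =>
      intro Ψ h1 _ h3
      exact ⟨0, Ψ, h1, (slice h1).analyticOrderAt_eq_zero.1 h3, by simp⟩
    | succ N ih =>
      intro Ψ h1 h2 h3
      have h4 : Ψ 0 = 0 := by
        by_contra h4
        rw [(slice h1).analyticOrderAt_eq_zero.2 h4] at h3
        exact absurd h3 (by exact_mod_cast (Nat.succ_ne_zero N).symm)
      obtain ⟨r, hr, h5⟩ := Metric.eventually_nhds_iff.1 h2
      have h6 : ∀ᶠ x in 𝓝 (0 : E), Ψ (0, x) = 0 := by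
        filter_upwards [eventually_exists_zero h1 h4 (hnz h2) hr,
          Metric.ball_mem_nhds (0 : E) hr] with x hx hxr
        obtain ⟨c, hc, hcz⟩ := hx
        have := h5 (y := (c, x)) (by
          rw [Prod.dist_eq]; exact max_lt hc hxr) hcz
        simp only at this
        rwa [this] at hcz
      obtain ⟨Ψ₁, h7, h8⟩ := exists_eq_fst_mul h1 h6
      have h9 : analyticOrderAt (fun c => Ψ₁ (c, 0)) 0 = N := by
        have e : (fun c => Ψ (c, 0)) =ᶠ[𝓝 0] (fun c : ℂ => c) * fun c => Ψ₁ (c, 0) := by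
          filter_upwards [tend.eventually h8] with c hc using hc
        rw [analyticOrderAt_congr e,
          analyticOrderAt_mul (f := fun c : ℂ => c) analyticAt_id (slice h7)] at h3
        have hid : analyticOrderAt (fun c : ℂ => c) 0 = 1 := by
          have := (analyticAt_id (𝕜 := ℂ) (z := (0:ℂ))).analyticOrderAt_eq_natCast (n := 1)
          refine this.2 ⟨fun _ => 1, analyticAt_const, one_ne_zero, by simp⟩
        rw [hid, add_comm] at h3
        push_cast at h3
        exact WithTop.add_right_cancel (by exact WithTop.one_ne_top) h3
      obtain ⟨k, u, hu, hu0, hk⟩ := ih Ψ₁ h7 (by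
        filter_upwards [h2, h8] with p hp2 hp8 hp
        exact hp2 (by rw [hp8, hp, mul_zero])) h9
      refine ⟨k + 1, u, hu, hu0, ?_⟩
      filter_upwards [h8, hk] with p hp hpk
      rw [hp, hpk]; ring
  have hfin : analyticOrderAt (fun c => Φ (c, 0)) 0 ≠ ⊤ := fun h =>
    hnz hz (analyticOrderAt_eq_top.1 h)
  obtain ⟨N, hN⟩ := ENat.ne_top_iff_exists.1 hfin
  exact main N Φ hΦ hz hN.symm

end OneVariable

/-! ### Straightening -/

section Straighten

lemma exists_local_inverse {E E' : Type} [NormedAddCommGroup E] [NormedSpace ℂ E] [CompleteSpace E]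
    [NormedAddCommGroup E'] [NormedSpace ℂ E'] {B : E → E'} {p : E} (hB : AnalyticAt ℂ B p)
    (e : E ≃L[ℂ] E') (he : fderiv ℂ B p = e) :
    ∃ A : E' → E, AnalyticAt ℂ A (B p) ∧ A (B p) = p ∧ (∀ᶠ x in 𝓝 p, A (B x) = x) ∧
      ∀ᶠ y in 𝓝 (B p), B (A y) = y := by
  have hs : HasStrictFDerivAt B (e : E →L[ℂ] E') p := he ▸ hB.hasStrictFDerivAt
  refine ⟨(hs.toOpenPartialHomeomorph B).symm, ?_, ?_, hs.eventually_left_inverse,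
    hs.eventually_right_inverse⟩
  · exact (hs.toOpenPartialHomeomorph B).analyticAt_symm' hs.mem_toOpenPartialHomeomorph_source hB he
  · exact (hs.toOpenPartialHomeomorph B).left_inv hs.mem_toOpenPartialHomeomorph_source

lemma exists_equiv_fst_eq {m : ℕ} {ℓ : Cn (m + 1) →L[ℂ] ℂ} (hℓ : ℓ ≠ 0) :
    ∃ L : Cn (m + 1) ≃L[ℂ] ℂ × Cn m, ∀ v, (L v).1 = ℓ v := by
  obtain ⟨π, hπ⟩ := LinearMap.exists_leftInverse_of_injective (LinearMap.ker (ℓ : Cn (m+1) →ₗ[ℂ] ℂ)).subtype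
    (Submodule.ker_subtype _)
  have hsurj : LinearMap.range (ℓ : Cn (m+1) →ₗ[ℂ] ℂ) = ⊤ := by
    refine LinearMap.range_eq_top.2 (LinearMap.surjective ?_)
    intro h; exact hℓ (ContinuousLinearMap.coe_injective h)
  have hker : Module.finrank ℂ (LinearMap.ker (ℓ : Cn (m+1) →ₗ[ℂ] ℂ)) = m := by
    have := LinearMap.finrank_range_add_finrank_ker (ℓ : Cn (m+1) →ₗ[ℂ] ℂ)
    rw [hsurj, finrank_top] at this
    simp at this
    omega
  let K : LinearMap.ker (ℓ : Cn (m+1) →ₗ[ℂ] ℂ) ≃ₗ[ℂ] Cn m :=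
    LinearEquiv.ofFinrankEq _ _ (by rw [hker]; simp)
  let T : Cn (m + 1) →ₗ[ℂ] ℂ × Cn m := (ℓ : Cn (m+1) →ₗ[ℂ] ℂ).prod (K.toLinearMap ∘ₗ π)
  have hT : Function.Injective T := by
    rw [injective_iff_map_eq_zero]
    intro x hx
    have h1 : ℓ x = 0 := congrArg Prod.fst hx
    have h2 : K (π x) = 0 := congrArg Prod.snd hx
    have h3 : π x = 0 := by simpa using h2
    have h4 := LinearMap.congr_fun hπ ⟨x, h1⟩
    simp only [LinearMap.comp_apply, Submodule.subtype_apply, LinearMap.id_apply, h3] at h4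
    exact (congrArg Subtype.val h4).symm
  let T' := LinearEquiv.ofInjectiveOfFinrankEq T hT (by simp [add_comm])
  exact ⟨T'.toContinuousLinearEquiv, fun v => rfl⟩

/-- A submersive function is the first coordinate in suitable local coordinates. -/
lemma exists_straightening {m : ℕ} {φ : Cn (m + 1) → ℂ} {p : Cn (m + 1)} (hφ : AnalyticAt ℂ φ p)
    (hφp : φ p = 0) (hd : fderiv ℂ φ p ≠ 0) :
    ∃ (A : ℂ × Cn m → Cn (m + 1)) (B : Cn (m + 1) → ℂ × Cn m),
      AnalyticAt ℂ A 0 ∧ AnalyticAt ℂ B p ∧ A 0 = p ∧ B p = 0 ∧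
      (∀ᶠ x in 𝓝 p, A (B x) = x) ∧ (∀ᶠ y in 𝓝 (0 : ℂ × Cn m), B (A y) = y) ∧
      (∀ x, (B x).1 = φ x) := by
  obtain ⟨L, hL⟩ := exists_equiv_fst_eq hd
  let B : Cn (m + 1) → ℂ × Cn m := fun x => (φ x, (L (x - p)).2)
  have hBp : B p = 0 := by simp [B, hφp]
  have hBa : AnalyticAt ℂ B p := by
    refine hφ.prod ?_
    exact ((ContinuousLinearMap.snd ℂ ℂ (Cn m)).analyticAt _).comp
      ((L.toContinuousLinearMap.analyticAt _).comp (analyticAt_id.sub analyticAt_const))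
  have hBd : fderiv ℂ B p = (L : Cn (m + 1) →L[ℂ] ℂ × Cn m) := by
    have h1 : HasFDerivAt (fun x => (L (x - p)).2)
        ((ContinuousLinearMap.snd ℂ ℂ (Cn m)).comp (L : Cn (m + 1) →L[ℂ] ℂ × Cn m)) p :=
      (((ContinuousLinearMap.snd ℂ ℂ (Cn m)).comp
        (L : Cn (m + 1) →L[ℂ] ℂ × Cn m)).hasFDerivAt).comp p ((hasFDerivAt_id p).sub_const p)
    rw [(hφ.differentiableAt.hasFDerivAt.prodMk h1).fderiv]
    ext v : 1
    exact Prod.ext (hL v).symm rfl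
  obtain ⟨A, hA, hAp, h1, h2⟩ := exists_local_inverse hBa L hBd
  rw [hBp] at hA hAp h2
  exact ⟨A, B, hA, hBa, hAp, hBp, h1, h2, fun _ => rfl⟩

end Straighten

/-! ### Jacobian matrices -/

section Jacobian

open Matrix

variable {N : ℕ}

/-- The Jacobian matrix of `g` at `x`. -/
def jac (g : Cn N → Cn N) (x : Cn N) : Matrix (Fin N) (Fin N) ℂ :=
  LinearMap.toMatrix' (fderiv ℂ g x : Cn N →ₗ[ℂ] Cn N)

lemma jac_mulVec (g : Cn N → Cn N) (x v : Cn N) : jac g x *ᵥ v = fderiv ℂ g x v := by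
  rw [jac, LinearMap.toMatrix'_mulVec]; rfl

lemma jac_apply (g : Cn N → Cn N) (x : Cn N) (i j : Fin N) :
    jac g x i j = fderiv ℂ g x (Pi.single j 1) i := by
  rw [jac, LinearMap.toMatrix'_apply]
  simp only [ContinuousLinearMap.coe_coe]

lemma AnalyticAt.jac_apply {g : Cn N → Cn N} {x : Cn N} (hg : AnalyticAt ℂ g x) (i j : Fin N) :
    AnalyticAt ℂ (fun x => jac g x i j) x := by
  simp only [_root_.jac_apply]
  exact ((ContinuousLinearMap.proj (R := ℂ) (φ := fun _ : Fin N => ℂ) i).comp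
    (ContinuousLinearMap.apply ℂ (Cn N) (Pi.single j 1 : Cn N))).analyticAt _ |>.comp hg.fderiv

variable {E : Type} [NormedAddCommGroup E] [NormedSpace ℂ E]

lemma analyticAt_det {M : E → Matrix (Fin N) (Fin N) ℂ} {x : E}
    (h : ∀ i j, AnalyticAt ℂ (fun x => M x i j) x) : AnalyticAt ℂ (fun x => (M x).det) x := by
  simp only [Matrix.det_apply']
  exact Finset.analyticAt_fun_sum _ fun σ _ => analyticAt_const.mul
    (Finset.analyticAt_fun_prod _ fun i _ => h _ _)

lemma analyticAt_adjugate {M : E → Matrix (Fin N) (Fin N) ℂ} {x : E}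
    (h : ∀ i j, AnalyticAt ℂ (fun x => M x i j) x) (i j : Fin N) :
    AnalyticAt ℂ (fun x => (M x).adjugate i j) x := by
  simp only [Matrix.adjugate_apply]
  refine analyticAt_det fun k l => ?_
  simp only [Matrix.updateRow_apply]
  split_ifs
  · exact analyticAt_const
  · exact h k l

/-- Jacobi's formula at an invertible matrix. -/
lemma fderiv_det {M : E → Matrix (Fin N) (Fin N) ℂ} {x : E}
    (h : ∀ i j, AnalyticAt ℂ (fun x => M x i j) x) (h0 : (M x).det ≠ 0) (w : E) :
    fderiv ℂ (fun x => (M x).det) x w =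
      (M x).det * ((M x)⁻¹ * Matrix.of fun i j => fderiv ℂ (fun x => M x i j) x w).trace := by
  set D : (Fin N → Fin N → ℂ) → ℂ := fun A => (Matrix.of A).det with hD
  set P : Matrix (Fin N) (Fin N) ℂ := Matrix.of fun i j => fderiv ℂ (fun x => M x i j) x w with hP
  have hDa : AnalyticAt ℂ D (fun i j => M x i j) := by
    refine analyticAt_det fun i j => ?_
    exact ((ContinuousLinearMap.proj (R := ℂ) (φ := fun _ : Fin N => ℂ) j).comp
      (ContinuousLinearMap.proj (R := ℂ) (φ := fun _ : Fin N => Fin N → ℂ) i)).analyticAt _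
  have hG : HasFDerivAt (fun x => fun i j => M x i j)
      (ContinuousLinearMap.pi fun i => ContinuousLinearMap.pi fun j =>
        fderiv ℂ (fun x => M x i j) x) x := by
    rw [hasFDerivAt_pi]
    intro i
    rw [hasFDerivAt_pi]
    intro j
    exact (h i j).differentiableAt.hasFDerivAt
  have h1 := hDa.differentiableAt.hasFDerivAt.comp x hG
  have h2 : fderiv ℂ (fun x => (M x).det) x w = fderiv ℂ D (fun i j => M x i j) (fun i j => P i j) := by
    have : (fun x => (M x).det) = D ∘ fun x => fun i j => M x i j := rfl
    rw [this, h1.fderiv]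
    rfl
  rw [h2]
  have h3 : HasDerivAt (fun t : ℂ => (fun i j => M x i j) + t • (fun i j => P i j))
      (fun i j => P i j) 0 := by
    have := ((hasDerivAt_id (0 : ℂ)).smul_const (fun i j => P i j)).const_add (fun i j => M x i j)
    simpa using this
  have h4 := hDa.differentiableAt.hasFDerivAt
  have h5 := HasFDerivAt.comp_hasDerivAt_of_eq (0 : ℂ) h4 h3 (by simp)
  have h6 : HasDerivAt (fun t : ℂ => (M x).det * (1 + ((M x)⁻¹ * P).trace * t +
      Polynomial.eval t (1 + (Polynomial.X : Polynomial ℂ) •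
        ((M x)⁻¹ * P).map Polynomial.C).det.divX.divX * t ^ 2))
      ((M x).det * ((M x)⁻¹ * P).trace) 0 := by
    have hq := (Polynomial.hasDerivAt (1 + (Polynomial.X : Polynomial ℂ) •
        ((M x)⁻¹ * P).map Polynomial.C).det.divX.divX (0 : ℂ)).mul ((hasDerivAt_id (0:ℂ)).pow 2)
    have hl := ((hasDerivAt_id (0:ℂ)).const_mul ((M x)⁻¹ * P).trace).const_add 1
    have := (hl.add hq).const_mul (M x).det
    refine this.congr_deriv ?_
    simp
  refine h5.unique (h6.congr_of_eventuallyEq (Eventually.of_forall fun t => ?_))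
  have hu : IsUnit (M x).det := isUnit_iff_ne_zero.2 h0
  show ((M x) + t • P).det = _
  beta_reduce
  rw [← Matrix.det_one_add_smul, ← Matrix.det_mul]
  congr 1
  rw [Matrix.mul_add, Matrix.mul_one, Matrix.mul_smul, ← Matrix.mul_assoc,
    Matrix.mul_nonsing_inv _ hu, Matrix.one_mul]

/-- The Piola identity: the columns of the adjugate of a Jacobian matrix are divergence free. -/
lemma piola {g : Cn N → Cn N} {x : Cn N} (hg : AnalyticAt ℂ g x) (h0 : (jac g x).det ≠ 0)
    (v : Cn N) :
    ∑ k, fderiv ℂ (fun x => ((jac g x).adjugate *ᵥ v) k) x (Pi.single k 1) = 0 := by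
  set M := jac g x with hM
  set W := M⁻¹ with hW
  have hu : IsUnit M.det := isUnit_iff_ne_zero.2 h0
  set P : Fin N → Matrix (Fin N) (Fin N) ℂ := fun k =>
    Matrix.of fun i j => fderiv ℂ (fun x => jac g x i j) x (Pi.single k 1) with hPdef
  set V : Cn N → Cn N := fun x => (jac g x).adjugate *ᵥ v with hV
  have hVa : ∀ k, AnalyticAt ℂ (fun x => V x k) x := by
    intro k
    simp only [hV, Matrix.mulVec, dotProduct]
    exact Finset.analyticAt_fun_sum _ fun j _ =>
      (analyticAt_adjugate (fun i j => hg.jac_apply i j) k j).mul analyticAt_const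
  have hsa : AnalyticAt ℂ (fun x => (jac g x).det) x := analyticAt_det fun i j => hg.jac_apply i j
  have hsymm : ∀ i j k, P k i j = P j i k := by
    intro i j k
    have h1 : ∀ a b : Fin N, fderiv ℂ (fun x => jac g x i b) x (Pi.single a 1) =
        fderiv ℂ (fderiv ℂ g) x (Pi.single a 1) (Pi.single b 1) i := by
      intro a b
      simp only [_root_.jac_apply]
      have := (((ContinuousLinearMap.proj (R := ℂ) (φ := fun _ : Fin N => ℂ) i).comp
        (ContinuousLinearMap.apply ℂ (Cn N) (Pi.single b 1 : Cn N))).hasFDerivAt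
        (x := fderiv ℂ g x)).comp x hg.fderiv.differentiableAt.hasFDerivAt
      have h2 := this.fderiv
      exact congrArg (fun L : Cn N →L[ℂ] ℂ => L (Pi.single a 1)) h2
    have h2 : IsSymmSndFDerivAt ℂ g x :=
      (hg.contDiffAt (n := ⊤)).isSymmSndFDerivAt le_top
    simp only [hPdef, Matrix.of_apply, h1]
    rw [h2.eq]
  have hprod : ∀ k, P k *ᵥ V x + M *ᵥ (fun i => fderiv ℂ (fun x => V x i) x (Pi.single k 1)) =
      fderiv ℂ (fun x => (jac g x).det) x (Pi.single k 1) • v := by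
    intro k
    funext i
    have e : (fun x => ∑ j, jac g x i j * V x j) = fun x => (jac g x).det * v i := by
      funext y
      have : jac g y *ᵥ V y = (jac g y).det • v := by
        simp only [hV]
        rw [Matrix.mulVec_mulVec, Matrix.mul_adjugate, Matrix.smul_mulVec, Matrix.one_mulVec]
      exact congrFun this i
    have h1 : HasFDerivAt (fun x => ∑ j, jac g x i j * V x j)
        (∑ j, (jac g x i j • fderiv ℂ (fun x => V x j) x +
          V x j • fderiv ℂ (fun x => jac g x i j) x)) x :=
      HasFDerivAt.fun_sum fun j _ => (hg.jac_apply i j).differentiableAt.hasFDerivAt.mul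
        (hVa j).differentiableAt.hasFDerivAt
    have h2 : HasFDerivAt (fun x => (jac g x).det * v i)
        (v i • fderiv ℂ (fun x => (jac g x).det) x) x :=
      hsa.differentiableAt.hasFDerivAt.mul_const (v i)
    rw [e] at h1
    have h3 := congrArg (fun L : Cn N →L[ℂ] ℂ => L (Pi.single k 1)) (h1.unique h2)
    simp only [_root_.sum_apply, _root_.add_apply,
      _root_.smul_apply, smul_eq_mul, Finset.sum_add_distrib] at h3
    simp only [Pi.add_apply, Pi.smul_apply, smul_eq_mul, Matrix.mulVec, dotProduct]
    rw [mul_comm _ (v i), ← h3, add_comm]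
    congr 1
    refine Finset.sum_congr rfl fun j _ => ?_
    rw [mul_comm]; rfl
  have hVW : V x = M.det • (W *ᵥ v) := by
    have : M.adjugate = M.det • W := by
      rw [hW, Matrix.inv_def, smul_smul, Ring.mul_inverse_cancel _ hu, one_smul]
    simp only [hV]
    rw [← hM, this, Matrix.smul_mulVec]
  have hder : ∀ k, fderiv ℂ (fun x => V x k) x (Pi.single k 1) =
      fderiv ℂ (fun x => (jac g x).det) x (Pi.single k 1) * (W *ᵥ v) k - (W *ᵥ (P k *ᵥ V x)) k := by
    intro k
    have h1 := congrArg (fun y => (W *ᵥ y) k) (hprod k)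
    simp only [Matrix.mulVec_add, Matrix.mulVec_mulVec (M := W) (N := M), Matrix.mulVec_smul, Pi.add_apply,
      Pi.smul_apply, smul_eq_mul] at h1
    rw [hW, Matrix.nonsing_inv_mul _ hu, Matrix.one_mulVec, ← hW] at h1
    rw [← h1]; ring
  have hjac : ∀ k, fderiv ℂ (fun x => (jac g x).det) x (Pi.single k 1) * (W *ᵥ v) k =
      (W * P k).trace * V x k := by
    intro k
    rw [fderiv_det (fun i j => hg.jac_apply i j) h0, hVW]
    simp only [Pi.smul_apply, smul_eq_mul]
    ring
  show ∑ k, fderiv ℂ (fun x => V x k) x (Pi.single k 1) = 0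
  simp only [hder, hjac, Finset.sum_sub_distrib]
  rw [sub_eq_zero]
  simp only [Matrix.trace, Matrix.diag, Matrix.mul_apply, Matrix.mulVec, dotProduct, Finset.sum_mul,
    Finset.mul_sum]
  rw [Finset.sum_comm]
  refine Finset.sum_congr rfl fun i _ => ?_
  rw [Finset.sum_comm]
  refine Finset.sum_congr rfl fun j _ => Finset.sum_congr rfl fun k _ => ?_
  rw [hsymm j i k]; ring

end Jacobian

/-! ### Integrals over the fibres of a map -/

section TraceIntegral

open MeasureTheory Matrix
open scoped ComplexConjugate

variable {N : ℕ}

/-- The pushforward under `g` of `f |det Dg|²`, smoothed by the kernel `ρ`. -/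
def traceIntegral (g : Cn N → Cn N) (r : ℝ) (ρ : Cn N → ℝ) (f : Cn N → ℂ) (y : Cn N) : ℂ :=
  ∫ x in Metric.ball (0 : Cn N) r,
    f x * ((jac g x).det * conj (jac g x).det) * (ρ (g x - y) : ℂ)

variable {g : Cn N → Cn N} {r δ : ℝ} {ρ : Cn N → ℝ} {f : Cn N → ℂ}

lemma continuousOn_weight (hg : AnalyticOnNhd ℂ g (Metric.closedBall 0 r))
    (hf : AnalyticOnNhd ℂ f (Metric.closedBall 0 r)) :
    ContinuousOn (fun x => f x * ((jac g x).det * conj (jac g x).det)) (Metric.closedBall 0 r) := by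
  intro x hx
  have hs : ContinuousAt (fun x => (jac g x).det) x :=
    (analyticAt_det fun i j => (hg x hx).jac_apply i j).continuousAt
  exact ((hf x hx).continuousAt.mul (hs.mul
    (Complex.continuous_conj.continuousAt.comp hs))).continuousWithinAt

lemma hasFDerivAt_traceIntegral (hg : AnalyticOnNhd ℂ g (Metric.closedBall 0 r))
    (hf : AnalyticOnNhd ℂ f (Metric.closedBall 0 r)) (hρ : ContDiff ℝ 1 ρ) (y : Cn N) :
    HasFDerivAt (traceIntegral g r ρ f)
      (∫ x in Metric.ball (0 : Cn N) r, (f x * ((jac g x).det * conj (jac g x).det)) •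
        (Complex.ofRealCLM.comp (-(fderiv ℝ ρ (g x - y))))) y ∧
    IntegrableOn (fun x => (f x * ((jac g x).det * conj (jac g x).det)) •
        (Complex.ofRealCLM.comp (-(fderiv ℝ ρ (g x - y))))) (Metric.ball (0 : Cn N) r) := by
  set w : Cn N → ℂ := fun x => f x * ((jac g x).det * conj (jac g x).det) with hw
  have hwc := continuousOn_weight hg hf
  have hgc : ContinuousOn g (Metric.closedBall 0 r) := fun x hx =>
    (hg x hx).continuousAt.continuousWithinAt
  have hK : IsCompact (Metric.closedBall (0 : Cn N) r) := isCompact_closedBall _ _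
  have hDρ : Continuous (fderiv ℝ ρ) := hρ.continuous_fderiv one_ne_zero
  set F' : Cn N → Cn N → (Cn N →L[ℝ] ℂ) := fun y x =>
    w x • (Complex.ofRealCLM.comp (-(fderiv ℝ ρ (g x - y)))) with hF'
  have hcont1 : ∀ y, ContinuousOn (fun x => w x * (ρ (g x - y) : ℂ)) (Metric.closedBall 0 r) := by
    intro y
    refine hwc.mul ?_
    exact (Complex.continuous_ofReal.comp hρ.continuous).comp_continuousOn (hgc.sub continuousOn_const)
  have hcont2 : ContinuousOn (fun q : Cn N × Cn N => F' q.1 q.2)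
      (Metric.closedBall y 1 ×ˢ Metric.closedBall 0 r) := by
    have h1 : ContinuousOn (fun q : Cn N × Cn N => w q.2)
        (Metric.closedBall y 1 ×ˢ Metric.closedBall 0 r) :=
      hwc.comp continuousOn_snd fun q hq => hq.2
    have h2 : ContinuousOn (fun q : Cn N × Cn N => g q.2 - q.1)
        (Metric.closedBall y 1 ×ˢ Metric.closedBall 0 r) :=
      (hgc.comp continuousOn_snd fun q hq => hq.2).sub continuousOn_fst
    have h3 : Continuous fun z : Cn N => Complex.ofRealCLM.comp (-(fderiv ℝ ρ z)) :=
      ((ContinuousLinearMap.compL ℝ (Cn N) ℝ ℂ) Complex.ofRealCLM).continuous.comp hDρ.neg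
    exact h1.smul (h3.comp_continuousOn h2)
  obtain ⟨C, hC⟩ := ((isCompact_closedBall y 1).prod hK).exists_bound_of_continuousOn hcont2
  have hInt : ∀ {G : Type} [NormedAddCommGroup G] (h : Cn N → G),
      ContinuousOn h (Metric.closedBall 0 r) → IntegrableOn h (Metric.ball 0 r) :=
    fun h hh => (hh.integrableOn_compact hK).mono_set Metric.ball_subset_closedBall
  have hint2 : IntegrableOn (F' y) (Metric.ball 0 r) :=
    hInt _ (hcont2.comp (f := fun x : Cn N => (y, x)) (by fun_prop)
      fun x hx => ⟨Metric.mem_closedBall_self zero_le_one, hx⟩)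
  refine ⟨?_, hint2⟩
  refine hasFDerivAt_integral_of_dominated_of_fderiv_le (𝕜 := ℝ)
    (F := fun y x => w x * (ρ (g x - y) : ℂ)) (F' := F') (bound := fun _ => C)
    (Metric.ball_mem_nhds y one_pos) ?_ (hInt _ (hcont1 y)) hint2.aestronglyMeasurable ?_ ?_ ?_
  · exact Eventually.of_forall fun y => (hInt _ (hcont1 y)).aestronglyMeasurable
  · refine (ae_restrict_iff' measurableSet_ball).2 (Eventually.of_forall fun x hx y' hy' => ?_)
    exact hC (y', x) ⟨Metric.ball_subset_closedBall hy', Metric.ball_subset_closedBall hx⟩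
  · have : IsFiniteMeasure (volume.restrict (Metric.ball (0 : Cn N) r)) :=
      ⟨by rw [Measure.restrict_apply_univ]; exact measure_ball_lt_top⟩
    exact integrable_const C
  · refine Eventually.of_forall fun x y' _ => ?_
    have h1 : HasFDerivAt (fun y' => g x - y') (-ContinuousLinearMap.id ℝ (Cn N)) y' :=
      (hasFDerivAt_id y').const_sub (g x)
    have h2 := ((hρ.differentiable one_ne_zero).differentiableAt (x := g x - y')).hasFDerivAt.comp y' h1
    have h3 := (Complex.ofRealCLM.hasFDerivAt.comp y' h2).const_mul (w x)
    refine h3.congr_fderiv ?_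
    ext v
    simp [hF']

lemma integral_fderiv_eq_zero {K : Cn N → ℂ} (hK : ContDiff ℝ 1 K) (hc : HasCompactSupport K)
    (v : Cn N) : ∫ x, fderiv ℝ K x v = 0 := by
  have hInt : Integrable fun x => fderiv ℝ K x v := by
    refine Continuous.integrable_of_hasCompactSupport
      ((hK.continuous_fderiv one_ne_zero).clm_apply continuous_const) ?_
    exact (hc.fderiv ℝ).comp_left (g := fun L : Cn N →L[ℝ] ℂ => L v) (by simp)
  have := integral_mul_fderiv_eq_neg_fderiv_mul_of_integrable (μ := (volume : Measure (Cn N)))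
    (f := fun _ => (1 : ℂ)) (g := K) (v := v) (by simp) (by simpa using hInt)
    (by simpa using hK.continuous.integrable_of_hasCompactSupport hc)
    (fun x _ => by fun_prop) (fun x _ => (hK.differentiable one_ne_zero).differentiableAt)
  simpa using this

/-- The antilinear part of a real-linear functional. -/
lemma antilinear_part (A : Cn N →L[ℝ] ℝ) (c : ℂ) (v : Cn N) :
    ((A (c • v) : ℂ) + Complex.I * A (Complex.I • c • v)) =
      conj c * ((A v : ℂ) + Complex.I * A (Complex.I • v)) := by
  have h1 : c • v = c.re • v + c.im • (Complex.I • v) := by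
    conv_lhs => rw [← Complex.re_add_im c]
    rw [add_smul, mul_smul]; rfl
  have h2 : Complex.I • c • v = c.re • (Complex.I • v) - c.im • v := by
    rw [h1, smul_add, smul_comm _ c.re, smul_comm _ c.im, smul_smul, Complex.I_mul_I, neg_one_smul,
      smul_neg, sub_eq_add_neg]
  have h3 : conj c = c.re - c.im * Complex.I := by
    apply Complex.ext <;> simp
  have h4 : ∀ (a : ℝ) (u : Cn N), A (a • u) = a * A u := fun a u => A.map_smul a u
  rw [h2, h1, map_add, map_sub, h4, h4, h4, h4, h3]
  push_cast
  linear_combination ((c.im : ℂ) * A (Complex.I • v)) * Complex.I_mul_I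

lemma sum_antilinear_part (A : Cn N →L[ℝ] ℝ) (L : Cn N →L[ℂ] Cn N) (V : Cn N) :
    ∑ j, conj (V j) * ((A (L (Pi.single j 1)) : ℂ) +
      Complex.I * A (Complex.I • L (Pi.single j 1))) =
      (A (L V) : ℂ) + Complex.I * A (Complex.I • L V) := by
  have hV : L V = ∑ j, V j • L (Pi.single j 1) := by
    conv_lhs => rw [pi_eq_sum_univ' V]
    rw [map_sum]
    refine Finset.sum_congr rfl fun j _ => ?_
    rw [map_smul]
  rw [hV, Finset.smul_sum, map_sum, map_sum]
  push_cast
  rw [Finset.mul_sum, ← Finset.sum_add_distrib]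
  exact Finset.sum_congr rfl fun j _ => (antilinear_part A (V j) _).symm

set_option maxHeartbeats 1000000 in
lemma integral_antilinear_part_eq_zero (hg : AnalyticOnNhd ℂ g (Metric.closedBall 0 r))
    (hf : AnalyticOnNhd ℂ f (Metric.closedBall 0 r)) (hρ : ContDiff ℝ 1 ρ)
    (hρs : ∀ w, δ < ‖w‖ → ρ w = 0) (hδ : ∀ x ∈ Metric.sphere (0 : Cn N) r, 3 * δ ≤ ‖g x‖)
    {y : Cn N} (hy : y ∈ Metric.ball 0 δ) (v : Cn N) :
    ∫ x in Metric.ball (0 : Cn N) r, f x * ((jac g x).det * conj (jac g x).det) *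
      ((fderiv ℝ ρ (g x - y) v : ℂ) + Complex.I * fderiv ℝ ρ (g x - y) (Complex.I • v)) = 0 := by
  rw [mem_ball_zero_iff] at hy
  set s : Cn N → ℂ := fun x => (jac g x).det with hs
  set V : Cn N → Cn N := fun x => (jac g x).adjugate *ᵥ v with hV
  set k : Fin N → Cn N → ℂ := fun j x => (ρ (g x - y) : ℂ) * (f x * s x * conj (V x j)) with hk
  set K : Fin N → Cn N → ℂ := fun j => (Metric.ball (0 : Cn N) r).indicator (k j) with hK
  have hsa : ∀ x ∈ Metric.closedBall (0 : Cn N) r, AnalyticAt ℂ s x := fun x hx =>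
    analyticAt_det fun i j => (hg x hx).jac_apply i j
  have hVa : ∀ x ∈ Metric.closedBall (0 : Cn N) r, ∀ j, AnalyticAt ℂ (fun x => V x j) x := by
    intro x hx j
    simp only [hV, Matrix.mulVec, dotProduct]
    exact Finset.analyticAt_fun_sum _ fun l _ =>
      (analyticAt_adjugate (fun i j => (hg x hx).jac_apply i j) j l).mul analyticAt_const
  have hin : ∀ j, ∀ x ∈ Metric.ball (0 : Cn N) r, K j =ᶠ[𝓝 x] k j := by
    intro j x hx
    filter_upwards [Metric.isOpen_ball.mem_nhds hx] with z hz
    exact indicator_of_mem hz _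
  have hout : ∀ j, ∀ x ∉ Metric.ball (0 : Cn N) r, K j =ᶠ[𝓝 x] 0 := by
    intro j x hx
    rw [mem_ball_zero_iff, not_lt] at hx
    rcases hx.eq_or_lt with hx | hx
    · have hδ' : 3 * δ ≤ ‖g x‖ := hδ x (by simp [hx])
      have hgx : ContinuousAt g x := (hg x (by simp [hx])).continuousAt
      have h1 : ∀ᶠ z in 𝓝 x, 2 * δ < ‖g z‖ :=
        hgx.norm.eventually_const_lt (by linarith [norm_nonneg y])
      filter_upwards [h1] with z hz
      by_cases hzb : z ∈ Metric.ball (0 : Cn N) r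
      · simp only [hK, indicator_of_mem hzb, hk, Pi.zero_apply]
        rw [hρs]
        · simp
        · have := norm_sub_norm_le (g z) y
          linarith
      · simp only [hK, indicator_of_notMem hzb, Pi.zero_apply]
    · filter_upwards [continuousAt_id.norm.eventually_const_lt hx] with z hz
      have : z ∉ Metric.ball (0 : Cn N) r := by
        rw [mem_ball_zero_iff, not_lt]; exact hz.le
      simp only [hK, indicator_of_notMem this, Pi.zero_apply]
  have hkC : ∀ j, ∀ x ∈ Metric.ball (0 : Cn N) r, ContDiffAt ℝ 1 (k j) x := by
    intro j x hx
    have hx' := Metric.ball_subset_closedBall hx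
    have h1 : ContDiffAt ℝ 1 (fun x => (ρ (g x - y) : ℂ)) x :=
      Complex.ofRealCLM.contDiff.contDiffAt.comp x (hρ.contDiffAt.comp x
        (((hg x hx').contDiffAt.restrict_scalars ℝ).sub contDiffAt_const))
    have h2 : ContDiffAt ℝ 1 (fun x => f x * s x) x :=
      (((hf x hx').mul (hsa x hx')).contDiffAt.restrict_scalars ℝ)
    have h3 : ContDiffAt ℝ 1 (fun x => conj (V x j)) x :=
      Complex.conjCLE.contDiff.contDiffAt.comp x ((hVa x hx' j).contDiffAt.restrict_scalars ℝ)
    exact h1.mul (h2.mul h3)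
  have hKC : ∀ j, ContDiff ℝ 1 (K j) := by
    intro j
    rw [contDiff_iff_contDiffAt]
    intro x
    by_cases hx : x ∈ Metric.ball (0 : Cn N) r
    · exact (hkC j x hx).congr_of_eventuallyEq (hin j x hx)
    · exact (contDiffAt_const (c := (0 : ℂ))).congr_of_eventuallyEq (hout j x hx)
  have hKs : ∀ j, HasCompactSupport (K j) := fun j =>
    HasCompactSupport.of_support_subset_isCompact (isCompact_closedBall (0 : Cn N) r)
      ((support_indicator_subset).trans Metric.ball_subset_closedBall)
  set D : Cn N → ℂ := fun x => ∑ j, (fderiv ℝ (K j) x (Pi.single j 1) +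
    Complex.I * fderiv ℝ (K j) x (Complex.I • (Pi.single j 1))) with hD
  have hDint : ∫ x, D x = 0 := by
    have hInt : ∀ j u, Integrable fun x => fderiv ℝ (K j) x u := by
      intro j u
      refine Continuous.integrable_of_hasCompactSupport
        (((hKC j).continuous_fderiv one_ne_zero).clm_apply continuous_const) ?_
      exact ((hKs j).fderiv ℝ).comp_left (g := fun L : Cn N →L[ℝ] ℂ => L u) (by simp)
    refine (integral_finsetSum Finset.univ
      fun j _ => (hInt j _).add ((hInt j _).const_mul _)).trans ?_
    refine Finset.sum_eq_zero fun j _ => ?_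
    refine (integral_add (hInt j _) ((hInt j _).const_mul _)).trans ?_
    rw [integral_const_mul,
      integral_fderiv_eq_zero (hKC j) (hKs j), integral_fderiv_eq_zero (hKC j) (hKs j)]
    simp
  have hDout : ∀ x ∉ Metric.ball (0 : Cn N) r, D x = 0 := by
    intro x hx
    simp only [hD]
    refine Finset.sum_eq_zero fun j _ => ?_
    rw [(hout j x hx).fderiv_eq]
    simp
  have hDin : ∀ x ∈ Metric.ball (0 : Cn N) r, D x = f x * (s x * conj (s x)) *
      ((fderiv ℝ ρ (g x - y) v : ℂ) + Complex.I * fderiv ℝ ρ (g x - y) (Complex.I • v)) := by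
    intro x hx
    have hx' := Metric.ball_subset_closedBall hx
    set A := fderiv ℝ ρ (g x - y) with hA
    set L := fderiv ℂ g x with hL
    have ha : AnalyticAt ℂ (fun x => f x * s x) x := (hf x hx').mul (hsa x hx')
    have hder : ∀ j u, fderiv ℝ (K j) x u =
        (A (L u) : ℂ) * (f x * s x * conj (V x j)) + (ρ (g x - y) : ℂ) *
          (fderiv ℂ (fun x => f x * s x) x u * conj (V x j) +
            f x * s x * conj (fderiv ℂ (fun x => V x j) x u)) := by
      intro j u
      rw [(hin j x hx).fderiv_eq]
      have h1 : HasFDerivAt (fun x => (ρ (g x - y) : ℂ))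
          (Complex.ofRealCLM.comp (A.comp (L.restrictScalars ℝ))) x :=
        Complex.ofRealCLM.hasFDerivAt.comp x
          (((hρ.differentiable one_ne_zero).differentiableAt (x := g x - y)).hasFDerivAt.comp x
            (((hg x hx').differentiableAt.hasFDerivAt.restrictScalars ℝ).sub_const y))
      have h2 := ha.differentiableAt.hasFDerivAt.restrictScalars ℝ
      have h3 : HasFDerivAt (fun x => conj (V x j))
          ((Complex.conjCLE : ℂ →L[ℝ] ℂ).comp
            ((fderiv ℂ (fun x => V x j) x).restrictScalars ℝ)) x :=
        (Complex.conjCLE : ℂ →L[ℝ] ℂ).hasFDerivAt.comp x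
          ((hVa x hx' j).differentiableAt.hasFDerivAt.restrictScalars ℝ)
      have h4 := (h1.mul (h2.mul h3)).fderiv
      have h5 := congrArg (fun T : Cn N →L[ℝ] ℂ => T u) h4
      refine h5.trans ?_
      simp
      ring
    have hLV : L (V x) = s x • v := by
      rw [hL, ← jac_mulVec, hV]
      simp only
      rw [Matrix.mulVec_mulVec, Matrix.mul_adjugate, Matrix.smul_mulVec, Matrix.one_mulVec]
    have hsum := sum_antilinear_part A L (V x)
    rw [hLV, antilinear_part] at hsum
    have hpiola : s x * conj (∑ j, fderiv ℂ (fun x => V x j) x (Pi.single j 1)) = 0 := by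
      by_cases h0 : s x = 0
      · simp [h0]
      · rw [piola (hg x hx') h0 v]; simp
    have hterm : ∀ j, fderiv ℝ (K j) x (Pi.single j 1) +
        Complex.I * fderiv ℝ (K j) x (Complex.I • (Pi.single j 1)) =
        f x * s x * (conj (V x j) * ((A (L (Pi.single j 1)) : ℂ) +
          Complex.I * A (Complex.I • L (Pi.single j 1)))) +
        2 * (ρ (g x - y) : ℂ) * f x *
          (s x * conj (fderiv ℂ (fun x => V x j) x (Pi.single j 1))) := by
      intro j
      rw [hder, hder]
      simp only [map_smul, smul_eq_mul, map_mul, Complex.conj_I]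
      linear_combination ((ρ (g x - y) : ℂ) *
        (fderiv ℂ (fun x => f x * s x) x (Pi.single j 1) * conj (V x j) -
            f x * s x * conj (fderiv ℂ (fun x => V x j) x (Pi.single j 1)))) * Complex.I_mul_I
    simp only [hD, hterm]
    rw [Finset.sum_add_distrib, ← Finset.mul_sum, ← Finset.mul_sum, hsum, ← Finset.mul_sum,
      ← map_sum, hpiola]
    ring
  rw [← setIntegral_congr_fun measurableSet_ball fun x hx => hDin x hx,
    setIntegral_eq_integral_of_forall_compl_eq_zero hDout, hDint]

lemma analyticOnNhd_traceIntegral (hg : AnalyticOnNhd ℂ g (Metric.closedBall 0 r))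
    (hf : AnalyticOnNhd ℂ f (Metric.closedBall 0 r)) (hρ : ContDiff ℝ 1 ρ)
    (hρs : ∀ w, δ < ‖w‖ → ρ w = 0) (hδ : ∀ x ∈ Metric.sphere (0 : Cn N) r, 3 * δ ≤ ‖g x‖) :
    AnalyticOnNhd ℂ (traceIntegral g r ρ f) (Metric.ball 0 δ) := by
  refine analyticOnNhd_of_differentiableOn Metric.isOpen_ball fun y hy => ?_
  obtain ⟨h1, h2⟩ := hasFDerivAt_traceIntegral hg hf hρ y
  set T' := ∫ x in Metric.ball (0 : Cn N) r, (f x * ((jac g x).det * conj (jac g x).det)) •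
        (Complex.ofRealCLM.comp (-(fderiv ℝ ρ (g x - y)))) with hT'
  have happ : ∀ v, T' v = ∫ x in Metric.ball (0 : Cn N) r,
      -(f x * ((jac g x).det * conj (jac g x).det) * (fderiv ℝ ρ (g x - y) v : ℂ)) := by
    intro v
    rw [hT', ContinuousLinearMap.integral_apply h2]
    simp
  have hInt : ∀ v, IntegrableOn (fun x => f x * ((jac g x).det * conj (jac g x).det) *
      (fderiv ℝ ρ (g x - y) v : ℂ)) (Metric.ball (0 : Cn N) r) := by
    intro v
    have := ((ContinuousLinearMap.apply ℝ ℂ v).integrable_comp h2).neg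
    refine this.congr (Eventually.of_forall fun x => ?_)
    simp
  have hI : ∀ v, T' (Complex.I • v) = Complex.I * T' v := by
    intro v
    have h3 := integral_antilinear_part_eq_zero hg hf hρ hρs hδ hy v
    simp only [mul_add, ← mul_assoc] at h3
    have h4 := hInt v
    have h5 := (hInt (Complex.I • v)).const_mul Complex.I
    rw [integral_add (by simpa only [mul_assoc, IntegrableOn] using h4)] at h3
    · have e : ∫ x in Metric.ball (0 : Cn N) r, f x * (jac g x).det * conj (jac g x).det *
          Complex.I * (fderiv ℝ ρ (g x - y) (Complex.I • v) : ℂ) = - (Complex.I * T' (Complex.I • v)) := by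
        rw [happ, integral_neg, mul_neg, neg_neg, ← integral_const_mul]
        refine integral_congr_ae (Eventually.of_forall fun x => ?_)
        simp only; ring
      have e' : ∫ x in Metric.ball (0 : Cn N) r, f x * (jac g x).det * conj (jac g x).det *
          (fderiv ℝ ρ (g x - y) v : ℂ) = - T' v := by
        rw [happ, integral_neg, neg_neg]
        simp only [mul_assoc]
      rw [e, e'] at h3
      linear_combination Complex.I * h3 + T' (Complex.I • v) * Complex.I_mul_I
    · refine h5.congr (Eventually.of_forall fun x => ?_)
      simp only; ring
  let T'' : Cn N →L[ℂ] ℂ :=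
    { toFun := T'
      map_add' := map_add T'
      map_smul' := by
        intro c v
        have : c • v = c.re • v + c.im • (Complex.I • v) := by
          conv_lhs => rw [← Complex.re_add_im c]
          rw [add_smul, mul_smul]; rfl
        rw [this, map_add, T'.map_smul, T'.map_smul, hI]
        simp only [Complex.real_smul, RingHom.id_apply, smul_eq_mul]
        linear_combination (T' v) * (Complex.re_add_im c)
      cont := T'.continuous }
  exact (hasFDerivAt_of_restrictScalars ℝ (f' := T'') h1
    rfl).differentiableAt.differentiableWithinAt

end TraceIntegral

/-! ### Regular values and local sections -/

section Sections

open MeasureTheory Matrix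

variable {N : ℕ}

lemma det_fderiv (g : Cn N → Cn N) (x : Cn N) : (fderiv ℂ g x).det = (jac g x).det := by
  rw [jac, LinearMap.det_toMatrix']

lemma det_restrictScalars_fderiv (g : Cn N → Cn N) (x : Cn N) :
    ((fderiv ℂ g x).restrictScalars ℝ).det = ‖(jac g x).det‖ ^ 2 := by
  have h := LinearMap.det_restrictScalars (R := ℝ) (f := (fderiv ℂ g x : Cn N →ₗ[ℂ] Cn N))
  rw [Algebra.norm_complex_eq] at h
  have h2 : LinearMap.det (fderiv ℂ g x : Cn N →ₗ[ℂ] Cn N) = (jac g x).det := det_fderiv g x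
  rw [h2] at h
  refine h.trans ?_
  exact Complex.normSq_eq_norm_sq _

lemma exists_local_inverse_of_det_ne_zero {g : Cn N → Cn N} {x : Cn N} (hg : AnalyticAt ℂ g x)
    (h0 : (jac g x).det ≠ 0) :
    ∃ A : Cn N → Cn N, AnalyticAt ℂ A (g x) ∧ A (g x) = x ∧ (∀ᶠ z in 𝓝 x, A (g z) = z) ∧
      ∀ᶠ y in 𝓝 (g x), g (A y) = y :=
  exists_local_inverse hg
    ((fderiv ℂ g x).toContinuousLinearEquivOfDetNeZero (by rwa [det_fderiv])) (by ext; simp)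

/-- The map `g` is proper over the ball of radius `δ` when restricted to the ball of radius `r`. -/
structure IsProperOn (g : Cn N → Cn N) (r δ : ℝ) : Prop where
  pos_source : 0 < r
  pos_target : 0 < δ
  analytic : AnalyticOnNhd ℂ g (Metric.closedBall 0 r)
  le_norm : ∀ x ∈ Metric.sphere (0 : Cn N) r, 3 * δ ≤ ‖g x‖

/-- The points of the target ball over which `g` is a local biholomorphism. -/
def regularValues (g : Cn N → Cn N) (r δ : ℝ) : Set (Cn N) :=
  {y ∈ Metric.ball 0 δ | ∀ x ∈ Metric.ball (0 : Cn N) r, g x = y → (jac g x).det ≠ 0}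

/-- Holomorphic sections `S i` of `g` over a ball which together parametrize the fibres. -/
structure FiberSections (g : Cn N → Cn N) (r : ℝ) (y : Cn N) (ε : ℝ) {d : ℕ}
    (S : Fin d → Cn N → Cn N) : Prop where
  pos : 0 < ε
  analytic : ∀ i, AnalyticOnNhd ℂ (S i) (Metric.ball y ε)
  mem_ball : ∀ i, ∀ z ∈ Metric.ball y ε, S i z ∈ Metric.ball (0 : Cn N) r
  map_eq : ∀ i, ∀ z ∈ Metric.ball y ε, g (S i z) = z
  injective : ∀ z ∈ Metric.ball y ε, Function.Injective fun i => S i z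
  exhaust : ∀ x ∈ Metric.ball (0 : Cn N) r, g x ∈ Metric.ball y ε → ∃ i, S i (g x) = x

variable {g : Cn N → Cn N} {r δ : ℝ}

lemma FiberSections.mono {y z : Cn N} {ε ε' : ℝ} {d : ℕ} {S : Fin d → Cn N → Cn N}
    (h : FiberSections g r y ε S) (hε : 0 < ε') (hs : Metric.ball z ε' ⊆ Metric.ball y ε) :
    FiberSections g r z ε' S :=
  ⟨hε, fun i => (h.analytic i).mono hs, fun i w hw => h.mem_ball i w (hs hw),
    fun i w hw => h.map_eq i w (hs hw), fun w hw => h.injective w (hs hw),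
    fun x hx hxw => h.exhaust x hx (hs hxw)⟩

namespace IsProperOn

lemma mem_ball (h : IsProperOn g r δ) {x : Cn N} (hx : x ∈ Metric.closedBall (0 : Cn N) r)
    (hy : g x ∈ Metric.ball (0 : Cn N) δ) : x ∈ Metric.ball (0 : Cn N) r := by
  rw [mem_closedBall_zero_iff] at hx
  rw [mem_ball_zero_iff] at hy ⊢
  refine hx.lt_of_ne fun hx' => ?_
  have := h.le_norm x (by simp [hx'])
  linarith [h.pos_target]

lemma continuousOn (h : IsProperOn g r δ) : ContinuousOn g (Metric.closedBall 0 r) :=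
  h.analytic.continuousOn

lemma continuousOn_det (h : IsProperOn g r δ) :
    ContinuousOn (fun x => (jac g x).det) (Metric.closedBall 0 r) := fun x hx =>
  (analyticAt_det fun i j => (h.analytic x hx).jac_apply i j).continuousAt.continuousWithinAt

lemma regularValues_eq (h : IsProperOn g r δ) : regularValues g r δ =
    Metric.ball 0 δ \ g '' {x ∈ Metric.closedBall (0 : Cn N) r | (jac g x).det = 0} := by
  ext y
  constructor
  · rintro ⟨hy, hy'⟩
    refine ⟨hy, ?_⟩
    rintro ⟨x, ⟨hx, hx0⟩, rfl⟩
    exact hy' x (h.mem_ball hx hy) rfl hx0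
  · rintro ⟨hy, hy'⟩
    exact ⟨hy, fun x hx hxy h0 => hy' ⟨x, ⟨Metric.ball_subset_closedBall hx, h0⟩, hxy⟩⟩

lemma isCompact_critical (h : IsProperOn g r δ) :
    IsCompact {x ∈ Metric.closedBall (0 : Cn N) r | (jac g x).det = 0} :=
  (isCompact_closedBall (0 : Cn N) r).of_isClosed_subset
    (h.continuousOn_det.preimage_isClosed_of_isClosed Metric.isClosed_closedBall isClosed_singleton)
    fun _ hx => hx.1

lemma isOpen_regularValues (h : IsProperOn g r δ) : IsOpen (regularValues g r δ) := by
  rw [h.regularValues_eq]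
  exact Metric.isOpen_ball.sdiff (h.isCompact_critical.image_of_continuousOn
    (h.continuousOn.mono fun _ hx => hx.1)).isClosed

lemma exists_mem_regularValues (h : IsProperOn g r δ) {O : Set (Cn N)} (hO : IsOpen O)
    {y : Cn N} (hy : y ∈ O) (hyδ : y ∈ Metric.ball 0 δ) : ∃ z ∈ O, z ∈ regularValues g r δ := by
  set C := {x ∈ Metric.closedBall (0 : Cn N) r | (jac g x).det = 0} with hC
  have h1 : volume (g '' C) = 0 := by
    refine addHaar_image_eq_zero_of_det_fderivWithin_eq_zero (μ := volume)
      (f' := fun x => (fderiv ℂ g x).restrictScalars ℝ) ?_ ?_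
    · intro x hx
      exact ((h.analytic x hx.1).differentiableAt.hasFDerivAt.restrictScalars ℝ).hasFDerivWithinAt
    · intro x hx
      rw [det_restrictScalars_fderiv, hx.2]; simp
  have h2 : Dense {y | y ∉ g '' C} := Measure.dense_of_ae (measure_eq_zero_iff_ae_notMem.1 h1)
  obtain ⟨z, hz, hz'⟩ := h2.inter_open_nonempty _ (hO.inter Metric.isOpen_ball) ⟨y, hy, hyδ⟩
  exact ⟨z, hz.1, by rw [h.regularValues_eq]; exact ⟨hz.2, hz'⟩⟩

lemma exists_fiberSections (h : IsProperOn g r δ) {y : Cn N} (hy : y ∈ regularValues g r δ) :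
    ∃ (d : ℕ) (ε : ℝ) (S : Fin d → Cn N → Cn N), FiberSections g r y ε S ∧
      Metric.ball y ε ⊆ regularValues g r δ := by
  classical
  set F := {x ∈ Metric.closedBall (0 : Cn N) r | g x = y} with hF
  have hFb : ∀ x ∈ F, x ∈ Metric.ball (0 : Cn N) r := fun x hx =>
    h.mem_ball hx.1 (by rw [hx.2]; exact hy.1)
  have hFc : IsCompact F := (isCompact_closedBall (0 : Cn N) r).of_isClosed_subset
    (h.continuousOn.preimage_isClosed_of_isClosed Metric.isClosed_closedBall isClosed_singleton)
    fun _ hx => hx.1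
  have hinv : ∀ x ∈ F, ∃ A : Cn N → Cn N, AnalyticAt ℂ A y ∧ A y = x ∧
      (∀ᶠ z in 𝓝 x, A (g z) = z) ∧ ∀ᶠ z in 𝓝 y, g (A z) = z := by
    intro x hx
    have := exists_local_inverse_of_det_ne_zero (h.analytic x hx.1) (hy.2 x (hFb x hx) hx.2)
    rwa [hx.2] at this
  have hFfin : F.Finite := by
    obtain ⟨t, -, ht⟩ := hFc.elim_nhds_subcover (fun x => {z | g z = y → z = x}) (by
      intro x hx
      obtain ⟨A, -, hA, hA', -⟩ := hinv x hx
      filter_upwards [hA'] with z hz hzy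
      rw [← hz, hzy, hA])
    refine t.finite_toSet.subset fun x hx => ?_
    obtain ⟨z, hz, hxz⟩ := mem_iUnion₂.1 (ht hx)
    rw [show x = z from hxz hx.2]
    exact hz
  let e := hFfin.toFinset.equivFin
  have hsymm : ∀ i, ((e.symm i : hFfin.toFinset) : Cn N) ∈ F := fun i =>
    hFfin.mem_toFinset.1 (e.symm i).2
  choose! A hA1 hA2 hA3 hA4 using hinv
  let S : Fin _ → Cn N → Cn N := fun i => A (e.symm i)
  have hmem : ∀ i, ∀ᶠ z in 𝓝 y, S i z ∈ Metric.ball (0 : Cn N) r := by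
    intro i
    have hc := (hA1 _ (hsymm i)).continuousAt
    exact hc.eventually_mem (Metric.isOpen_ball.mem_nhds
      (by rw [hA2 _ (hsymm i)]; exact hFb _ (hsymm i)))
  have hinj : ∀ i j, i ≠ j → ∀ᶠ z in 𝓝 y, S i z ≠ S j z := by
    intro i j hij
    refine ((hA1 _ (hsymm i)).continuousAt.ne_iff_eventually_ne
      (hA1 _ (hsymm j)).continuousAt).1 ?_
    rw [hA2 _ (hsymm i), hA2 _ (hsymm j)]
    exact fun hh => hij (e.symm.injective (Subtype.ext hh))
  have hexh : ∀ᶠ z in 𝓝 y, ∀ x ∈ Metric.closedBall (0 : Cn N) r, g x = z → ∃ i, S i z = x := by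
    refine (isCompact_closedBall (0 : Cn N) r).eventually_forall_of_forall_eventually
      fun x hx => ?_
    by_cases hxy : g x = y
    · have hxF : x ∈ F := ⟨hx, hxy⟩
      have h1 : ∀ᶠ q : Cn N × Cn N in 𝓝 (y, x), A x (g q.2) = q.2 :=
        (continuous_snd.tendsto (y, x)).eventually (hA3 x hxF)
      filter_upwards [h1] with q hq hgq
      refine ⟨e ⟨x, hFfin.mem_toFinset.2 hxF⟩, ?_⟩
      simp only [S, Equiv.symm_apply_apply]
      rw [← hgq, hq]
    · have hgx : ContinuousAt (fun q : Cn N × Cn N => g q.2) (y, x) :=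
        ContinuousAt.comp (f := Prod.snd) (x := (y, x)) (g := g)
          (h.analytic x hx).continuousAt continuousAt_snd
      filter_upwards [(hgx.ne_iff_eventually_ne (continuousAt_fst (p := (y, x)))).1 hxy] with q hq hgq
      exact absurd hgq hq
  have hev : ∀ᶠ z in 𝓝 y, z ∈ regularValues g r δ ∧ (∀ i, AnalyticAt ℂ (S i) z) ∧
      (∀ i, S i z ∈ Metric.ball (0 : Cn N) r) ∧ (∀ i, g (S i z) = z) ∧
      (∀ i j, i ≠ j → S i z ≠ S j z) ∧
      ∀ x ∈ Metric.closedBall (0 : Cn N) r, g x = z → ∃ i, S i z = x := by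
    refine (h.isOpen_regularValues.eventually_mem hy).and (.and ?_ (.and ?_ (.and ?_ (.and ?_ hexh))))
    · exact eventually_all.2 fun i => (hA1 _ (hsymm i)).eventually_analyticAt
    · exact eventually_all.2 hmem
    · exact eventually_all.2 fun i => hA4 _ (hsymm i)
    · refine eventually_all.2 fun i => eventually_all.2 fun j => ?_
      by_cases hij : i = j
      · exact Eventually.of_forall fun _ h => absurd hij h
      · filter_upwards [hinj i j hij] with z hz _ using hz
  obtain ⟨ε, hε, hb⟩ := Metric.eventually_nhds_iff_ball.1 hev
  refine ⟨_, ε, S, ⟨hε, fun i z hz => (hb z hz).2.1 i, fun i z hz => (hb z hz).2.2.1 i,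
    fun i z hz => (hb z hz).2.2.2.1 i, fun z hz i j hij => ?_, fun x hx hxz => ?_⟩,
    fun z hz => (hb z hz).1⟩
  · by_contra hne
    exact (hb z hz).2.2.2.2.1 i j hne hij
  · exact (hb _ hxz).2.2.2.2.2 x (Metric.ball_subset_closedBall hx) rfl

end IsProperOn

end Sections

/-! ### The trace of a holomorphic function -/

section Trace

open MeasureTheory Matrix

variable {N : ℕ}

/-- A smooth kernel supported in the closed ball of radius `ε`, invariant under multiplication by
unit complex numbers. -/
def kernel (N : ℕ) (ε : ℝ) (z : Cn N) : ℝ :=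
  Real.smoothTransition (1 - ∑ j, Complex.normSq (z j) / ε ^ 2)

lemma contDiff_kernel (ε : ℝ) : ContDiff ℝ 1 (kernel N ε) := by
  have h : ContDiff ℝ 1 Real.smoothTransition := Real.smoothTransition.contDiff (n := 1)
  refine h.comp (contDiff_const.sub (ContDiff.sum fun j _ => ?_))
  refine ContDiff.div_const ?_ _
  have h2 : (fun z : Cn N => Complex.normSq (z j)) = fun z : Cn N => ‖z j‖ ^ 2 := by
    funext z; exact Complex.normSq_eq_norm_sq _
  rw [h2]
  have h3 : ContDiff ℝ 1 fun z : Cn N => z j := contDiff_apply ℝ ℂ j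
  exact h3.norm_sq ℝ

lemma kernel_nonneg (ε : ℝ) (z : Cn N) : 0 ≤ kernel N ε z := Real.smoothTransition.nonneg _

lemma kernel_eq_zero {ε : ℝ} (hε : 0 < ε) {z : Cn N} (hz : ε < ‖z‖) : kernel N ε z = 0 := by
  refine Real.smoothTransition.zero_of_nonpos ?_
  obtain ⟨j, hj⟩ : ∃ j, ε < ‖z j‖ := by
    by_contra! hcon
    exact absurd ((pi_norm_le_iff_of_nonneg hε.le).2 hcon) (not_le.2 hz)
  have h1 : Complex.normSq (z j) / ε ^ 2 ≤ ∑ j, Complex.normSq (z j) / ε ^ 2 :=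
    Finset.single_le_sum (f := fun j => Complex.normSq (z j) / ε ^ 2)
      (fun i _ => div_nonneg (Complex.normSq_nonneg _) (sq_nonneg _)) (Finset.mem_univ j)
  have h2 : 1 ≤ Complex.normSq (z j) / ε ^ 2 := by
    rw [one_le_div (by positivity), Complex.normSq_eq_norm_sq]
    gcongr
  linarith

lemma kernel_rotate (ε : ℝ) {c : ℂ} (hc : ‖c‖ = 1) (z : Cn N) : kernel N ε (c • z) = kernel N ε z := by
  have h : Complex.normSq c = 1 := by rw [Complex.normSq_eq_norm_sq, hc]; norm_num
  simp [kernel, h]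

lemma hasCompactSupport_kernel {ε : ℝ} (hε : 0 < ε) : HasCompactSupport (kernel N ε) := by
  refine HasCompactSupport.intro (isCompact_closedBall (0 : Cn N) ε) fun z hz => ?_
  rw [mem_closedBall_zero_iff, not_le] at hz
  exact kernel_eq_zero hε hz

lemma integral_kernel_pos {ε : ℝ} (hε : 0 < ε) : 0 < ∫ z, kernel N ε z := by
  refine (contDiff_kernel ε).continuous.integral_pos_of_hasCompactSupport_nonneg_nonzero
    (x := 0) (hasCompactSupport_kernel hε) (kernel_nonneg ε) ?_
  have : kernel N ε 0 = 1 := by simp [kernel]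
  rw [this]; exact one_ne_zero

lemma measurePreserving_rotate {c : ℂ} (hc : ‖c‖ = 1) :
    MeasurePreserving (fun z : Cn N => c • z) volume volume := by
  have h1 : MeasurePreserving (fun z : ℂ => c * z) volume volume := by
    have := (rotation ⟨c, by simp [Submonoid.unitSphere, hc]⟩).measurePreserving
    exact this
  exact volume_preserving_pi fun _ : Fin N => h1

/-- The mean value property. -/
lemma integral_mul_kernel {h : Cn N → ℂ} {y : Cn N} {R ε : ℝ} (hε : 0 < ε) (hR : 2 * ε ≤ R)
    (hh : AnalyticOnNhd ℂ h (Metric.ball y R)) :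
    ∫ z in Metric.ball y R, h z * (kernel N ε (z - y) : ℂ) =
      h y * ((∫ z, kernel N ε z : ℝ) : ℂ) := by
  set K := Metric.closedBall (0 : Cn N) ε with hK
  have hKc : IsCompact K := isCompact_closedBall _ _
  have hcs : CompactSpace K := isCompact_iff_compactSpace.1 hKc
  set Φ : ℂ → ℂ := fun c => ∫ z in K, h (y + c • z) * (kernel N ε z : ℂ) with hΦ
  have hmem : ∀ z ∈ K, ∀ c ∈ Metric.ball (0 : ℂ) 2, y + c • z ∈ Metric.ball y R := by
    intro z hz c hc
    rw [mem_closedBall_zero_iff] at hz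
    rw [mem_ball_zero_iff] at hc
    rw [mem_ball_iff_norm, add_sub_cancel_left, norm_smul]
    rcases (norm_nonneg z).eq_or_lt with h0 | h0
    · rw [← h0]; linarith
    · nlinarith [norm_nonneg c]
  have hΦa : AnalyticOnNhd ℂ Φ (Metric.ball 0 2) := by
    have hfin : IsFiniteMeasure (Measure.comap ((↑) : K → Cn N) volume) := by
      refine ⟨?_⟩
      rw [comap_subtype_coe_apply hKc.measurableSet, image_univ, Subtype.range_coe]
      exact hKc.measure_lt_top
    have := analyticOnNhd_integral_of_compactSpace (T := K)
      (Measure.comap ((↑) : K → Cn N) volume)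
      (H := fun z c => h (y + c • (z : Cn N)) * (kernel N ε z : ℂ)) (U := Metric.ball (0 : ℂ) 2)
      Metric.isOpen_ball ?_ ?_
    · refine this.congr Metric.isOpen_ball fun c _ => ?_
      exact integral_subtype_comap hKc.measurableSet
        (fun z => h (y + c • z) * (kernel N ε z : ℂ))
    · refine ContinuousOn.mul ?_ ?_
      · refine hh.continuousOn.comp (f := fun q : K × ℂ => y + q.2 • (q.1 : Cn N)) (by fun_prop) ?_
        rintro ⟨z, c⟩ ⟨-, hc⟩
        exact hmem z z.2 c hc
      · have := (contDiff_kernel (N := N) ε).continuous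
        exact (Complex.continuous_ofReal.comp
          (this.comp (continuous_subtype_val.comp continuous_fst))).continuousOn
    · intro z c hc
      refine DifferentiableAt.differentiableWithinAt ?_
      refine DifferentiableAt.mul_const ?_ _
      exact DifferentiableAt.comp (g := h) (f := fun c : ℂ => y + c • (z : Cn N)) c
        (hh _ (hmem z z.2 c hc)).differentiableAt (by fun_prop)
  have hrot : ∀ c ∈ Metric.sphere (0 : ℂ) 1, Φ c = Φ 1 := by
    intro c hc
    have hc1 : ‖c‖ = 1 := by simpa using hc
    have hme : MeasurableEmbedding fun z : Cn N => c • z := by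
      have hc0 : c ≠ 0 := by rintro rfl; simp at hc1
      exact (Homeomorph.smulOfNeZero c hc0).measurableEmbedding
    have h1 := (measurePreserving_rotate (N := N) hc1).setIntegral_preimage_emb hme
      (fun z => h (y + z) * (kernel N ε z : ℂ)) K
    have h2 : (fun z : Cn N => c • z) ⁻¹' K = K := by
      ext z
      simp [hK, norm_smul, hc1]
    rw [h2] at h1
    simp only [kernel_rotate ε hc1] at h1
    simp only [hΦ, one_smul]
    exact h1
  have h0 : Φ 0 = Φ 1 := by
    have hdc : DiffContOnCl ℂ Φ (Metric.ball 0 |1|) := by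
      refine DifferentiableOn.diffContOnCl ?_
      rw [abs_one, closure_ball _ one_ne_zero]
      exact hΦa.differentiableOn.mono (Metric.closedBall_subset_ball one_lt_two)
    rw [← hdc.circleAverage]
    exact Real.circleAverage_const_on_circle (by rw [abs_one]; exact hrot)
  have hΦ0 : Φ 0 = h y * ((∫ z, kernel N ε z : ℝ) : ℂ) := by
    simp only [hΦ, zero_smul, add_zero]
    rw [integral_const_mul, integral_complex_ofReal, setIntegral_eq_integral_of_forall_compl_eq_zero]
    intro z hz
    rw [mem_closedBall_zero_iff, not_le] at hz
    exact kernel_eq_zero hε hz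
  have hΦ1 : Φ 1 = ∫ z in Metric.ball y R, h z * (kernel N ε (z - y) : ℂ) := by
    have h1 := (measurePreserving_add_left (volume : Measure (Cn N)) y).setIntegral_preimage_emb
      (measurableEmbedding_addLeft y)
      (fun z => h z * (kernel N ε (z - y) : ℂ)) (Metric.ball y R)
    simp only [add_sub_cancel_left] at h1
    rw [← h1]
    simp only [hΦ, one_smul]
    refine (setIntegral_eq_of_subset_of_forall_sdiff_eq_zero ?_ ?_ ?_).symm
    · exact (measurable_const_add y) measurableSet_ball
    · intro z hz
      have := hmem z hz 1 (by simp)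
      rwa [one_smul] at this
    · rintro z ⟨-, hz⟩
      rw [mem_closedBall_zero_iff, not_le] at hz
      rw [kernel_eq_zero hε hz]; simp
  rw [← hΦ1, ← h0, hΦ0]

variable {g : Cn N → Cn N} {r δ : ℝ} {f : Cn N → ℂ}

lemma IsProperOn.traceIntegral_eq_sum (h : IsProperOn g r δ)
    (hf : AnalyticOnNhd ℂ f (Metric.closedBall 0 r)) {y : Cn N} {R ε : ℝ} {d : ℕ}
    {S : Fin d → Cn N → Cn N} (hS : FiberSections g r y R S) (hε : 0 < ε) (hR : 2 * ε ≤ R) :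
    traceIntegral g r (kernel N ε) f y =
      (∑ i, f (S i y)) * ((∫ z, kernel N ε z : ℝ) : ℂ) := by
  set k : Cn N → ℂ := fun x => f x * ((jac g x).det * star (jac g x).det) *
    (kernel N ε (g x - y) : ℂ) with hk
  set A : Fin d → Set (Cn N) := fun i => S i '' Metric.ball y R with hA
  have hAsub : ∀ i, A i ⊆ Metric.ball 0 r := by
    rintro i _ ⟨z, hz, rfl⟩
    exact hS.mem_ball i z hz
  have hSinj : ∀ i, InjOn (S i) (Metric.ball y R) := by
    intro i z hz z' hz' hzz
    rw [← hS.map_eq i z hz, ← hS.map_eq i z' hz', hzz]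
  have hAm : ∀ i, MeasurableSet (A i) := fun i =>
    measurableSet_ball.image_of_continuousOn_injOn (hS.analytic i).continuousOn (hSinj i)
  have hginj : ∀ i, InjOn g (A i) := by
    rintro i _ ⟨z, hz, rfl⟩ _ ⟨z', hz', rfl⟩ hzz
    rw [hS.map_eq i z hz, hS.map_eq i z' hz'] at hzz
    rw [hzz]
  have hgA : ∀ i, g '' A i = Metric.ball y R := by
    intro i
    ext z
    constructor
    · rintro ⟨_, ⟨z', hz', rfl⟩, rfl⟩
      rwa [hS.map_eq i z' hz']
    · intro hz
      exact ⟨S i z, mem_image_of_mem _ hz, hS.map_eq i z hz⟩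
  have hdisj : Pairwise (Function.onFun Disjoint A) := by
    intro i j hij
    rw [Function.onFun, Set.disjoint_left]
    rintro _ ⟨z, hz, rfl⟩ ⟨z', hz', hzz⟩
    have h1 : z' = z := by
      rw [← hS.map_eq i z hz, ← hS.map_eq j z' hz', hzz]
    subst h1
    exact hij (hS.injective z' hz hzz.symm)
  have hkint : IntegrableOn k (Metric.ball 0 r) := by
    have hc : ContinuousOn k (Metric.closedBall 0 r) := by
      refine (continuousOn_weight h.analytic hf).mul ?_
      exact (Complex.continuous_ofReal.comp (contDiff_kernel (N := N) ε).continuous).comp_continuousOn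
        (h.continuousOn.sub continuousOn_const)
    exact (hc.integrableOn_compact (isCompact_closedBall _ _)).mono_set Metric.ball_subset_closedBall
  have h1 : traceIntegral g r (kernel N ε) f y = ∫ x in ⋃ i, A i, k x := by
    refine setIntegral_eq_of_subset_of_forall_sdiff_eq_zero measurableSet_ball
      (iUnion_subset hAsub) ?_
    rintro x ⟨hx, hxA⟩
    rw [kernel_eq_zero hε, Complex.ofReal_zero, mul_zero]
    by_contra hcon
    have hgx : g x ∈ Metric.ball y R := by
      rw [mem_ball_iff_norm]
      linarith [hS.pos]
    obtain ⟨i, hi⟩ := hS.exhaust x hx hgx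
    exact hxA (mem_iUnion.2 ⟨i, g x, hgx, hi⟩)
  rw [h1, integral_iUnion_fintype hAm hdisj fun i => hkint.mono_set (hAsub i), Finset.sum_mul]
  refine Finset.sum_congr rfl fun i _ => ?_
  have hfS : AnalyticOnNhd ℂ (fun z => f (S i z)) (Metric.ball y R) := fun z hz =>
    (hf _ (Metric.ball_subset_closedBall (hS.mem_ball i z hz))).comp (hS.analytic i z hz)
  rw [← integral_mul_kernel hε hR hfS, ← hgA i,
    integral_image_eq_integral_abs_det_fderiv_smul volume (hAm i) (fun x hx =>
      ((h.analytic x (Metric.ball_subset_closedBall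
        (hAsub i hx))).differentiableAt.hasFDerivAt.restrictScalars ℝ).hasFDerivWithinAt) (hginj i)]
  refine setIntegral_congr_fun (hAm i) ?_
  rintro _ ⟨z, hz, rfl⟩
  simp only [hk, det_restrictScalars_fderiv, hS.map_eq i z hz]
  rw [abs_of_nonneg (sq_nonneg _), Complex.real_smul]
  have : (jac g (S i z)).det * star (jac g (S i z)).det = ((‖(jac g (S i z)).det‖ ^ 2 : ℝ) : ℂ) := by
    rw [Complex.star_def, Complex.mul_conj, Complex.normSq_eq_norm_sq]
  rw [this]
  ring

/-- The trace of `f` along the fibres of `g` is holomorphic. -/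
theorem IsProperOn.exists_trace (h : IsProperOn g r δ)
    (hf : AnalyticOnNhd ℂ f (Metric.closedBall 0 r)) :
    ∃ T : Cn N → ℂ, AnalyticOnNhd ℂ T (Metric.ball 0 δ) ∧
      ∀ (y : Cn N) (ε : ℝ) (d : ℕ) (S : Fin d → Cn N → Cn N), y ∈ Metric.ball 0 δ →
        FiberSections g r y ε S → T y = ∑ i, f (S i y) := by
  set T : ℝ → Cn N → ℂ := fun ε y =>
    traceIntegral g r (kernel N ε) f y / ((∫ z, kernel N ε z : ℝ) : ℂ) with hT
  have hTa : ∀ ε, 0 < ε → ε ≤ δ → AnalyticOnNhd ℂ (T ε) (Metric.ball 0 δ) := by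
    intro ε hε hεδ y hy
    refine (analyticOnNhd_traceIntegral h.analytic hf (contDiff_kernel ε)
      (fun w hw => kernel_eq_zero hε (hεδ.trans_lt hw)) h.le_norm y hy).div analyticAt_const ?_
    exact_mod_cast (integral_kernel_pos hε).ne'
  have hTs : ∀ (y : Cn N) (R ε : ℝ) (d : ℕ) (S : Fin d → Cn N → Cn N), FiberSections g r y R S →
      0 < ε → 2 * ε ≤ R → T ε y = ∑ i, f (S i y) := by
    intro y R ε d S hS hε hR
    simp only [hT]
    rw [h.traceIntegral_eq_sum hf hS hε hR, mul_div_cancel_right₀]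
    exact_mod_cast (integral_kernel_pos hε).ne'
  obtain ⟨y₀, -, hy₀⟩ := h.exists_mem_regularValues isOpen_univ (mem_univ (0 : Cn N))
    (Metric.mem_ball_self h.pos_target)
  obtain ⟨d₀, R₀, S₀, hS₀, hR₀⟩ := h.exists_fiberSections hy₀
  have hagree : ∀ ε, 0 < ε → ε ≤ δ → ∀ ε', 0 < ε' → ε' ≤ δ → 4 * ε ≤ R₀ → 4 * ε' ≤ R₀ →
      EqOn (T ε) (T ε') (Metric.ball 0 δ) := by
    intro ε hε hεδ ε' hε' hεδ' h4 h4'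
    refine (hTa ε hε hεδ).eqOn_of_preconnected_of_eventuallyEq (hTa ε' hε' hεδ')
      (convex_ball _ _).isPreconnected hy₀.1 ?_
    filter_upwards [Metric.ball_mem_nhds y₀ (half_pos hS₀.pos)] with y hy
    have hS : FiberSections g r y (R₀ / 2) S₀ := by
      refine hS₀.mono (half_pos hS₀.pos) (Metric.ball_subset_ball' ?_)
      rw [Metric.mem_ball] at hy
      linarith
    rw [hTs y _ ε d₀ S₀ hS hε (by linarith), hTs y _ ε' d₀ S₀ hS hε' (by linarith)]
  set ε₀ := min δ (R₀ / 4) with hε₀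
  have hε₀p : 0 < ε₀ := lt_min h.pos_target (by linarith [hS₀.pos])
  have h1 : ε₀ ≤ δ := min_le_left _ _
  have h2 : ε₀ ≤ R₀ / 4 := min_le_right _ _
  refine ⟨T ε₀, hTa ε₀ hε₀p h1, fun y ε d S hy hS => ?_⟩
  set ε₁ := min ε₀ (ε / 2) with hε₁
  have hε₁p : 0 < ε₁ := lt_min hε₀p (by linarith [hS.pos])
  have h3 : ε₁ ≤ ε₀ := min_le_left _ _
  have h4 : ε₁ ≤ ε / 2 := min_le_right _ _
  rw [hagree ε₀ hε₀p h1 ε₁ hε₁p (h3.trans h1) (by linarith) (by linarith) hy]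
  exact hTs y ε ε₁ d S hS hε₁p (by linarith)

end Trace

/-! ### Monic polynomials with prescribed power sums -/

section PowerSums

open Polynomial

lemma exists_eval_psum_eq_esymm (d k : ℕ) : ∃ E : MvPolynomial ℕ ℂ, ∀ a : Fin d → ℂ,
    MvPolynomial.eval (fun j => ∑ i, a i ^ j) E =
      MvPolynomial.aeval a (MvPolynomial.esymm (Fin d) ℂ k) := by
  induction k using Nat.strong_induction_on with
  | _ k ih =>
  rcases Nat.eq_zero_or_pos k with rfl | hk
  · exact ⟨1, fun a => by simp⟩
  choose! E hE using ih
  refine ⟨MvPolynomial.C ((k : ℂ)⁻¹ * (-1) ^ (k + 1)) *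
    ∑ a ∈ Finset.HasAntidiagonal.antidiagonal k with a.1 < k,
      MvPolynomial.C ((-1) ^ a.1) * E a.1 * MvPolynomial.X a.2, fun a => ?_⟩
  have h := congrArg (MvPolynomial.aeval a) (MvPolynomial.mul_esymm_eq_sum (Fin d) ℂ k)
  have hk0 : (k : ℂ) ≠ 0 := by exact_mod_cast hk.ne'
  simp only [map_mul, map_natCast, map_pow, map_neg, map_one, map_sum] at h
  have h' : MvPolynomial.aeval a (MvPolynomial.esymm (Fin d) ℂ k) = (k : ℂ)⁻¹ *
      ((k : ℂ) * MvPolynomial.aeval a (MvPolynomial.esymm (Fin d) ℂ k)) := by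
    rw [inv_mul_cancel_left₀ hk0]
  rw [h', h, map_mul, MvPolynomial.eval_C, map_sum, mul_assoc]
  congr 2
  refine Finset.sum_congr rfl fun b hb => ?_
  rw [map_mul, map_mul, MvPolynomial.eval_C, MvPolynomial.eval_X,
    hE b.1 (Finset.mem_filter.1 hb).2]
  simp [MvPolynomial.psum]

lemma exists_eval_psum_eq_coeff (d k : ℕ) : ∃ E : MvPolynomial ℕ ℂ, k < d → ∀ a : Fin d → ℂ,
    MvPolynomial.eval (fun j => ∑ i, a i ^ j) E = (∏ i, (X - C (a i))).coeff k := by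
  obtain ⟨E, hE⟩ := exists_eval_psum_eq_esymm d (d - k)
  refine ⟨MvPolynomial.C ((-1) ^ (d - k)) * E, fun hk a => ?_⟩
  have h := Multiset.prod_X_sub_C_coeff (Finset.univ.val.map a) (k := k) (by simpa using hk.le)
  rw [Multiset.map_map] at h
  rw [map_mul, MvPolynomial.eval_C, hE, MvPolynomial.aeval_esymm_eq_multiset_esymm]
  refine Eq.trans ?_ h.symm
  simp

/-- The monic polynomial of degree `d` whose roots have the power sums `p`. -/
def polyOfPowerSums (d : ℕ) (p : ℕ → ℂ) : ℂ[X] :=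
  X ^ d + ∑ k ∈ Finset.range d,
    C (MvPolynomial.eval p (exists_eval_psum_eq_coeff d k).choose) * X ^ k

lemma degree_sum_lt (d : ℕ) (c : ℕ → ℂ) :
    (∑ k ∈ Finset.range d, C (c k) * X ^ k).degree < (d : WithBot ℕ) := by
  refine lt_of_le_of_lt (degree_sum_le _ _) ((Finset.sup_lt_iff (WithBot.bot_lt_coe d)).2 ?_)
  intro k hk
  exact lt_of_le_of_lt (degree_C_mul_X_pow_le k _) (WithBot.coe_lt_coe.2 (Finset.mem_range.1 hk))

lemma polyOfPowerSums_monic (d : ℕ) (p : ℕ → ℂ) : (polyOfPowerSums d p).Monic :=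
  monic_X_pow_add (degree_sum_lt d _)

lemma polyOfPowerSums_natDegree (d : ℕ) (p : ℕ → ℂ) : (polyOfPowerSums d p).natDegree = d := by
  rw [polyOfPowerSums, natDegree_add_eq_left_of_degree_lt, natDegree_X_pow]
  rw [degree_X_pow]
  exact degree_sum_lt d _

lemma polyOfPowerSums_eq {d : ℕ} {p : ℕ → ℂ} {a : Fin d → ℂ} (h : ∀ j, p j = ∑ i, a i ^ j) :
    polyOfPowerSums d p = ∏ i, (X - C (a i)) := by
  have hp : p = fun j => ∑ i, a i ^ j := funext h
  have hm : (∏ i, (X - C (a i))).Monic := monic_prod_X_sub_C a _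
  have hd : (∏ i, (X - C (a i))).natDegree = d := by
    rw [natDegree_prod_of_monic _ _ fun i _ => monic_X_sub_C _]; simp
  have h1 := hm.as_sum
  rw [hd] at h1
  rw [h1, polyOfPowerSums]
  congr 1
  refine Finset.sum_congr rfl fun k hk => ?_
  rw [hp, (exists_eval_psum_eq_coeff d k).choose_spec (Finset.mem_range.1 hk) a]

end PowerSums

/-! ### Holomorphic families of polynomials -/

section Family

open Polynomial

variable {E : Type} [NormedAddCommGroup E] [NormedSpace ℂ E]

/-- A family of polynomials of bounded degree with holomorphic coefficients. -/
def AnalyticFamily (P : E → ℂ[X]) (D : Set E) : Prop :=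
  (∃ d, ∀ y, (P y).natDegree ≤ d) ∧ ∀ k, AnalyticOnNhd ℂ (fun y => (P y).coeff k) D

lemma AnalyticFamily.iterate_derivative {P : E → ℂ[X]} {D : Set E} (h : AnalyticFamily P D)
    (i : ℕ) : AnalyticFamily (fun y => derivative^[i] (P y)) D := by
  obtain ⟨⟨d, hd⟩, hc⟩ := h
  refine ⟨⟨d, fun y => (natDegree_iterate_derivative _ _).trans
    ((Nat.sub_le _ _).trans (hd y))⟩, fun k y hy => ?_⟩
  simp only [coeff_iterate_derivative, nsmul_eq_mul]
  exact analyticAt_const.mul (hc _ y hy)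

lemma AnalyticFamily.eval {P : E → ℂ[X]} {D : Set E} (h : AnalyticFamily P D)
    {E' : Type} [NormedAddCommGroup E'] [NormedSpace ℂ E'] {u : E' → E} {t : E' → ℂ} {x : E'}
    (hu : AnalyticAt ℂ u x) (ht : AnalyticAt ℂ t x) (hx : u x ∈ D) :
    AnalyticAt ℂ (fun x => (P (u x)).eval (t x)) x := by
  obtain ⟨⟨d, hd⟩, hc⟩ := h
  have h1 : (fun x => (P (u x)).eval (t x)) =
      fun x => ∑ k ∈ Finset.range (d + 1), (P (u x)).coeff k * t x ^ k :=
    funext fun x => eval_eq_sum_range' (Nat.lt_succ_of_le (hd _)) _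
  rw [h1]
  exact Finset.analyticAt_fun_sum _ fun k _ => ((hc k _ hx).comp hu).mul (ht.pow k)

lemma AnalyticFamily.of_powerSums {d : ℕ} {p : E → ℕ → ℂ} {D : Set E}
    (h : ∀ j, AnalyticOnNhd ℂ (fun y => p y j) D) :
    AnalyticFamily (fun y => polyOfPowerSums d (p y)) D := by
  have hE : ∀ F : MvPolynomial ℕ ℂ, AnalyticOnNhd ℂ (fun y => MvPolynomial.eval (p y) F) D := by
    intro F y hy
    induction F using MvPolynomial.induction_on with
    | C a => simpa using analyticAt_const
    | add F G hF hG =>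
      simp only [map_add]
      exact hF.fun_add hG
    | mul_X F i hF =>
      simp only [map_mul, MvPolynomial.eval_X]
      exact hF.fun_mul (h i y hy)
  refine ⟨⟨d, fun y => (polyOfPowerSums_natDegree d _).le⟩, fun k y hy => ?_⟩
  simp only [polyOfPowerSums, coeff_add, finsetSum_coeff, coeff_C_mul]
  exact analyticAt_const.add (Finset.analyticAt_fun_sum _ fun i _ => (hE _ y hy).mul analyticAt_const)

end Family

/-! ### Degree, surjectivity and characteristic polynomials -/

section Degree

open Polynomial

variable {N : ℕ} {g : Cn N → Cn N} {r δ : ℝ} {f : Cn N → ℂ}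

namespace IsProperOn

lemma mono (h : IsProperOn g r δ) {δ' : ℝ} (h0 : 0 < δ') (h1 : δ' ≤ δ) : IsProperOn g r δ' :=
  ⟨h.pos_source, h0, h.analytic, fun x hx => le_trans (by linarith) (h.le_norm x hx)⟩

lemma exists_degree (h : IsProperOn g r δ) : ∃ d : ℕ, ∀ (y : Cn N) (ε : ℝ) (d' : ℕ)
    (S : Fin d' → Cn N → Cn N), y ∈ Metric.ball 0 δ → FiberSections g r y ε S → d' = d := by
  obtain ⟨T, hT, hTs⟩ := h.exists_trace (f := fun _ => 1) fun _ _ => analyticAt_const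
  obtain ⟨y₀, -, hy₀⟩ := h.exists_mem_regularValues isOpen_univ (mem_univ (0 : Cn N))
    (Metric.mem_ball_self h.pos_target)
  obtain ⟨d₀, R₀, S₀, hS₀, hR₀⟩ := h.exists_fiberSections hy₀
  have hconst : EqOn T (fun _ => (d₀ : ℂ)) (Metric.ball 0 δ) := by
    refine hT.eqOn_of_preconnected_of_eventuallyEq (fun _ _ => analyticAt_const)
      (convex_ball _ _).isPreconnected hy₀.1 ?_
    filter_upwards [Metric.ball_mem_nhds y₀ (half_pos hS₀.pos)] with y hy
    have hsub : Metric.ball y (R₀ / 2) ⊆ Metric.ball y₀ R₀ := by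
      refine Metric.ball_subset_ball' ?_
      rw [Metric.mem_ball] at hy
      linarith
    have hS : FiberSections g r y (R₀ / 2) S₀ := hS₀.mono (half_pos hS₀.pos) hsub
    rw [hTs y _ d₀ S₀ (hR₀ (hsub (Metric.mem_ball_self (half_pos hS₀.pos)))).1 hS]
    simp
  refine ⟨d₀, fun y ε d' S hy hS => ?_⟩
  have h1 := hTs y ε d' S hy hS
  rw [hconst hy] at h1
  simp only [Finset.sum_const, Finset.card_univ, Fintype.card_fin, nsmul_eq_mul, mul_one] at h1
  exact_mod_cast h1.symm

lemma exists_regular_near (h : IsProperOn g r δ) {x : Cn N} (hx : x ∈ Metric.ball (0 : Cn N) r)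
    (hgx : g x ∈ Metric.ball (0 : Cn N) δ) (hdet : (jac g x).det ≠ 0) {O : Set (Cn N)}
    (hO : IsOpen O) (hxO : x ∈ O) :
    ∃ z ∈ O, z ∈ Metric.ball (0 : Cn N) r ∧ g z ∈ regularValues g r δ := by
  obtain ⟨A, hA, hAx, -, hgA⟩ := exists_local_inverse_of_det_ne_zero
    (h.analytic x (Metric.ball_subset_closedBall hx)) hdet
  have h1 : ∀ᶠ y in 𝓝 (g x), g (A y) = y ∧ A y ∈ O ∩ Metric.ball 0 r :=
    hgA.and (hA.continuousAt.eventually_mem ((hO.inter Metric.isOpen_ball).mem_nhds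
      (by rw [hAx]; exact ⟨hxO, hx⟩)))
  obtain ⟨V, hV, hVo, hxV⟩ := eventually_nhds_iff.1 h1
  obtain ⟨y, hyV, hyR⟩ := h.exists_mem_regularValues hVo hxV hgx
  obtain ⟨h2, h3⟩ := hV y hyV
  exact ⟨A y, h3.1, h3.2, by rwa [h2]⟩

lemma surjOn_of_det_ne_zero (h : IsProperOn g r δ) {x : Cn N} (hx : x ∈ Metric.ball (0 : Cn N) r)
    (hgx : g x ∈ Metric.ball (0 : Cn N) δ) (hdet : (jac g x).det ≠ 0) {y : Cn N}
    (hy : y ∈ Metric.ball (0 : Cn N) δ) : ∃ z ∈ Metric.ball (0 : Cn N) r, g z = y := by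
  obtain ⟨d, hd⟩ := h.exists_degree
  have hd0 : 0 < d := by
    obtain ⟨z, -, hz, hgz⟩ := h.exists_regular_near hx hgx hdet isOpen_univ (mem_univ x)
    obtain ⟨d', ε, S, hS, -⟩ := h.exists_fiberSections hgz
    obtain ⟨i, -⟩ := hS.exhaust z hz (Metric.mem_ball_self hS.pos)
    rw [← hd _ _ _ _ hgz.1 hS]
    exact i.pos
  have hcl : IsClosed (g '' Metric.closedBall (0 : Cn N) r) :=
    ((isCompact_closedBall (0 : Cn N) r).image_of_continuousOn h.continuousOn).isClosed
  have hmem : y ∈ g '' Metric.closedBall (0 : Cn N) r := by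
    rw [← hcl.closure_eq, mem_closure_iff]
    intro O hO hyO
    obtain ⟨w, hwO, hwR⟩ := h.exists_mem_regularValues hO hyO hy
    obtain ⟨d', ε, S, hS, -⟩ := h.exists_fiberSections hwR
    have : d' = d := hd _ _ _ _ hwR.1 hS
    subst this
    have hw := Metric.mem_ball_self (x := w) hS.pos
    exact ⟨w, hwO, S ⟨0, hd0⟩ w, Metric.ball_subset_closedBall (hS.mem_ball _ w hw),
      hS.map_eq _ w hw⟩
  obtain ⟨z, hz, rfl⟩ := hmem
  exact ⟨z, h.mem_ball hz hy, rfl⟩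

lemma exists_small_det_ne_zero (M : Matrix (Fin N) (Fin N) ℂ) {η : ℝ} (hη : 0 < η) :
    ∃ t : ℝ, 0 < t ∧ t < η ∧ (M + (t : ℂ) • (1 : Matrix (Fin N) (Fin N) ℂ)).det ≠ 0 := by
  classical
  have hne : (-M).charpoly ≠ 0 := ((-M).charpoly_monic).ne_zero
  have hinf : ((fun t : ℝ => (t : ℂ)) '' Ioo 0 η).Infinite :=
    (Ioo_infinite hη).image Complex.ofReal_injective.injOn
  obtain ⟨_, ⟨t, ht, rfl⟩, htr⟩ := hinf.exists_notMem_finset (-M).charpoly.roots.toFinset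
  refine ⟨t, ht.1, ht.2, fun h0 => htr ?_⟩
  rw [Multiset.mem_toFinset, mem_roots hne, IsRoot, Matrix.eval_charpoly, sub_neg_eq_add, add_comm,
    ← h0]
  congr 2
  ext i j
  simp [Matrix.scalar_apply, Matrix.diagonal_apply, Matrix.one_apply]

lemma closedBall_subset_image (h : IsProperOn g r δ) (hg0 : g 0 = 0) {y : Cn N}
    (hy : y ∈ Metric.ball (0 : Cn N) (δ / 2)) : ∃ z ∈ Metric.ball (0 : Cn N) r, g z = y := by
  have hcl : IsClosed (g '' Metric.closedBall (0 : Cn N) r) :=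
    ((isCompact_closedBall (0 : Cn N) r).image_of_continuousOn h.continuousOn).isClosed
  have hδ := h.pos_target
  have hr := h.pos_source
  have hmem : y ∈ g '' Metric.closedBall (0 : Cn N) r := by
    rw [← hcl.closure_eq, Metric.mem_closure_iff]
    intro η hη
    obtain ⟨t, ht0, ht, hdet⟩ := exists_small_det_ne_zero (jac g 0)
      (η := min (η / r) (δ / r)) (lt_min (by positivity) (by positivity))
    have ht1 : t * r < η := by
      have := ht.trans_le (min_le_left _ _)
      rwa [lt_div_iff₀ hr] at this
    have ht2 : t * r < δ := by
      have := ht.trans_le (min_le_right _ _)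
      rwa [lt_div_iff₀ hr] at this
    have hG : IsProperOn (fun x => g x + (t : ℂ) • x) r (δ / 2) := by
      refine ⟨hr, half_pos hδ, fun x hx => (h.analytic x hx).fun_add
          (((t : ℂ) • ContinuousLinearMap.id ℂ (Cn N)).analyticAt x),
        fun x hx => ?_⟩
      have h1 := h.le_norm x hx
      have h2 := norm_sub_le (g x + (t : ℂ) • x) ((t : ℂ) • x)
      rw [add_sub_cancel_right, norm_smul, Complex.norm_real, Real.norm_of_nonneg ht0.le,
        mem_sphere_zero_iff_norm.1 hx] at h2
      linarith
    have hjac : jac (fun x => g x + (t : ℂ) • x) 0 = jac g 0 + (t : ℂ) • 1 := by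
      have h1 : fderiv ℂ (fun x => g x + (t : ℂ) • x) 0 =
          fderiv ℂ g 0 + (t : ℂ) • ContinuousLinearMap.id ℂ (Cn N) := by
        have h2 : HasFDerivAt (fun x : Cn N => (t : ℂ) • x) ((t : ℂ) • ContinuousLinearMap.id ℂ (Cn N)) 0 :=
          (hasFDerivAt_id (0 : Cn N)).const_smul (t : ℂ)
        exact ((h.analytic 0 (by simp [hr.le])).differentiableAt.hasFDerivAt.add h2).fderiv
      ext i j
      rw [jac_apply, h1]
      simp [jac_apply, Matrix.one_apply, Pi.single_apply]
    obtain ⟨z, hz, hzy⟩ := hG.surjOn_of_det_ne_zero (x := 0) (Metric.mem_ball_self hr)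
      (by simpa [hg0] using hδ) (by rwa [hjac]) hy
    refine ⟨g z, mem_image_of_mem _ (Metric.ball_subset_closedBall hz), ?_⟩
    rw [← hzy, dist_eq_norm]
    simp only [add_sub_cancel_left, norm_smul, Complex.norm_real, Real.norm_of_nonneg ht0.le]
    rw [mem_ball_zero_iff] at hz
    nlinarith
  obtain ⟨z, hz, rfl⟩ := hmem
  exact ⟨z, h.mem_ball hz (Metric.ball_subset_ball (by linarith) hy), rfl⟩

lemma exists_det_ne_zero (h : IsProperOn g r δ) (hg0 : g 0 = 0) :
    ∃ x ∈ Metric.ball (0 : Cn N) r, g x ∈ Metric.ball (0 : Cn N) δ ∧ (jac g x).det ≠ 0 := by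
  have hδ := h.pos_target
  obtain ⟨y, hy, hyR⟩ := h.exists_mem_regularValues (Metric.isOpen_ball (x := (0 : Cn N)) (ε := δ / 2))
    (Metric.mem_ball_self (half_pos hδ)) (Metric.mem_ball_self hδ)
  obtain ⟨z, hz, rfl⟩ := h.closedBall_subset_image hg0 hy
  exact ⟨z, hz, hyR.1, hyR.2 z hz rfl⟩

lemma surjOn (h : IsProperOn g r δ) (hg0 : g 0 = 0) {y : Cn N}
    (hy : y ∈ Metric.ball (0 : Cn N) δ) : ∃ z ∈ Metric.ball (0 : Cn N) r, g z = y := by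
  obtain ⟨x, hx, hgx, hdet⟩ := h.exists_det_ne_zero hg0
  exact h.surjOn_of_det_ne_zero hx hgx hdet hy

lemma exists_det_ne_zero_near (h : IsProperOn g r δ) (hg0 : g 0 = 0) {x : Cn N}
    (hx : x ∈ Metric.ball (0 : Cn N) r) {O : Set (Cn N)} (hO : IsOpen O) (hxO : x ∈ O) :
    ∃ z ∈ O, z ∈ Metric.ball (0 : Cn N) r ∧ (jac g z).det ≠ 0 := by
  by_contra! hcon
  obtain ⟨x₀, hx₀, -, hdet⟩ := h.exists_det_ne_zero hg0
  refine hdet ?_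
  have ha : AnalyticOnNhd ℂ (fun x => (jac g x).det) (Metric.ball 0 r) := fun z hz =>
    analyticAt_det fun i j => (h.analytic z (Metric.ball_subset_closedBall hz)).jac_apply i j
  refine ha.eqOn_zero_of_preconnected_of_eventuallyEq_zero (convex_ball _ _).isPreconnected hx ?_ hx₀
  filter_upwards [hO.mem_nhds hxO, Metric.isOpen_ball.mem_nhds hx] with z hz hz'
  exact hcon z hz hz'

lemma exists_map_mem_regularValues (h : IsProperOn g r δ) (hg0 : g 0 = 0) {x : Cn N}
    (hx : x ∈ Metric.ball (0 : Cn N) r) (hgx : g x ∈ Metric.ball (0 : Cn N) δ) {O : Set (Cn N)}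
    (hO : IsOpen O) (hxO : x ∈ O) :
    ∃ z ∈ O, z ∈ Metric.ball (0 : Cn N) r ∧ g z ∈ regularValues g r δ := by
  have hgc : ContinuousAt g x := (h.analytic x (Metric.ball_subset_closedBall hx)).continuousAt
  obtain ⟨V, hV, hVo, hxV⟩ := eventually_nhds_iff.1
    (hgc.eventually_mem (Metric.isOpen_ball.mem_nhds hgx))
  obtain ⟨z, hz, hzr, hdet⟩ := h.exists_det_ne_zero_near hg0 hx (hO.inter hVo) ⟨hxO, hxV⟩
  exact h.exists_regular_near hzr (hV z hz.2) hdet hO hz.1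

/-- The characteristic polynomial of a holomorphic function along the fibres of `g`. -/
theorem exists_charpoly (h : IsProperOn g r δ) (hg0 : g 0 = 0)
    (hf : AnalyticOnNhd ℂ f (Metric.closedBall 0 r)) :
    ∃ (d : ℕ) (T : Cn N → ℕ → ℂ) (P : Cn N → ℂ[X]), 0 < d ∧
      (∀ j, AnalyticOnNhd ℂ (fun y => T y j) (Metric.ball 0 δ)) ∧
      AnalyticFamily P (Metric.ball 0 δ) ∧ (∀ y, (P y).Monic) ∧
      (∀ (y : Cn N) (ε : ℝ) (d' : ℕ) (S : Fin d' → Cn N → Cn N), y ∈ Metric.ball 0 δ →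
        FiberSections g r y ε S → d' = d ∧ (∀ j, T y j = ∑ i, f (S i y) ^ j) ∧
          P y = ∏ i, (X - C (f (S i y)))) ∧
      ∀ y ∈ Metric.ball 0 δ, ∀ t, (P y).eval t = 0 ↔
        ∃ x ∈ Metric.ball (0 : Cn N) r, g x = y ∧ f x = t := by
  obtain ⟨d, hd⟩ := h.exists_degree
  choose T hTa hTs using fun j : ℕ => h.exists_trace (f := fun x => f x ^ j)
    fun x hx => (hf x hx).fun_pow j
  set P : Cn N → ℂ[X] := fun y => polyOfPowerSums d fun j => T j y with hP
  have hfam : AnalyticFamily P (Metric.ball 0 δ) :=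
    AnalyticFamily.of_powerSums (p := fun y j => T j y) hTa
  have hsec : ∀ (y : Cn N) (ε : ℝ) (d' : ℕ) (S : Fin d' → Cn N → Cn N), y ∈ Metric.ball 0 δ →
      FiberSections g r y ε S → d' = d ∧ (∀ j, T j y = ∑ i, f (S i y) ^ j) ∧
        P y = ∏ i, (X - C (f (S i y))) := by
    intro y ε d' S hy hS
    have hdd := hd y ε d' S hy hS
    subst hdd
    have h1 : ∀ j, T j y = ∑ i, f (S i y) ^ j := fun j => hTs j y ε d' S hy hS
    exact ⟨rfl, h1, polyOfPowerSums_eq h1⟩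
  have hdpos : 0 < d := by
    obtain ⟨x, hx, hgx, hdet⟩ := h.exists_det_ne_zero hg0
    obtain ⟨z, -, hz, hgz⟩ := h.exists_regular_near hx hgx hdet isOpen_univ (mem_univ x)
    obtain ⟨d', ε, S, hS, -⟩ := h.exists_fiberSections hgz
    obtain ⟨i, -⟩ := hS.exhaust z hz (Metric.mem_ball_self hS.pos)
    rw [← hd _ _ _ _ hgz.1 hS]
    exact i.pos
  refine ⟨d, fun y j => T j y, P, hdpos, hTa, hfam, fun y => polyOfPowerSums_monic d _, hsec,
    fun y hy t => ⟨fun h0 => ?_, ?_⟩⟩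
  · set K := {x ∈ Metric.closedBall (0 : Cn N) r | f x = t} with hK
    have hKc : IsCompact K := (isCompact_closedBall (0 : Cn N) r).of_isClosed_subset
      (hf.continuousOn.preimage_isClosed_of_isClosed Metric.isClosed_closedBall isClosed_singleton)
      fun _ hx => hx.1
    by_contra! hcon
    have hfib : ∀ x ∈ Metric.closedBall (0 : Cn N) r, g x = y → f x ≠ t := fun x hx hxy =>
      hcon x (h.mem_ball hx (by rwa [hxy])) hxy
    obtain ⟨c, hc0, hc⟩ : ∃ c > 0, ∀ᶠ z in 𝓝 y, ∀ x ∈ Metric.closedBall (0 : Cn N) r,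
        g x = z → c < ‖t - f x‖ := by
      have hyK : ∀ᶠ z in 𝓝 y, ∀ x ∈ Metric.closedBall (0 : Cn N) r, g x = z → f x ≠ t := by
        have hcl : IsClosed (g '' K) := (hKc.image_of_continuousOn
          (h.continuousOn.mono fun _ hx => hx.1)).isClosed
        have hyn : y ∉ g '' K := by
          rintro ⟨x, hx, hxy⟩
          exact hfib x hx.1 hxy hx.2
        filter_upwards [hcl.isOpen_compl.mem_nhds hyn] with z hz x hx hxz hxt
        exact hz ⟨x, ⟨hx, hxt⟩, hxz⟩
      obtain ⟨ε, hε, hεb⟩ := Metric.nhds_basis_closedBall.eventually_iff.1 hyK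
      have hKc' : IsCompact {x ∈ Metric.closedBall (0 : Cn N) r | g x ∈ Metric.closedBall y ε} :=
        (isCompact_closedBall (0 : Cn N) r).of_isClosed_subset
          (h.continuousOn.preimage_isClosed_of_isClosed Metric.isClosed_closedBall
            Metric.isClosed_closedBall) fun _ hx => hx.1
      have hcont : ContinuousOn (fun x => ‖t - f x‖)
          {x ∈ Metric.closedBall (0 : Cn N) r | g x ∈ Metric.closedBall y ε} :=
        (continuousOn_const.sub (hf.continuousOn.mono fun _ hx => hx.1)).norm
      obtain ⟨c, hc0, hc⟩ : ∃ c > 0, ∀ x ∈ {x ∈ Metric.closedBall (0 : Cn N) r |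
          g x ∈ Metric.closedBall y ε}, c ≤ ‖t - f x‖ := by
        rcases eq_empty_or_nonempty {x ∈ Metric.closedBall (0 : Cn N) r |
          g x ∈ Metric.closedBall y ε} with he | hne
        · exact ⟨1, one_pos, fun x hx => absurd hx (by rw [he]; exact notMem_empty x)⟩
        · obtain ⟨x₀, hx₀, hmin⟩ := hKc'.exists_isMinOn hne hcont
          refine ⟨‖t - f x₀‖, norm_pos_iff.2 (sub_ne_zero.2 ?_), fun x hx => hmin hx⟩
          exact (hεb hx₀.2 x₀ hx₀.1 rfl).symm
      refine ⟨c / 2, half_pos hc0, ?_⟩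
      filter_upwards [Metric.closedBall_mem_nhds y hε] with z hz x hx hxz
      have := hc x ⟨hx, by rwa [hxz]⟩
      linarith
    have hcont : ContinuousAt (fun z => (P z).eval t) y :=
      (hfam.eval (u := fun z => z) analyticAt_id analyticAt_const hy).continuousAt
    have hsmall : ∀ᶠ z in 𝓝 y, ‖(P z).eval t‖ < c ^ d := by
      refine hcont.norm.eventually_lt_const ?_
      show ‖(P y).eval t‖ < c ^ d
      rw [h0, norm_zero]
      positivity
    obtain ⟨V, hV, hVo, hyV⟩ := eventually_nhds_iff.1 (hsmall.and hc)
    obtain ⟨z, hzV, hzR⟩ := h.exists_mem_regularValues hVo hyV hy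
    obtain ⟨d', ε, S, hS, -⟩ := h.exists_fiberSections hzR
    obtain ⟨rfl, -, hPz⟩ := hsec z ε d' S hzR.1 hS
    obtain ⟨hz1, hz2⟩ := hV z hzV
    rw [hPz, eval_prod, norm_prod] at hz1
    have hzb := Metric.mem_ball_self (x := z) hS.pos
    have h2 : c ^ d' ≤ ∏ i, ‖(X - C (f (S i z))).eval t‖ := by
      have := Finset.prod_le_prod (s := (Finset.univ : Finset (Fin d'))) (f := fun _ => c)
        (g := fun i => ‖(X - C (f (S i z))).eval t‖) (fun _ _ => hc0.le) (fun i _ => by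
          simp only [eval_sub, eval_X, eval_C]
          exact (hz2 _ (Metric.ball_subset_closedBall (hS.mem_ball i z hzb))
            (hS.map_eq i z hzb)).le)
      simpa using this
    linarith
  · rintro ⟨x, hx, rfl, rfl⟩
    by_contra hne
    have hxc := Metric.ball_subset_closedBall hx
    have hcont : ContinuousAt (fun x => (P (g x)).eval (f x)) x :=
      (hfam.eval (h.analytic x hxc) (hf x hxc) hy).continuousAt
    obtain ⟨V, hV, hVo, hxV⟩ := eventually_nhds_iff.1 (hcont.eventually_ne hne)
    obtain ⟨z, hzV, hz, hgz⟩ := h.exists_map_mem_regularValues hg0 hx hy hVo hxV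
    refine hV z hzV ?_
    obtain ⟨d', ε, S, hS, -⟩ := h.exists_fiberSections hgz
    obtain ⟨-, -, hPz⟩ := hsec _ ε d' S hgz.1 hS
    obtain ⟨i, hi⟩ := hS.exhaust z hz (Metric.mem_ball_self hS.pos)
    rw [hPz, eval_prod]
    refine Finset.prod_eq_zero (Finset.mem_univ i) ?_
    rw [hi]; simp

end IsProperOn

end Degree

/-! ### Finite germs -/

section FiniteGerm

variable {N : ℕ} {g : Cn N → Cn N}

/-- A holomorphic map germ at `0` whose only zero near `0` is `0`. -/
structure IsFiniteGerm (g : Cn N → Cn N) : Prop where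
  analytic : AnalyticAt ℂ g 0
  map_zero : g 0 = 0
  eq_zero : ∀ᶠ x in 𝓝 (0 : Cn N), g x = 0 → x = 0

lemma IsProperOn.exists_preimage_subset {r δ : ℝ} (h : IsProperOn g r δ)
    (hz : ∀ x ∈ Metric.closedBall (0 : Cn N) r, g x = 0 → x = 0) {O : Set (Cn N)}
    (hO : O ∈ 𝓝 (0 : Cn N)) :
    ∃ δ', 0 < δ' ∧ δ' ≤ δ ∧ ∀ x ∈ Metric.ball (0 : Cn N) r,
      g x ∈ Metric.ball (0 : Cn N) δ' → x ∈ O := by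
  have hK : IsCompact (Metric.closedBall (0 : Cn N) r \ interior O) :=
    (isCompact_closedBall _ _).diff isOpen_interior
  rcases (Metric.closedBall (0 : Cn N) r \ interior O).eq_empty_or_nonempty with he | hne
  · refine ⟨δ, h.pos_target, le_rfl, fun x hx _ => ?_⟩
    by_contra hxO
    exact (he ▸ (⟨Metric.ball_subset_closedBall hx, fun hi => hxO (interior_subset hi)⟩ :
      x ∈ Metric.closedBall (0 : Cn N) r \ interior O) : x ∈ (∅ : Set (Cn N)))
  · obtain ⟨x₀, hx₀, hmin⟩ := hK.exists_isMinOn hne (h.continuousOn.norm.mono sdiff_subset)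
    have hpos : 0 < ‖g x₀‖ := norm_pos_iff.2 fun h0 => hx₀.2 (by
      rw [hz x₀ hx₀.1 h0]; exact mem_interior_iff_mem_nhds.2 hO)
    refine ⟨min δ ‖g x₀‖, lt_min h.pos_target hpos, min_le_left _ _, fun x hx hgx => ?_⟩
    by_contra hxO
    have h1 : ‖g x₀‖ ≤ ‖g x‖ :=
      hmin ⟨Metric.ball_subset_closedBall hx, fun hi => hxO (interior_subset hi)⟩
    rw [mem_ball_zero_iff] at hgx
    exact absurd (hgx.trans_le (min_le_right _ _)) (not_lt.2 h1)

namespace IsFiniteGerm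

lemma exists_isProperOn (h : IsFiniteGerm g) {O : Set (Cn N)} (hO : O ∈ 𝓝 (0 : Cn N)) :
    ∃ r δ, IsProperOn g r δ ∧ Metric.closedBall (0 : Cn N) r ⊆ O ∧
      ∀ x ∈ Metric.closedBall (0 : Cn N) r, g x = 0 → x = 0 := by
  obtain ⟨r, hr, hsub⟩ := Metric.nhds_basis_closedBall.mem_iff.1
    (inter_mem hO (inter_mem h.analytic.eventually_analyticAt h.eq_zero))
  have hc : ContinuousOn g (Metric.sphere 0 r) := fun x hx =>
    (hsub (Metric.sphere_subset_closedBall hx)).2.1.continuousAt.continuousWithinAt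
  have hδ : ∃ c > 0, ∀ x ∈ Metric.sphere (0 : Cn N) r, c ≤ ‖g x‖ := by
    rcases (Metric.sphere (0 : Cn N) r).eq_empty_or_nonempty with he | hne
    · exact ⟨1, one_pos, by simp [he]⟩
    · obtain ⟨x₀, hx₀, hmin⟩ := (isCompact_sphere (0 : Cn N) r).exists_isMinOn hne hc.norm
      refine ⟨‖g x₀‖, norm_pos_iff.2 fun h0 => ?_, fun x hx => hmin hx⟩
      have h1 := (hsub (Metric.sphere_subset_closedBall hx₀)).2.2 h0
      rw [h1, mem_sphere_zero_iff_norm, norm_zero] at hx₀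
      exact hr.ne hx₀
  obtain ⟨c, hc0, hcx⟩ := hδ
  exact ⟨r, c / 3, ⟨hr, by positivity, fun x hx => (hsub hx).2.1, fun x hx => by
    linarith [hcx x hx]⟩, fun x hx => (hsub hx).1, fun x hx => (hsub hx).2.2⟩

lemma map_nhds (h : IsFiniteGerm g) : map g (𝓝 0) = 𝓝 0 := by
  refine le_antisymm ?_ fun s hs => ?_
  · simpa [Tendsto, ContinuousAt, h.map_zero] using h.analytic.continuousAt
  · obtain ⟨r, δ, hp, hrs, -⟩ := h.exists_isProperOn (mem_map.1 hs)
    filter_upwards [Metric.ball_mem_nhds (0 : Cn N) hp.pos_target] with y hy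
    obtain ⟨z, hz, rfl⟩ := hp.surjOn h.map_zero hy
    exact hrs (Metric.ball_subset_closedBall hz)

lemma tendsto (h : IsFiniteGerm g) : Tendsto g (𝓝 0) (𝓝 0) := h.map_nhds.le

lemma eventually_map_iff (h : IsFiniteGerm g) {p : Cn N → Prop} :
    (∀ᶠ x in 𝓝 0, p (g x)) ↔ ∀ᶠ y in 𝓝 0, p y := by
  conv_rhs => rw [← h.map_nhds, eventually_map]

lemma not_eventually_det_eq_zero (h : IsFiniteGerm g) {x : Cn N} {r δ : ℝ}
    (hp : IsProperOn g r δ) (hx : x ∈ Metric.ball (0 : Cn N) r) :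
    ∃ᶠ z in 𝓝 x, (jac g z).det ≠ 0 := by
  rw [frequently_iff]
  intro O hO
  obtain ⟨O', hO', hOo, hxO⟩ := mem_nhds_iff.1 hO
  obtain ⟨z, hz, -, hd⟩ := hp.exists_det_ne_zero_near h.map_zero hx hOo hxO
  exact ⟨z, hO' hz, hd⟩

end IsFiniteGerm

end FiniteGerm

/-! ### Linear differential equations in the complex domain -/

section Picard

open MeasureTheory

lemma analyticOnNhd_of_tendstoUniformlyOn {E F : Type} [NormedAddCommGroup E] [NormedSpace ℂ E]
    [FiniteDimensional ℂ E] [NormedAddCommGroup F] [NormedSpace ℂ F] [CompleteSpace F]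
    {u : ℕ → E → F} {f : E → F} {D : Set E} (hD : IsOpen D) (h : TendstoUniformlyOn u f atTop D)
    (hu : ∀ k, AnalyticOnNhd ℂ (u k) D) : AnalyticOnNhd ℂ f D := by
  refine LineHolomorphic.analyticOnNhd (fun x hx v => ?_) hD
    (h.continuousOn (Frequently.of_forall fun k => (hu k).continuousOn))
  have hl : Continuous fun t : ℂ => x + t • v := by fun_prop
  have h1 := (h.comp fun t : ℂ => x + t • v).tendstoLocallyUniformlyOn.differentiableOn
    (Eventually.of_forall fun k t ht => ?_) (hD.preimage hl)
  · exact h1.differentiableAt ((hD.preimage hl).mem_nhds (by simpa using hx))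
  · exact (DifferentiableAt.comp t (hu k _ ht).differentiableAt
      (by fun_prop : DifferentiableAt ℂ (fun t : ℂ => x + t • v) t)).differentiableWithinAt

variable {E : Type} [NormedAddCommGroup E] [NormedSpace ℂ E]

/-- One step of the Picard iteration along rays `s ↦ (c, s x)`. -/
def picardStep (b : ℂ × E → E →L[ℂ] ℂ) (X : ℂ × E → ℂ) (p : ℂ × E) : ℂ :=
  p.1 + ∫ s : unitInterval, b (X (p.1, ((s : ℝ) : ℂ) • p.2), ((s : ℝ) : ℂ) • p.2) p.2

lemma ray_mem_ball {r : ℝ} {p : ℂ × E} (hp : p ∈ Metric.ball (0 : ℂ × E) r) (s : unitInterval) :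
    (p.1, ((s : ℝ) : ℂ) • p.2) ∈ Metric.ball (0 : ℂ × E) r := by
  rw [mem_ball_zero_iff, Prod.norm_def, max_lt_iff] at hp ⊢
  refine ⟨hp.1, lt_of_le_of_lt ?_ hp.2⟩
  simp only [norm_smul, Complex.norm_real, Real.norm_of_nonneg s.2.1]
  exact mul_le_of_le_one_left (norm_nonneg _) s.2.2

lemma norm_integral_unitInterval_le {f : unitInterval → ℂ} {C : ℝ} (h : ∀ s, ‖f s‖ ≤ C) :
    ‖∫ s, f s‖ ≤ C := by
  have := norm_integral_le_of_norm_le_const (μ := (volume : Measure unitInterval))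
    (Eventually.of_forall h)
  simpa using this

variable {b : ℂ × E → E →L[ℂ] ℂ} {X Y : ℂ × E → ℂ} {r ρ : ℝ}

lemma continuous_ray : Continuous fun q : unitInterval × (ℂ × E) =>
    (q.2.1, ((q.1 : ℝ) : ℂ) • q.2.2) := by fun_prop

lemma continuousOn_picard_integrand (hb : ContinuousOn b (Metric.ball 0 ρ))
    (hX : ContinuousOn X (Metric.ball 0 r))
    (hXρ : ∀ p ∈ Metric.ball (0 : ℂ × E) r, (X p, p.2) ∈ Metric.ball (0 : ℂ × E) ρ) :
    ContinuousOn (fun q : unitInterval × (ℂ × E) =>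
      b (X (q.2.1, ((q.1 : ℝ) : ℂ) • q.2.2), ((q.1 : ℝ) : ℂ) • q.2.2) q.2.2)
      (univ ×ˢ Metric.ball 0 r) := by
  have h1 : ContinuousOn (fun q : unitInterval × (ℂ × E) =>
      X (q.2.1, ((q.1 : ℝ) : ℂ) • q.2.2)) (univ ×ˢ Metric.ball 0 r) :=
    hX.comp continuous_ray.continuousOn fun q hq => ray_mem_ball hq.2 q.1
  have h2 : ContinuousOn (fun q : unitInterval × (ℂ × E) =>
      b (X (q.2.1, ((q.1 : ℝ) : ℂ) • q.2.2), ((q.1 : ℝ) : ℂ) • q.2.2)) (univ ×ˢ Metric.ball 0 r) :=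
    hb.comp (h1.prodMk continuous_ray.snd.continuousOn) fun q hq =>
      hXρ _ (ray_mem_ball hq.2 q.1)
  exact h2.clm_apply continuous_snd.snd.continuousOn

lemma integrable_picard_integrand (hb : ContinuousOn b (Metric.ball 0 ρ))
    (hX : ContinuousOn X (Metric.ball 0 r))
    (hXρ : ∀ p ∈ Metric.ball (0 : ℂ × E) r, (X p, p.2) ∈ Metric.ball (0 : ℂ × E) ρ)
    {p : ℂ × E} (hp : p ∈ Metric.ball (0 : ℂ × E) r) :
    Integrable (fun s : unitInterval =>
      b (X (p.1, ((s : ℝ) : ℂ) • p.2), ((s : ℝ) : ℂ) • p.2) p.2) := by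
  have h : Continuous (fun s : unitInterval =>
      b (X (p.1, ((s : ℝ) : ℂ) • p.2), ((s : ℝ) : ℂ) • p.2) p.2) :=
    (continuousOn_picard_integrand hb hX hXρ).comp_continuous
      (by fun_prop : Continuous fun s : unitInterval => (s, p)) fun s => ⟨mem_univ _, hp⟩
  exact h.integrable_of_hasCompactSupport (HasCompactSupport.of_compactSpace _)

variable [FiniteDimensional ℂ E]

lemma analyticOnNhd_picardStep (hb : AnalyticOnNhd ℂ b (Metric.ball 0 ρ))
    (hX : AnalyticOnNhd ℂ X (Metric.ball 0 r))
    (hXρ : ∀ p ∈ Metric.ball (0 : ℂ × E) r, (X p, p.2) ∈ Metric.ball (0 : ℂ × E) ρ) :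
    AnalyticOnNhd ℂ (picardStep b X) (Metric.ball 0 r) := by
  have h := analyticOnNhd_integral_of_compactSpace (volume : Measure unitInterval)
    (H := fun s (p : ℂ × E) => b (X (p.1, ((s : ℝ) : ℂ) • p.2), ((s : ℝ) : ℂ) • p.2) p.2)
    Metric.isOpen_ball (continuousOn_picard_integrand hb.continuousOn hX.continuousOn hXρ)
    fun s p hp => by
      have h1 : DifferentiableAt ℂ (fun p : ℂ × E => (p.1, ((s : ℝ) : ℂ) • p.2)) p := by fun_prop
      have h2 : DifferentiableAt ℂ (fun p : ℂ × E => X (p.1, ((s : ℝ) : ℂ) • p.2)) p :=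
        DifferentiableAt.comp p (hX _ (ray_mem_ball hp s)).differentiableAt h1
      have h3 : DifferentiableAt ℂ
          (fun p : ℂ × E => b (X (p.1, ((s : ℝ) : ℂ) • p.2), ((s : ℝ) : ℂ) • p.2)) p :=
        DifferentiableAt.comp p (hb _ (hXρ _ (ray_mem_ball hp s))).differentiableAt
          (h2.prodMk h1.snd)
      exact (h3.clm_apply differentiableAt_snd).differentiableWithinAt
  exact fun p hp => analyticAt_fst.add (h p hp)

theorem exists_picard (hb : AnalyticAt ℂ b 0) {O : Set (ℂ × E)} (hO : O ∈ 𝓝 (0 : ℂ × E)) :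
    ∃ (r : ℝ) (X : ℂ × E → ℂ), 0 < r ∧ AnalyticOnNhd ℂ X (Metric.ball 0 r) ∧
      ∀ p ∈ Metric.ball (0 : ℂ × E) r, (X p, p.2) ∈ O ∧ X p = picardStep b X p := by
  obtain ⟨K, t, ht, hK⟩ := (hb.contDiffAt (n := 1)).exists_lipschitzOnWith
  set M := ‖b 0‖ + 1
  have hM : 0 < M := by positivity
  have hbM : ∀ᶠ p in 𝓝 (0 : ℂ × E), ‖b p‖ < M :=
    hb.continuousAt.norm.eventually_lt_const (by simp [M])
  obtain ⟨ρ, hρ, hsub⟩ := Metric.mem_nhds_iff.1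
    (inter_mem (inter_mem hO ht) (inter_mem hb.eventually_analyticAt hbM))
  have hban : AnalyticOnNhd ℂ b (Metric.ball 0 ρ) := fun p hp => (hsub hp).2.1
  obtain ⟨r, hr, hr1, hr2, hr3⟩ : ∃ r > 0, r ≤ ρ / 2 ∧ M * r ≤ ρ / 2 ∧ K * r ≤ 1 / 2 := by
    refine ⟨min (ρ / 2) (min (ρ / 2 / M) (1 / 2 / (K + 1))), by positivity, min_le_left _ _, ?_, ?_⟩
    · rw [mul_comm, ← le_div_iff₀ hM]
      exact (min_le_right _ _).trans (min_le_left _ _)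
    · have h1 : min (ρ / 2) (min (ρ / 2 / M) (1 / 2 / ((K : ℝ) + 1))) ≤ 1 / 2 / ((K : ℝ) + 1) :=
        (min_le_right _ _).trans (min_le_right _ _)
      rw [le_div_iff₀ (by positivity)] at h1
      have h2 : 0 ≤ min (ρ / 2) (min (ρ / 2 / M) (1 / 2 / ((K : ℝ) + 1))) := by positivity
      nlinarith
  set D := Metric.ball (0 : ℂ × E) r
  have hpD : ∀ p ∈ D, ‖p.1‖ < r ∧ ‖p.2‖ < r := fun p hp => by
    rwa [mem_ball_zero_iff, Prod.norm_def, max_lt_iff] at hp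
  have hbd : ∀ X : ℂ × E → ℂ, (∀ p ∈ D, (X p, p.2) ∈ Metric.ball (0 : ℂ × E) ρ) →
      ∀ p ∈ D, ‖picardStep b X p‖ ≤ ‖p.1‖ + ρ / 2 := by
    intro X hX p hp
    have h3 : ‖∫ s : unitInterval, b (X (p.1, ((s : ℝ) : ℂ) • p.2), ((s : ℝ) : ℂ) • p.2) p.2‖
        ≤ M * r := norm_integral_unitInterval_le fun s =>
      (ContinuousLinearMap.le_opNorm _ _).trans
        (mul_le_mul (hsub (hX _ (ray_mem_ball hp s))).2.2.le (hpD p hp).2.le (norm_nonneg _) hM.le)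
    have h4 := norm_add_le p.1
      (∫ s : unitInterval, b (X (p.1, ((s : ℝ) : ℂ) • p.2), ((s : ℝ) : ℂ) • p.2) p.2)
    exact h4.trans (by linarith)
  have hball : ∀ p ∈ D, ∀ x : ℂ, ‖x‖ ≤ ‖p.1‖ + ρ / 2 → (x, p.2) ∈ Metric.ball (0 : ℂ × E) ρ := by
    intro p hp x hx
    obtain ⟨h1, h2⟩ := hpD p hp
    rw [mem_ball_zero_iff, Prod.norm_def, max_lt_iff]
    exact ⟨hx.trans_lt (by linarith), h2.trans_le (by linarith)⟩
  have hcontr : ∀ (X Y : ℂ × E → ℂ) (C : ℝ), ContinuousOn X D → ContinuousOn Y D →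
      (∀ p ∈ D, (X p, p.2) ∈ Metric.ball (0 : ℂ × E) ρ) →
      (∀ p ∈ D, (Y p, p.2) ∈ Metric.ball (0 : ℂ × E) ρ) → (∀ p ∈ D, ‖X p - Y p‖ ≤ C) →
      ∀ p ∈ D, ‖picardStep b X p - picardStep b Y p‖ ≤ C / 2 := by
    intro X Y C hXc hYc hX hY hC p hp
    rw [picardStep, picardStep, add_sub_add_left_eq_sub,
      ← integral_sub (integrable_picard_integrand hban.continuousOn hXc hX hp)
        (integrable_picard_integrand hban.continuousOn hYc hY hp)]
    refine norm_integral_unitInterval_le fun s => ?_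
    have hs := ray_mem_ball hp s
    have h1 := hK.dist_le_mul _ (hsub (hX _ hs)).1.2 _ (hsub (hY _ hs)).1.2
    rw [dist_eq_norm, Prod.dist_eq, dist_self, max_eq_left dist_nonneg, dist_eq_norm] at h1
    rw [← _root_.sub_apply]
    refine (ContinuousLinearMap.le_opNorm _ _).trans ?_
    have h2 := hC _ hs
    have h3 := (hpD p hp).2.le
    have h0 : 0 ≤ C := (norm_nonneg _).trans h2
    calc _ ≤ (K * C) * r := mul_le_mul (h1.trans (by gcongr)) h3 (norm_nonneg _) (by positivity)
      _ = C * (K * r) := by ring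
      _ ≤ C * (1 / 2) := by gcongr
      _ = C / 2 := by ring
  let u : ℕ → ℂ × E → ℂ := fun k => (picardStep b)^[k] Prod.fst
  have hus : ∀ k, u (k + 1) = picardStep b (u k) := fun k =>
    Function.iterate_succ_apply' _ _ _
  have hu : ∀ k, AnalyticOnNhd ℂ (u k) D ∧
      ∀ p ∈ D, (u k p, p.2) ∈ Metric.ball (0 : ℂ × E) ρ := by
    intro k
    induction k with
    | zero =>
      refine ⟨fun p _ => analyticAt_fst, fun p hp => ?_⟩
      have h2 := hpD p hp
      rw [mem_ball_zero_iff, Prod.norm_def, max_lt_iff]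
      exact ⟨h2.1.trans_le (by linarith), h2.2.trans_le (by linarith)⟩
    | succ k ih =>
      rw [hus]
      exact ⟨analyticOnNhd_picardStep hban ih.1 ih.2, fun p hp => hball p hp _ (hbd _ ih.2 p hp)⟩
  have hdiff : ∀ k, ∀ p ∈ D, ‖u (k + 1) p - u k p‖ ≤ 2 * ρ / 2 ^ k := by
    intro k
    induction k with
    | zero =>
      intro p hp
      have h1 := (hu 1).2 p hp
      have h2 := (hu 0).2 p hp
      rw [mem_ball_zero_iff, Prod.norm_def, max_lt_iff] at h1 h2
      have h3 := norm_sub_le (u 1 p) (u 0 p)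
      simp only [zero_add, pow_zero, div_one]
      linarith [h1.1, h2.1]
    | succ k ih =>
      intro p hp
      have := hcontr (u (k + 1)) (u k) _ (hu _).1.continuousOn (hu _).1.continuousOn (hu _).2
        (hu _).2 ih p hp
      rw [← hus, ← hus] at this
      rwa [pow_succ, ← div_div]
  have hlim : ∀ p ∈ D, ∃ x, Tendsto (fun k => u k p) atTop (𝓝 x) ∧
      ∀ k, dist (u k p) x ≤ 4 * ρ / 2 ^ k := by
    intro p hp
    have hd : ∀ k, dist (u k p) (u (k + 1) p) ≤ 4 * ρ / 2 / 2 ^ k := fun k => by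
      rw [dist_comm, dist_eq_norm, show 4 * ρ / 2 = 2 * ρ by ring]
      exact hdiff k p hp
    obtain ⟨x, hx⟩ := cauchySeq_tendsto_of_complete (cauchySeq_of_le_geometric_two hd)
    exact ⟨x, hx, dist_le_of_le_geometric_two_of_tendsto hd hx⟩
  choose! X hXt hXd using hlim
  have hunif : TendstoUniformlyOn u X atTop D := by
    rw [Metric.tendstoUniformlyOn_iff]
    intro ε hε
    have h1 : Tendsto (fun k : ℕ => 4 * ρ / 2 ^ k) atTop (𝓝 0) :=
      tendsto_const_nhds.div_atTop (tendsto_pow_atTop_atTop_of_one_lt one_lt_two)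
    filter_upwards [h1.eventually_lt_const hε] with k hk p hp
    rw [dist_comm]
    exact (hXd p hp k).trans_lt hk
  have hXa := analyticOnNhd_of_tendstoUniformlyOn Metric.isOpen_ball hunif fun k => (hu k).1
  have hXρ : ∀ p ∈ D, (X p, p.2) ∈ Metric.ball (0 : ℂ × E) ρ := fun p hp => by
    refine hball p hp _ (le_of_tendsto ((hXt p hp).comp (tendsto_add_atTop_nat 1)).norm
      (Eventually.of_forall fun k => ?_))
    simp only [Function.comp_apply, hus]
    exact hbd _ (hu k).2 p hp
  refine ⟨r, X, hr, hXa, fun p hp => ⟨(hsub (hXρ p hp)).1.1, ?_⟩⟩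
  have h1 : Tendsto (fun k => u (k + 1) p) atTop (𝓝 (picardStep b X p)) := by
    rw [tendsto_iff_norm_sub_tendsto_zero]
    have h3 : Tendsto (fun k : ℕ => 4 * ρ / 2 ^ k) atTop (𝓝 0) :=
      tendsto_const_nhds.div_atTop (tendsto_pow_atTop_atTop_of_one_lt one_lt_two)
    have h2 : Tendsto (fun k : ℕ => 4 * ρ / 2 ^ k / 2) atTop (𝓝 0) := by
      simpa using h3.div_const 2
    refine squeeze_zero (fun _ => norm_nonneg _) (fun k => ?_) h2
    rw [hus]
    exact hcontr _ _ _ (hu k).1.continuousOn hXa.continuousOn (hu k).2 hXρ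
      (fun p hp => by rw [← dist_eq_norm]; exact hXd p hp k) p hp
  exact tendsto_nhds_unique ((hXt p hp).comp (tendsto_add_atTop_nat 1)) h1

end Picard

/-! ### The Frobenius theorem -/

section Frobenius

open MeasureTheory

variable {E : Type} [NormedAddCommGroup E] [NormedSpace ℂ E]
  {b : ℂ × E → E →L[ℂ] ℂ} {X : ℂ × E → ℂ} {r : ℝ}

lemma hasDerivAt_real_ray (c : ℂ) (x : E) (t : ℝ) :
    HasDerivAt (fun t : ℝ => (c, (t : ℂ) • x)) ((0 : ℂ), x) t := by
  have h1 : HasDerivAt (fun t : ℝ => (t : ℂ)) 1 t := Complex.ofRealCLM.hasDerivAt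
  have h2 := h1.smul_const x
  rw [one_smul] at h2
  exact (hasDerivAt_const t c).prodMk h2

lemma HasFDerivAt.comp_real_ray {F : Type} [NormedAddCommGroup F] [NormedSpace ℂ F]
    {f : ℂ × E → F} {f' : ℂ × E →L[ℂ] F} {c : ℂ} {x : E} {t : ℝ}
    (h : HasFDerivAt f f' (c, (t : ℂ) • x)) :
    HasDerivAt (fun t : ℝ => f (c, (t : ℂ) • x)) (f' (0, x)) t :=
  HasFDerivAt.comp_hasDerivAt (l := f) (f := fun t : ℝ => (c, (t : ℂ) • x)) t
    (h.restrictScalars ℝ) (hasDerivAt_real_ray c x t)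

/-- A fixed point of the Picard step solves the radial differential equation. -/
lemma fderiv_radial (hX : AnalyticOnNhd ℂ X (Metric.ball 0 r))
    (hb : ∀ p ∈ Metric.ball (0 : ℂ × E) r, AnalyticAt ℂ b (X p, p.2))
    (hfix : ∀ p ∈ Metric.ball (0 : ℂ × E) r, X p = picardStep b X p)
    {p : ℂ × E} (hp : p ∈ Metric.ball (0 : ℂ × E) r) :
    fderiv ℂ X p (0, p.2) = b (X p, p.2) p.2 := by
  obtain ⟨c, x⟩ := p
  set S : Set ℝ := {t | (c, (t : ℂ) • x) ∈ Metric.ball (0 : ℂ × E) r}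
  have hcont : Continuous fun t : ℝ => (c, (t : ℂ) • x) := by fun_prop
  have hS : IsOpen S := Metric.isOpen_ball.preimage hcont
  have h1S : (1 : ℝ) ∈ S := by simpa [S] using hp
  let F : ℝ → ℂ := fun t => b (X (c, (t : ℂ) • x), (t : ℂ) • x) x
  have hF : ContinuousOn F S := by
    intro t ht
    have h1 : ContinuousAt (fun t : ℝ => X (c, (t : ℂ) • x)) t :=
      ContinuousAt.comp (f := fun t : ℝ => (c, (t : ℂ) • x)) (hX _ ht).continuousAt
        hcont.continuousAt
    have h2 : ContinuousAt (fun t : ℝ => b (X (c, (t : ℂ) • x), (t : ℂ) • x)) t :=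
      ContinuousAt.comp (f := fun t : ℝ => (X (c, (t : ℂ) • x), (t : ℂ) • x))
        (hb _ ht).continuousAt (h1.prodMk hcont.continuousAt.snd)
    exact (h2.clm_apply continuousAt_const).continuousWithinAt
  have hIcc : uIcc (0 : ℝ) 1 ⊆ S := by
    rw [uIcc_of_le zero_le_one]
    exact fun t ht => ray_mem_ball hp ⟨t, ht⟩
  have hint : HasDerivAt (fun t => ∫ s in (0 : ℝ)..t, F s) (F 1) 1 :=
    intervalIntegral.integral_hasDerivAt_right (hF.mono hIcc).intervalIntegrable
      (hF.stronglyMeasurableAtFilter hS _ h1S) (hF.continuousAt (hS.mem_nhds h1S))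
  have heq : (fun t : ℝ => X (c, (t : ℂ) • x)) =ᶠ[𝓝 1] fun t => c + ∫ s in (0 : ℝ)..t, F s := by
    filter_upwards [hS.mem_nhds h1S] with t ht
    rw [hfix _ ht, picardStep]
    congr 1
    have h1 := integral_unitInterval_eq (fun s : ℝ => (b (X (c, (s : ℂ) • (t : ℂ) • x),
      (s : ℂ) • (t : ℂ) • x)) ((t : ℂ) • x))
    refine h1.trans ?_
    have h2 := intervalIntegral.smul_integral_comp_mul_left (a := 0) (b := 1) F t
    rw [mul_zero, mul_one] at h2
    rw [← h2, ← intervalIntegral.integral_smul]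
    refine intervalIntegral.integral_congr fun s _ => ?_
    simp only [F, map_smul, smul_smul, Complex.ofReal_mul, mul_comm (t : ℂ), Complex.real_smul,
      smul_eq_mul]
  have h1 := (hint.const_add c).congr_of_eventuallyEq heq
  have h2 : HasFDerivAt X (fderiv ℂ X (c, x)) (c, ((1 : ℝ) : ℂ) • x) := by
    simpa using (hX _ hp).differentiableAt.hasFDerivAt
  have h3 := h2.comp_real_ray.unique h1
  simpa [F] using h3

/-- The defect of `X` from solving the full system `∂ₓ X = b (X, x)`. -/
def frobeniusDefect (b : ℂ × E → E →L[ℂ] ℂ) (X : ℂ × E → ℂ) (v : E) (p : ℂ × E) : ℂ :=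
  fderiv ℂ X p (0, v) - b (X p, p.2) v

lemma hasFDerivAt_frobeniusDefect (hX : AnalyticOnNhd ℂ X (Metric.ball 0 r))
    (hb : ∀ p ∈ Metric.ball (0 : ℂ × E) r, AnalyticAt ℂ b (X p, p.2))
    (hfix : ∀ p ∈ Metric.ball (0 : ℂ × E) r, X p = picardStep b X p)
    (hsym : ∀ p ∈ Metric.ball (0 : ℂ × E) r, ∀ u v, fderiv ℂ b (X p, p.2) (b (X p, p.2) u, u) v =
      fderiv ℂ b (X p, p.2) (b (X p, p.2) v, v) u) (v : E)
    {p : ℂ × E} (hp : p ∈ Metric.ball (0 : ℂ × E) r) :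
    ∃ W' : ℂ × E →L[ℂ] ℂ, HasFDerivAt (frobeniusDefect b X v) W' p ∧
      W' (0, p.2) = fderiv ℂ b (X p, p.2) (1, 0) p.2 * frobeniusDefect b X v p
        - frobeniusDefect b X v p := by
  have hX1 : HasFDerivAt X (fderiv ℂ X p) p := (hX p hp).differentiableAt.hasFDerivAt
  have hX2 : HasFDerivAt (fderiv ℂ X) (fderiv ℂ (fderiv ℂ X) p) p :=
    (hX p hp).fderiv.differentiableAt.hasFDerivAt
  have hev : ∀ᶠ q in 𝓝 p, q ∈ Metric.ball (0 : ℂ × E) r := Metric.isOpen_ball.mem_nhds hp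
  have hss := second_derivative_symmetric_of_eventually
    (hev.mono fun q hq => (hX q hq).differentiableAt.hasFDerivAt) hX2
  have hpair : HasFDerivAt (fun q : ℂ × E => (X q, q.2))
      ((fderiv ℂ X p).prod (ContinuousLinearMap.snd ℂ ℂ E)) p := hX1.prodMk hasFDerivAt_snd
  have hB : HasFDerivAt (fun q : ℂ × E => b (X q, q.2)) ((fderiv ℂ b (X p, p.2)).comp
      ((fderiv ℂ X p).prod (ContinuousLinearMap.snd ℂ ℂ E))) p :=
    HasFDerivAt.comp p (hb p hp).differentiableAt.hasFDerivAt hpair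
  have hW := (hX2.clm_apply (hasFDerivAt_const ((0 : ℂ), v) p)).sub
    (hB.clm_apply (hasFDerivAt_const v p))
  refine ⟨_, hW, ?_⟩
  have hpt : HasFDerivAt (fun q : ℂ × E => ((0 : ℂ), q.2))
      ((0 : ℂ × E →L[ℂ] ℂ).prod (ContinuousLinearMap.snd ℂ ℂ E)) p :=
    (hasFDerivAt_const (0 : ℂ) p).prodMk hasFDerivAt_snd
  have hR1 := hX2.clm_apply hpt
  have hR2 := hB.clm_apply (hasFDerivAt_snd (p := p) (𝕜 := ℂ))
  have hR := hR1.unique (hR2.congr_of_eventuallyEq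
    (hev.mono fun q hq => fderiv_radial hX hb hfix hq))
  have hRv := congrArg (fun T : ℂ × E →L[ℂ] ℂ => T (0, v)) hR
  have hrad := fderiv_radial hX hb hfix hp
  have hs := hsym p hp v p.2
  have hsp := hss (0, p.2) (0, v)
  have hsplit : ∀ (a : ℂ) (w u : E), fderiv ℂ b (X p, p.2) (a, w) u =
      a * fderiv ℂ b (X p, p.2) (1, 0) u + fderiv ℂ b (X p, p.2) (0, w) u := by
    intro a w u
    have : ((a, w) : ℂ × E) = a • (1, 0) + (0, w) := by simp
    rw [this, map_add, map_smul]
    simp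
  simp only [frobeniusDefect, ContinuousLinearMap.comp_apply, _root_.add_apply, _root_.sub_apply,
    ContinuousLinearMap.flip_apply, ContinuousLinearMap.prod_apply, ContinuousLinearMap.coe_snd',
    _root_.zero_apply, map_zero, zero_add] at hRv ⊢
  rw [hrad, hsp]
  rw [hsplit (fderiv ℂ X p (0, v))] at hRv
  rw [hsplit (b (X p, p.2) v)] at hs
  linear_combination hRv + hs

lemma frobeniusDefect_eq_zero (hX : AnalyticOnNhd ℂ X (Metric.ball 0 r))
    (hb : ∀ p ∈ Metric.ball (0 : ℂ × E) r, AnalyticAt ℂ b (X p, p.2))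
    (hfix : ∀ p ∈ Metric.ball (0 : ℂ × E) r, X p = picardStep b X p)
    (hsym : ∀ p ∈ Metric.ball (0 : ℂ × E) r, ∀ u v, fderiv ℂ b (X p, p.2) (b (X p, p.2) u, u) v =
      fderiv ℂ b (X p, p.2) (b (X p, p.2) v, v) u) (v : E)
    {p : ℂ × E} (hp : p ∈ Metric.ball (0 : ℂ × E) r) : frobeniusDefect b X v p = 0 := by
  obtain ⟨c, x⟩ := p
  have hmem : ∀ t ∈ Icc (0 : ℝ) 1, (c, (t : ℂ) • x) ∈ Metric.ball (0 : ℂ × E) r :=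
    fun t ht => ray_mem_ball hp ⟨t, ht⟩
  let β : ℝ → ℂ := fun t => fderiv ℂ b (X (c, (t : ℂ) • x), (t : ℂ) • x) (1, 0) x
  let u : ℝ → ℂ := fun t => (t : ℂ) * frobeniusDefect b X v (c, (t : ℂ) • x)
  have hcont : Continuous fun t : ℝ => (c, (t : ℂ) • x) := by fun_prop
  have hβ : ContinuousOn β (Icc 0 1) := by
    intro t ht
    have h1 : ContinuousAt (fun t : ℝ => X (c, (t : ℂ) • x)) t :=
      ContinuousAt.comp (f := fun t : ℝ => (c, (t : ℂ) • x)) (hX _ (hmem t ht)).continuousAt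
        hcont.continuousAt
    have h2 : ContinuousAt (fun t : ℝ => fderiv ℂ b (X (c, (t : ℂ) • x), (t : ℂ) • x)) t :=
      ContinuousAt.comp (f := fun t : ℝ => (X (c, (t : ℂ) • x), (t : ℂ) • x))
        (hb _ (hmem t ht)).fderiv.continuousAt (h1.prodMk hcont.continuousAt.snd)
    exact ((h2.clm_apply continuousAt_const).clm_apply continuousAt_const).continuousWithinAt
  obtain ⟨K, hK⟩ := isCompact_Icc.exists_bound_of_continuousOn hβ
  have hu : ∀ t ∈ Icc (0 : ℝ) 1, HasDerivAt u (β t * u t) t := by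
    intro t ht
    obtain ⟨W', hW, hW'⟩ := hasFDerivAt_frobeniusDefect hX hb hfix hsym v (hmem t ht)
    have h1 : HasDerivAt (fun t : ℝ => (t : ℂ)) 1 t := Complex.ofRealCLM.hasDerivAt
    have h2 := h1.mul hW.comp_real_ray
    refine h2.congr_deriv ?_
    have h3 : W' (0, (t : ℂ) • x) = (t : ℂ) * W' (0, x) := by
      rw [← smul_eq_mul, ← map_smul]; simp
    simp only [h3, map_smul, smul_eq_mul] at hW'
    simp only [β, u]
    linear_combination hW'
  have h := norm_le_gronwallBound_of_norm_deriv_right_le (f := u) (f' := fun t => β t * u t)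
    (δ := 0) (K := K) (ε := 0) (a := 0) (b := 1)
    (fun t ht => (hu t ht).continuousAt.continuousWithinAt)
    (fun t ht => (hu t (Ico_subset_Icc_self ht)).hasDerivWithinAt) (by simp [u])
    (fun t ht => by
      rw [norm_mul, add_zero]
      exact mul_le_mul_of_nonneg_right (hK t (Ico_subset_Icc_self ht)) (norm_nonneg _))
    1 (right_mem_Icc.2 zero_le_one)
  rw [gronwallBound_ε0_δ0] at h
  simpa [u] using norm_le_zero_iff.1 h

end Frobenius

/-! ### First integrals -/

section FirstIntegral

variable {m : ℕ}

/-- The coefficients of an integrable form `a (dc - b)` satisfy the symmetry condition. -/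
lemma frobenius_symm {η : OneForm (m + 1)} (L : Cn (m + 1) ≃L[ℂ] ℂ × Cn m)
    {b : ℂ × Cn m → Cn m →L[ℂ] ℂ} {q : ℂ × Cn m} (hη : AnalyticAt ℂ η (L.symm q))
    (hb : AnalyticAt ℂ b q) (h1 : η (L.symm q) (L.symm (1, 0)) ≠ 0)
    (hker : ∀ᶠ q in 𝓝 q, ∀ v, η (L.symm q) (L.symm (b q v, v)) = 0)
    (hint : ∀ u v w, η (L.symm q) u * extd η (L.symm q) v w + η (L.symm q) v * extd η (L.symm q) w u
      + η (L.symm q) w * extd η (L.symm q) u v = 0) (u v : Cn m) :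
    fderiv ℂ b q (b q u, u) v = fderiv ℂ b q (b q v, v) u := by
  have hηd : HasFDerivAt (fun q => η (L.symm q))
      ((fderiv ℂ η (L.symm q)).comp (L.symm : ℂ × Cn m →L[ℂ] Cn (m + 1))) q :=
    HasFDerivAt.comp q hη.differentiableAt.hasFDerivAt L.symm.hasFDerivAt
  have key : ∀ u v, fderiv ℂ η (L.symm q) (L.symm (b q u, u)) (L.symm (b q v, v)) =
      -(fderiv ℂ b q (b q u, u) v * η (L.symm q) (L.symm (1, 0))) := by
    intro u v
    have hbv : HasFDerivAt (fun q => L.symm (b q v, v)) _ q :=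
      HasFDerivAt.comp q (L.symm : ℂ × Cn m →L[ℂ] Cn (m + 1)).hasFDerivAt
        ((hb.differentiableAt.hasFDerivAt.clm_apply (hasFDerivAt_const v q)).prodMk
          (hasFDerivAt_const v q))
    have h2 := (hηd.clm_apply hbv).unique
      ((hasFDerivAt_const (0 : ℂ) q).congr_of_eventuallyEq (hker.mono fun q hq => hq v))
    have h3 := congrArg (fun T : ℂ × Cn m →L[ℂ] ℂ => T (b q u, u)) h2
    simp only [ContinuousLinearMap.comp_apply, _root_.add_apply,
      ContinuousLinearMap.flip_apply, ContinuousLinearMap.prod_apply,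
      _root_.zero_apply, map_zero, zero_add] at h3
    have h4 : L.symm ((fderiv ℂ b q (b q u, u) v, 0) : ℂ × Cn m) =
        fderiv ℂ b q (b q u, u) v • L.symm (1, 0) := by
      rw [← map_smul]; simp
    have h5 : η (L.symm q) (L.symm ((fderiv ℂ b q (b q u, u) v, 0) : ℂ × Cn m)) =
        fderiv ℂ b q (b q u, u) v * η (L.symm q) (L.symm (1, 0)) := by
      rw [h4, map_smul, smul_eq_mul]
    rw [← h5]
    exact eq_neg_of_add_eq_zero_right h3
  have hk := hker.self_of_nhds
  have h2 := hint (L.symm (1, 0)) (L.symm (b q u, u)) (L.symm (b q v, v))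
  rw [hk u, hk v, zero_mul, zero_mul, add_zero, add_zero] at h2
  have h3 := (mul_eq_zero.1 h2).resolve_left h1
  rw [extd, key, key] at h3
  exact mul_right_cancel₀ h1 (by linear_combination -h3)

/-- Frobenius: an integrable holomorphic one-form which does not vanish at `0` is, near `0`, a
multiple of the differential of a holomorphic function. -/
theorem exists_first_integral {η : OneForm (m + 1)} (hη : AnalyticAt ℂ η 0) (h0 : η 0 ≠ 0)
    (hint : ∀ᶠ x in 𝓝 (0 : Cn (m + 1)), ∀ u v w, η x u * extd η x v w + η x v * extd η x w u
      + η x w * extd η x u v = 0) :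
    ∃ φ κ : Cn (m + 1) → ℂ, AnalyticAt ℂ φ 0 ∧ φ 0 = 0 ∧
      ∀ᶠ x in 𝓝 (0 : Cn (m + 1)), η x = κ x • fderiv ℂ φ x := by
  obtain ⟨L, hL⟩ := exists_equiv_fst_eq h0
  set e := L.symm (1, 0)
  have he : η 0 e = 1 := by rw [← hL]; simp [e]
  let J : Cn m →L[ℂ] Cn (m + 1) :=
    (L.symm : ℂ × Cn m →L[ℂ] Cn (m + 1)).comp (ContinuousLinearMap.inr ℂ ℂ (Cn m))
  let b : ℂ × Cn m → Cn m →L[ℂ] ℂ := fun q =>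
    (-(η (L.symm q) e)⁻¹) • (η (L.symm q)).comp J
  have hLan : ∀ q, AnalyticAt ℂ (fun q => L.symm q) q := fun q =>
    (L.symm : ℂ × Cn m →L[ℂ] Cn (m + 1)).analyticAt q
  have hgood : ∀ᶠ q in 𝓝 (0 : ℂ × Cn m), AnalyticAt ℂ η (L.symm q) ∧ η (L.symm q) e ≠ 0 ∧
      (∀ u v w, η (L.symm q) u * extd η (L.symm q) v w + η (L.symm q) v * extd η (L.symm q) w u
        + η (L.symm q) w * extd η (L.symm q) u v = 0) := by
    have ht : Tendsto L.symm (𝓝 0) (𝓝 0) := by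
      simpa using L.symm.continuous.tendsto 0
    have hne : ∀ᶠ x in 𝓝 (0 : Cn (m + 1)), η x e ≠ 0 :=
      (hη.continuousAt.clm_apply continuousAt_const).eventually_ne (by simp [he])
    exact ht.eventually (hη.eventually_analyticAt.and (hne.and hint))
  have hban : ∀ q, AnalyticAt ℂ η (L.symm q) → η (L.symm q) e ≠ 0 → AnalyticAt ℂ b q := by
    intro q h1 h2
    have h3 : AnalyticAt ℂ (fun q => η (L.symm q)) q := h1.comp (hLan q)
    have h4 : AnalyticAt ℂ (fun q => η (L.symm q) e) q :=
      ((ContinuousLinearMap.apply ℂ ℂ e).analyticAt _).comp h3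
    have h5 : AnalyticAt ℂ (fun q => (η (L.symm q)).comp J) q :=
      (((ContinuousLinearMap.compL ℂ (Cn m) (Cn (m + 1)) ℂ).flip J).analyticAt _).comp h3
    exact (h4.inv h2).neg.smul h5
  have hker : ∀ q, η (L.symm q) e ≠ 0 → ∀ v, η (L.symm q) (L.symm (b q v, v)) = 0 := by
    intro q hq v
    have h1 : ((b q v, v) : ℂ × Cn m) = b q v • (1, 0) + (0, v) := by simp
    rw [h1, map_add, map_smul, map_add, map_smul]
    simp only [b, _root_.smul_apply, smul_eq_mul, ContinuousLinearMap.comp_apply, J,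
      ContinuousLinearMap.inr_apply]
    change -(η (L.symm q) e)⁻¹ * η (L.symm q) (L.symm (0, v)) * η (L.symm q) e
      + η (L.symm q) (L.symm (0, v)) = 0
    field_simp
    simp
  obtain ⟨h00, h01, -⟩ := hgood.self_of_nhds
  have hb0 : AnalyticAt ℂ b 0 := hban 0 h00 h01
  obtain ⟨r, X, hr, hX, hXp⟩ := exists_picard hb0 hgood.eventually_nhds
  have hXb : ∀ p ∈ Metric.ball (0 : ℂ × Cn m) r, AnalyticAt ℂ b (X p, p.2) := fun p hp => by
    obtain ⟨h1, h2, -⟩ := (hXp p hp).1.self_of_nhds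
    exact hban _ h1 h2
  have hsym : ∀ p ∈ Metric.ball (0 : ℂ × Cn m) r, ∀ u v,
      fderiv ℂ b (X p, p.2) (b (X p, p.2) u, u) v =
      fderiv ℂ b (X p, p.2) (b (X p, p.2) v, v) u := fun p hp => by
    obtain ⟨h1, h2, h3⟩ := (hXp p hp).1.self_of_nhds
    exact frobenius_symm L h1 (hXb p hp) h2
      ((hXp p hp).1.mono fun q hq => hker q hq.2.1) h3
  have hdX : ∀ p ∈ Metric.ball (0 : ℂ × Cn m) r, ∀ v, fderiv ℂ X p (0, v) = b (X p, p.2) v :=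
    fun p hp v => sub_eq_zero.1
      (frobeniusDefect_eq_zero hX hXb (fun p hp => (hXp p hp).2) hsym v hp)
  have hX0 : ∀ c : ℂ, (c, (0 : Cn m)) ∈ Metric.ball (0 : ℂ × Cn m) r → X (c, 0) = c := fun c hc => by
    rw [(hXp _ hc).2, picardStep]
    simp
  have h0D := Metric.mem_ball_self (x := (0 : ℂ × Cn m)) hr
  have hX00 : X 0 = 0 := hX0 0 h0D
  let Θ : ℂ × Cn m → ℂ × Cn m := fun p => (X p, p.2)
  have hΘ0 : Θ 0 = 0 := by simp [Θ, hX00]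
  have hΘan : AnalyticAt ℂ Θ 0 := (hX 0 h0D).prod analyticAt_snd
  have hXd : HasFDerivAt X (fderiv ℂ X 0) 0 := (hX 0 h0D).differentiableAt.hasFDerivAt
  have hX1 : fderiv ℂ X 0 (1, 0) = 1 := by
    have h1 : HasDerivAt (fun c : ℂ => (c, (0 : Cn m))) (1, 0) 0 :=
      (hasDerivAt_id (0 : ℂ)).prodMk (hasDerivAt_const _ _)
    have h2 := HasFDerivAt.comp_hasDerivAt (l := X) (f := fun c : ℂ => (c, (0 : Cn m)))
      (0 : ℂ) hXd h1
    refine h2.unique ((hasDerivAt_id (0 : ℂ)).congr_of_eventuallyEq ?_)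
    have hc : Tendsto (fun c : ℂ => (c, (0 : Cn m))) (𝓝 0) (𝓝 0) :=
      (by fun_prop : Continuous fun c : ℂ => (c, (0 : Cn m))).tendsto' _ _ rfl
    filter_upwards [hc (Metric.ball_mem_nhds 0 hr)] with c hc using hX0 c hc
  have hXfull : ∀ a v, fderiv ℂ X 0 (a, v) = a + b 0 v := by
    intro a v
    have h1 : ((a, v) : ℂ × Cn m) = a • (1, 0) + (0, v) := by simp
    rw [h1, map_add, map_smul, hX1, hdX 0 h0D, hX00]
    simp
    rfl
  let T : (ℂ × Cn m) ≃L[ℂ] ℂ × Cn m := ContinuousLinearEquiv.equivOfInverse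
    ((fderiv ℂ X 0).prod (ContinuousLinearMap.snd ℂ ℂ (Cn m)))
    ((ContinuousLinearMap.fst ℂ ℂ (Cn m) - (b 0).comp (ContinuousLinearMap.snd ℂ ℂ (Cn m))).prod
      (ContinuousLinearMap.snd ℂ ℂ (Cn m)))
    (fun p => by obtain ⟨a, v⟩ := p; simp [hXfull]) (fun p => by obtain ⟨a, v⟩ := p; simp [hXfull])
  obtain ⟨B, hB, hB0, -, hΘB⟩ := exists_local_inverse hΘan T
    (hXd.prodMk hasFDerivAt_snd).fderiv
  rw [hΘ0] at hB hB0 hΘB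
  have hLt : Tendsto L (𝓝 0) (𝓝 0) := by simpa using L.continuous.tendsto 0
  have hLa : ∀ x, AnalyticAt ℂ (fun x => L x) x := fun x =>
    (L : Cn (m + 1) →L[ℂ] ℂ × Cn m).analyticAt x
  have hBL : AnalyticAt ℂ (fun x => B (L x)) 0 := hB.comp_of_eq (hLa 0) (by simp)
  refine ⟨fun x => (B (L x)).1, fun x => η x (L.symm (fderiv ℂ Θ (B (L x)) (1, 0))),
    (ContinuousLinearMap.fst ℂ ℂ (Cn m)).analyticAt _ |>.comp hBL, by simp [hB0], ?_⟩
  have hBt : Tendsto (fun x => B (L x)) (𝓝 0) (𝓝 0) := by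
    have := hBL.continuousAt.tendsto
    simpa [hB0] using this
  filter_upwards [hBL.eventually_analyticAt, hBt (Metric.ball_mem_nhds 0 hr),
    (hLt.eventually hΘB).eventually_nhds] with x hx1 hx2 hx3
  set p := B (L x) with hp
  have hΘp : Θ p = L x := hx3.self_of_nhds
  have hΘd : HasFDerivAt Θ ((fderiv ℂ X p).prod (ContinuousLinearMap.snd ℂ ℂ (Cn m))) p :=
    (hX p hx2).differentiableAt.hasFDerivAt.prodMk hasFDerivAt_snd
  have hBd := hx1.differentiableAt.hasFDerivAt
  have hcomp : HasFDerivAt (fun x => Θ (B (L x))) _ x := HasFDerivAt.comp x hΘd hBd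
  have h1 := hcomp.unique ((L : Cn (m + 1) →L[ℂ] ℂ × Cn m).hasFDerivAt.congr_of_eventuallyEq hx3)
  have hφ : fderiv ℂ (fun x => (B (L x)).1) x =
      (ContinuousLinearMap.fst ℂ ℂ (Cn m)).comp (fderiv ℂ (fun x => B (L x)) x) :=
    (HasFDerivAt.fst hBd).fderiv
  ext u
  have h2 := congrArg (fun T : Cn (m + 1) →L[ℂ] ℂ × Cn m => T u) h1
  simp only [ContinuousLinearMap.comp_apply, ContinuousLinearEquiv.coe_coe] at h2
  rw [_root_.smul_apply, hφ, hΘd.fderiv]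
  set w := fderiv ℂ (fun x => B (L x)) x u
  have h3 : u = L.symm (((fderiv ℂ X p).prod (ContinuousLinearMap.snd ℂ ℂ (Cn m))) w) := by
    rw [h2]; simp
  have h4 : w = w.1 • (1, 0) + (0, w.2) := by simp
  have h5 : η x (L.symm (b (X p, p.2) w.2, w.2)) = 0 := by
    have h6 := hker (X p, p.2) (hXp p hx2).1.self_of_nhds.2.1 w.2
    have h7 : L.symm (X p, p.2) = x := by
      rw [show (X p, p.2) = Θ p from rfl, hΘp]; simp
    rwa [h7] at h6
  conv_lhs => rw [h3, h4, map_add, map_smul, map_add, map_smul, map_add, map_smul]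
  have h8 : ((fderiv ℂ X p).prod (ContinuousLinearMap.snd ℂ ℂ (Cn m))) (0, w.2) =
      (b (X p, p.2) w.2, w.2) := by
    simp [hdX p hx2]
  rw [h8, h5, add_zero, smul_eq_mul, smul_eq_mul, mul_comm]
  rfl

end FirstIntegral

/-! ### Dense sets, codimension two and fibres -/

section Density

lemma ContinuousAt.eq_zero_of_frequently {X Y : Type} [TopologicalSpace X] [TopologicalSpace Y]
    [T1Space Y] [Zero Y] {f : X → Y} {x : X} (hf : ContinuousAt f x)
    (h : ∃ᶠ z in 𝓝 x, f z = 0) : f x = 0 := by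
  by_contra hne
  exact h (hf.eventually_ne hne)

variable {E F : Type} [NormedAddCommGroup E] [NormedSpace ℂ E] [NormedAddCommGroup F]
  [NormedSpace ℂ F]

lemma AnalyticAt.eventually_frequently_ne [CompleteSpace F] {f : E → F} {p : E} (hf : AnalyticAt ℂ f p)
    (h : ¬ ∀ᶠ x in 𝓝 p, f x = 0) : ∀ᶠ x in 𝓝 p, ∃ᶠ z in 𝓝 x, f z ≠ 0 := by
  obtain ⟨r, hr, hsub⟩ := Metric.mem_nhds_iff.1 hf.eventually_analyticAt
  filter_upwards [Metric.ball_mem_nhds p hr] with x hx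
  by_contra hcon
  rw [not_frequently] at hcon
  have h1 := AnalyticOnNhd.eqOn_zero_of_preconnected_of_eventuallyEq_zero
    (f := f) (U := Metric.ball p r) (fun z hz => hsub hz)
    (convex_ball p r).isPreconnected hx (hcon.mono fun z hz => by simpa using hz)
  exact h (by filter_upwards [Metric.ball_mem_nhds p hr] with z hz using h1 hz)

lemma AnalyticAt.eventually_eq_zero_of_mul {G : Type} [TopologicalSpace G] [T1Space G] [Zero G]
    {f : E → ℂ} {k : E → G} {p : E}
    (hf : AnalyticAt ℂ f p) (hk : ∀ᶠ x in 𝓝 p, ContinuousAt k x)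
    (h : ∀ᶠ x in 𝓝 p, f x ≠ 0 → k x = 0) (hne : ¬ ∀ᶠ x in 𝓝 p, f x = 0) :
    ∀ᶠ x in 𝓝 p, k x = 0 := by
  filter_upwards [hk, h.eventually_nhds, hf.eventually_frequently_ne hne] with x h1 h2 h3
  exact h1.eq_zero_of_frequently ((h3.and_eventually h2).mono fun z hz => hz.2 hz.1)

end Density

section Codim

variable {m : ℕ}

lemma CodimAtLeastTwo.not_eventually {F : Type} [Zero F] {ω : Cn (m + 1) → F} {W : Set (Cn (m + 1))}
    {p : Cn (m + 1)}
    (h : CodimAtLeastTwo {x ∈ W | ω x = 0}) (hW : W ∈ 𝓝 p)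
    {a : Cn (m + 1) → ℂ} (ha : AnalyticAt ℂ a p) (ha0 : a p = 0) :
    ¬ ∀ᶠ x in 𝓝 p, a x = 0 → ω x = 0 := by
  have key : ∀ a : Cn (m + 1) → ℂ, AnalyticAt ℂ a p → a p = 0 → (¬ ∀ᶠ x in 𝓝 p, a x = 0) →
      ¬ ∀ᶠ x in 𝓝 p, a x = 0 → ω x = 0 := by
    intro a ha ha0 hne hz
    obtain ⟨r, hr, hsub⟩ := Metric.mem_nhds_iff.1
      (inter_mem hW (inter_mem ha.eventually_analyticAt hz))
    refine h ⟨p, Metric.ball p r, a, Metric.isOpen_ball, (convex_ball p r).isPreconnected,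
      Metric.mem_ball_self hr, fun x hx => (hsub hx).2.1, ha0, ?_,
      fun x hx => ⟨(hsub hx.1).1, (hsub hx.1).2.2 hx.2⟩⟩
    by_contra! hcon
    exact hne (by filter_upwards [Metric.ball_mem_nhds p hr] with z hz using hcon z hz)
  by_cases hne : ∀ᶠ x in 𝓝 p, a x = 0
  · intro hz
    let c : Cn (m + 1) → ℂ := fun x => x 0 - p 0
    have hc : AnalyticAt ℂ c p :=
      ((ContinuousLinearMap.proj (R := ℂ) (φ := fun _ : Fin (m + 1) => ℂ) 0).analyticAt p).sub
        analyticAt_const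
    refine key c hc (by simp [c]) (fun hc0 => ?_) ((hne.and hz).mono fun x hx _ => hx.2 hx.1)
    have ht : Tendsto (fun t : ℂ => p + t • (fun _ => 1 : Cn (m + 1))) (𝓝 0) (𝓝 p) :=
      (by fun_prop : Continuous fun t : ℂ => p + t • (fun _ => 1 : Cn (m + 1))).tendsto' _ _
        (by simp)
    have h1 : ∀ᶠ t : ℂ in 𝓝 0, t = 0 := (ht.eventually hc0).mono fun t ht => by
      simpa [c] using ht
    obtain ⟨r, hr, hsub⟩ := Metric.mem_nhds_iff.1 h1
    have h2 : ((r / 2 : ℝ) : ℂ) = 0 := hsub (by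
      rw [mem_ball_zero_iff, Complex.norm_real, Real.norm_of_nonneg (by positivity)]
      linarith)
    have h3 : r / 2 = 0 := by exact_mod_cast h2
    linarith
  · exact key a ha ha0 hne

end Codim

section Fibers

variable {N : ℕ} {g : Cn N → Cn N} {r δ : ℝ}

lemma FiberSections.eventually_section {y : Cn N} {ε : ℝ} {d : ℕ} {S : Fin d → Cn N → Cn N}
    (h : FiberSections g r y ε S) {z : Cn N} (hz : z ∈ Metric.ball y ε) (i : Fin d)
    (hg : ContinuousAt g (S i z)) : ∀ᶠ x in 𝓝 (S i z), S i (g x) = x := by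
  have hgz : Tendsto g (𝓝 (S i z)) (𝓝 z) := by
    have := hg.tendsto
    rwa [h.map_eq i z hz] at this
  have h1 : ∀ j, j ≠ i → ∀ᶠ x in 𝓝 (S i z), S j (g x) ≠ x := by
    intro j hj
    have h2 : Tendsto (fun x => S j (g x)) (𝓝 (S i z)) (𝓝 (S j z)) :=
      (h.analytic j z hz).continuousAt.tendsto.comp hgz
    obtain ⟨u, v, hu, hv, hzu, hzv, huv⟩ :=
      t2_separation fun he : S j z = S i z => hj (h.injective z hz he)
    filter_upwards [h2.eventually (hu.mem_nhds hzu), hv.mem_nhds hzv] with x hx1 hx2 he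
    exact Set.disjoint_left.1 huv hx1 (by rw [he]; exact hx2)
  filter_upwards [hgz (Metric.isOpen_ball.mem_nhds hz),
    Metric.isOpen_ball.mem_nhds (h.mem_ball i z hz), eventually_all.2 fun j =>
      (by by_cases hj : j = i
          · exact Eventually.of_forall fun x hne => absurd hj hne
          · exact (h1 j hj).mono fun x hx _ => hx :
        ∀ᶠ x in 𝓝 (S i z), j ≠ i → S j (g x) ≠ x)] with x hx1 hx2 hx3
  obtain ⟨j, hj⟩ := h.exhaust x hx2 hx1
  by_cases hji : j = i
  · rw [← hji, hj]
  · exact absurd hj (hx3 j hji)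

lemma FiberSections.eventually_of_comp {y : Cn N} {ε : ℝ} {d : ℕ} {S : Fin d → Cn N → Cn N}
    (h : FiberSections g r y ε S) {z : Cn N} (hz : z ∈ Metric.ball y ε) (i : Fin d)
    (hg : ContinuousAt g (S i z)) {q : Cn N → Prop} (hq : ∀ᶠ w in 𝓝 z, q (S i w)) :
    ∀ᶠ x in 𝓝 (S i z), q x := by
  have hgz : Tendsto g (𝓝 (S i z)) (𝓝 z) := by
    have := hg.tendsto
    rwa [h.map_eq i z hz] at this
  filter_upwards [h.eventually_section hz i hg, hgz.eventually hq] with x h1 h2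
  rwa [h1] at h2

/-- A function vanishing on no open set is nowhere zero on the fibres over a dense set of regular
values. -/
lemma IsProperOn.exists_mem_regularValues_forall_ne (h : IsProperOn g r δ) {q : Cn N → ℂ}
    (hqc : ∀ x ∈ Metric.ball (0 : Cn N) r, g x ∈ Metric.ball (0 : Cn N) δ → ContinuousAt q x)
    (hq : ∀ x ∈ Metric.ball (0 : Cn N) r, g x ∈ Metric.ball (0 : Cn N) δ →
      ¬ ∀ᶠ z in 𝓝 x, q z = 0)
    {y : Cn N} (hy : y ∈ Metric.ball (0 : Cn N) δ) {O : Set (Cn N)} (hO : IsOpen O) (hyO : y ∈ O) :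
    ∃ z ∈ O, z ∈ regularValues g r δ ∧ ∀ x ∈ Metric.ball (0 : Cn N) r, g x = z → q x ≠ 0 := by
  classical
  obtain ⟨y₁, hy₁O, hy₁⟩ := h.exists_mem_regularValues hO hyO hy
  obtain ⟨d, ε, S, hS, hεR⟩ := h.exists_fiberSections hy₁
  have key : ∀ s : Finset (Fin d), ∃ z ∈ O ∩ Metric.ball y₁ ε, ∀ i ∈ s, q (S i z) ≠ 0 := by
    intro s
    induction s using Finset.induction_on with
    | empty => exact ⟨y₁, ⟨hy₁O, Metric.mem_ball_self hS.pos⟩, by simp⟩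
    | insert i s _ ih =>
      obtain ⟨z, hz, hzs⟩ := ih
      have hSz := hS.mem_ball i z hz.2
      have hev : ∀ᶠ w in 𝓝 z, w ∈ O ∩ Metric.ball y₁ ε ∧ ∀ j ∈ s, q (S j w) ≠ 0 := by
        have h1 : ∀ᶠ w in 𝓝 z, w ∈ O ∩ Metric.ball y₁ ε :=
          (hO.inter Metric.isOpen_ball).mem_nhds hz
        refine h1.and ?_
        rw [Finset.eventually_all]
        intro j hj
        have hc : ContinuousAt (fun w => q (S j w)) z :=
          ContinuousAt.comp (f := S j) (hqc _ (hS.mem_ball j z hz.2) (by rw [hS.map_eq j z hz.2]; exact (hεR hz.2).1))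
            (hS.analytic j z hz.2).continuousAt
        exact hc.eventually_ne (hzs j hj)
      have hfr : ∃ᶠ w in 𝓝 z, q (S i w) ≠ 0 := by
        intro hcon
        refine hq _ hSz ?_ (hS.eventually_of_comp hz.2 i
          (h.analytic _ (Metric.ball_subset_closedBall hSz)).continuousAt
          (q := fun x => q x = 0) (hcon.mono fun w hw => not_not.1 hw))
        rw [hS.map_eq i z hz.2]
        exact (hεR hz.2).1
      obtain ⟨w, hw1, hw2, hw3⟩ := (hfr.and_eventually hev).exists
      refine ⟨w, hw2, fun j hj => ?_⟩
      rcases Finset.mem_insert.1 hj with rfl | hj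
      · exact hw1
      · exact hw3 j hj
  obtain ⟨z, hz, hzs⟩ := key Finset.univ
  refine ⟨z, hz.1, hεR hz.2, fun x hx hgx => ?_⟩
  obtain ⟨i, hi⟩ := hS.exhaust x hx (by rw [hgx]; exact hz.2)
  rw [← hi, hgx]
  exact hzs i (Finset.mem_univ i)

end Fibers

/-! ### Pullbacks and exterior products of one-forms -/

section Pullback

variable {n : ℕ}

lemma eq_zero_of_comp_fderiv_eq_zero {g : Cn n → Cn n} {x : Cn n} (hd : (jac g x).det ≠ 0)
    {T : Cn n →L[ℂ] ℂ} (hT : T.comp (fderiv ℂ g x) = 0) : T = 0 := by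
  rw [← det_fderiv] at hd
  have hs : Function.Surjective (fderiv ℂ g x) :=
    (LinearMap.equivOfDetNeZero (fderiv ℂ g x : Cn n →ₗ[ℂ] Cn n) hd).surjective
  ext v
  obtain ⟨u, hu⟩ := hs v
  rw [← hu]
  exact congrArg (fun S : Cn n →L[ℂ] ℂ => S u) hT

lemma extd_pullback {g : Cn n → Cn n} {ω : OneForm n} {x : Cn n} (hg : AnalyticAt ℂ g x)
    (hω : AnalyticAt ℂ ω (g x)) (u v : Cn n) :
    extd (fun x => (ω (g x)).comp (fderiv ℂ g x)) x u v =
      extd ω (g x) (fderiv ℂ g x u) (fderiv ℂ g x v) := by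
  have h1 : HasFDerivAt (fun x => ω (g x)) ((fderiv ℂ ω (g x)).comp (fderiv ℂ g x)) x :=
    hω.differentiableAt.hasFDerivAt.comp x hg.differentiableAt.hasFDerivAt
  have h2 := hg.fderiv.differentiableAt.hasFDerivAt
  have h3 := h1.clm_comp h2
  have hsymm : fderiv ℂ (fderiv ℂ g) x u v = fderiv ℂ (fderiv ℂ g) x v u :=
    second_derivative_symmetric_of_eventually (𝕜 := ℂ)
      (hg.eventually_analyticAt.mono fun z hz => hz.differentiableAt.hasFDerivAt) h2 u v
  simp [extd, h3.fderiv, hsymm]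

lemma extd_smul {f : Cn n → ℂ} {η : OneForm n} {x : Cn n} (hf : DifferentiableAt ℂ f x)
    (hη : DifferentiableAt ℂ η x) (u v : Cn n) :
    extd (fun x => f x • η x) x u v =
      f x * extd η x u v + (fderiv ℂ f x u * η x v - fderiv ℂ f x v * η x u) := by
  have h := hf.hasFDerivAt.smul hη.hasFDerivAt
  have h' : fderiv ℂ (fun x => f x • η x) x = _ := h.fderiv
  simp only [extd, h']
  simp
  ring

lemma Filter.EventuallyEq.extd_eq {ω η : OneForm n} {x : Cn n} (h : ω =ᶠ[𝓝 x] η) (u v : Cn n) :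
    extd ω x u v = extd η x u v := by
  simp only [extd, h.fderiv_eq]

lemma IsFiniteGerm.eventually_form_eq_zero {g : Cn n → Cn n} (hg : IsFiniteGerm g) {ω : OneForm n}
    (hω : AnalyticAt ℂ ω 0) (h : ∀ᶠ x in 𝓝 0, (ω (g x)).comp (fderiv ℂ g x) = 0) :
    ∀ᶠ y in 𝓝 0, ω y = 0 := by
  rw [← hg.eventually_map_iff]
  obtain ⟨r, δ, hp, -, -⟩ := hg.exists_isProperOn univ_mem
  refine AnalyticAt.eventually_eq_zero_of_mul (f := fun x => (jac g x).det)
    (k := fun x => ω (g x)) ?_ ?_ ?_ ?_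
  · exact analyticAt_det fun i j => hg.analytic.jac_apply i j
  · filter_upwards [hg.tendsto.eventually hω.eventually_analyticAt,
      hg.analytic.eventually_analyticAt] with x h1 h2
    exact ContinuousAt.comp (f := g) h1.continuousAt h2.continuousAt
  · exact h.mono fun x hx hd => eq_zero_of_comp_fderiv_eq_zero hd hx
  · intro hcon
    have h0 := hg.not_eventually_det_eq_zero hp (Metric.mem_ball_self hp.pos_source)
    exact h0 (hcon.mono fun x hx => not_not.2 hx)

lemma eventually_integrable_pullback {g : Cn n → Cn n} {ω η : OneForm n} {f : Cn n → ℂ}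
    (hg : AnalyticAt ℂ g 0) (hω : AnalyticAt ℂ ω (g 0)) (hf : AnalyticAt ℂ f 0)
    (hη : AnalyticAt ℂ η 0) (hf0 : ¬ ∀ᶠ x in 𝓝 0, f x = 0)
    (hpull : ∀ᶠ x in 𝓝 0, (ω (g x)).comp (fderiv ℂ g x) = f x • η x)
    (hint : ∀ᶠ y in 𝓝 (g 0), ∀ u v w : Cn n,
      ω y u * extd ω y v w + ω y v * extd ω y w u + ω y w * extd ω y u v = 0) :
    ∀ᶠ x in 𝓝 0, ∀ u v w : Cn n,
      η x u * extd η x v w + η x v * extd η x w u + η x w * extd η x u v = 0 := by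
  have hmain := AnalyticAt.eventually_eq_zero_of_mul (f := f) (p := (0 : Cn n))
    (k := fun x => fun q : Cn n × Cn n × Cn n =>
      η x q.1 * extd η x q.2.1 q.2.2 + η x q.2.1 * extd η x q.2.2 q.1
        + η x q.2.2 * extd η x q.1 q.2.1) hf ?_ ?_ hf0
  · exact hmain.mono fun x hx u v w => congrFun hx (u, v, w)
  · filter_upwards [hη.eventually_analyticAt] with x hx
    have h1 := hx.continuousAt
    have h2 := hx.fderiv.continuousAt
    rw [continuousAt_pi]
    intro q
    have h3 : ∀ u, ContinuousAt (fun x => η x u) x := fun u => h1.clm_apply continuousAt_const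
    have h4 : ∀ u v, ContinuousAt (fun x => extd η x u v) x := fun u v =>
      ((h2.clm_apply continuousAt_const).clm_apply continuousAt_const).sub
        ((h2.clm_apply continuousAt_const).clm_apply continuousAt_const)
    exact (((h3 _).mul (h4 _ _)).add ((h3 _).mul (h4 _ _))).add ((h3 _).mul (h4 _ _))
  · filter_upwards [hpull.eventually_nhds, hg.continuousAt.tendsto.eventually hint,
      hg.continuousAt.tendsto.eventually hω.eventually_analyticAt, hg.eventually_analyticAt,
      hf.eventually_analyticAt, hη.eventually_analyticAt] with x h1 h2 h3 h4 h5 h6 hfx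
    funext q
    obtain ⟨u, v, w⟩ := q
    have hv : ∀ u, ω (g x) (fderiv ℂ g x u) = f x * η x u := fun u =>
      congrArg (fun T : Cn n →L[ℂ] ℂ => T u) h1.self_of_nhds
    have he : ∀ u v, extd ω (g x) (fderiv ℂ g x u) (fderiv ℂ g x v) =
        f x * extd η x u v + (fderiv ℂ f x u * η x v - fderiv ℂ f x v * η x u) := fun u v => by
      rw [← extd_pullback h4 h3, ← extd_smul h5.differentiableAt h6.differentiableAt]
      exact Filter.EventuallyEq.extd_eq h1 u v
    have h := h2 (fderiv ℂ g x u) (fderiv ℂ g x v) (fderiv ℂ g x w)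
    simp only [hv, he] at h
    have h' : f x ^ 2 * (η x u * extd η x v w + η x v * extd η x w u + η x w * extd η x u v) = 0 := by
      linear_combination h
    exact (mul_eq_zero.1 h').resolve_left (pow_ne_zero 2 hfx)

end Pullback

section Wedge

variable {m : ℕ}

lemma eventually_eq_fst_of_fderiv_eq_zero {Ψ : ℂ × Cn m → ℂ} (hΨ : AnalyticAt ℂ Ψ 0)
    (h : ∀ᶠ p in 𝓝 0, ∀ v : Cn m, fderiv ℂ Ψ p (0, v) = 0) :
    ∀ᶠ p in 𝓝 0, Ψ p = Ψ (p.1, 0) := by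
  obtain ⟨ρ, hρ, hsub⟩ := Metric.mem_nhds_iff.1 (hΨ.eventually_analyticAt.and h)
  filter_upwards [Metric.ball_mem_nhds 0 hρ] with p hp
  rw [mem_ball_zero_iff, Prod.norm_def, max_lt_iff] at hp
  have hmem : ∀ y ∈ Metric.ball (0 : Cn m) ρ, (p.1, y) ∈ Metric.ball (0 : ℂ × Cn m) ρ := by
    intro y hy
    rw [mem_ball_zero_iff] at hy ⊢
    exact max_lt hp.1 hy
  have hd : ∀ y ∈ Metric.ball (0 : Cn m) ρ, HasFDerivAt (fun y => Ψ (p.1, y))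
      ((fderiv ℂ Ψ (p.1, y)).comp (ContinuousLinearMap.inr ℂ ℂ (Cn m))) y := fun y hy =>
    (hsub (hmem y hy)).1.differentiableAt.hasFDerivAt.comp y (hasFDerivAt_prodMk_right p.1 y)
  exact Metric.isOpen_ball.is_const_of_fderiv_eq_zero (𝕜 := ℂ)
    (convex_ball (0 : Cn m) ρ).isPreconnected
    (fun y hy => (hd y hy).differentiableAt.differentiableWithinAt)
    (fun y hy => by
      rw [(hd y hy).fderiv]
      ext v
      simpa using (hsub (hmem y hy)).2 v)
    (x := p.2) (y := 0) (by simpa using hp.2) (Metric.mem_ball_self hρ)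

/-- If `dΘ ∧ dφ = 0` with `dφ ≠ 0`, then `Θ` is locally a function of `φ`. -/
lemma eventually_eq_zero_iff_of_wedge {Θ φ : Cn (m + 1) → ℂ} (hΘ : AnalyticAt ℂ Θ 0)
    (hφ : AnalyticAt ℂ φ 0) (hφ0 : φ 0 = 0) (hd : fderiv ℂ φ 0 ≠ 0) (hΘ0 : Θ 0 = 0)
    (hne : ¬ ∀ᶠ x in 𝓝 0, Θ x = 0)
    (hw : ∀ᶠ x in 𝓝 0, ∀ u v, fderiv ℂ Θ x u * fderiv ℂ φ x v = fderiv ℂ Θ x v * fderiv ℂ φ x u) :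
    ∀ᶠ x in 𝓝 0, Θ x = 0 ↔ φ x = 0 := by
  obtain ⟨A, B, hA, hB, hA0, hB0, hAB, hBA, hBφ⟩ := exists_straightening hφ hφ0 hd
  have hAt : Tendsto A (𝓝 0) (𝓝 0) := by simpa [hA0] using hA.continuousAt.tendsto
  have hBt : Tendsto B (𝓝 0) (𝓝 0) := by simpa [hB0] using hB.continuousAt.tendsto
  have hΨ : AnalyticAt ℂ (fun p => Θ (A p)) 0 :=
    AnalyticAt.comp (g := Θ) (f := A) (by rwa [hA0]) hA
  have hfst : ∀ᶠ p in 𝓝 0, φ (A p) = p.1 := hBA.mono fun p hp => by rw [← hBφ, hp]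
  have h1 : ∀ᶠ p in 𝓝 (0 : ℂ × Cn m), ∀ v : Cn m, fderiv ℂ (fun p => Θ (A p)) p (0, v) = 0 := by
    filter_upwards [hfst.eventually_nhds, hA.eventually_analyticAt,
      hAt.eventually hΘ.eventually_analyticAt, hAt.eventually hφ.eventually_analyticAt,
      hAt.eventually hw] with p h1 h2 h3 h4 h5 v
    have e1 : fderiv ℂ (fun p => Θ (A p)) p = (fderiv ℂ Θ (A p)).comp (fderiv ℂ A p) :=
      (h3.differentiableAt.hasFDerivAt.comp p h2.differentiableAt.hasFDerivAt).fderiv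
    have e2 : (fderiv ℂ φ (A p)).comp (fderiv ℂ A p) = ContinuousLinearMap.fst ℂ ℂ (Cn m) := by
      rw [← (h4.differentiableAt.hasFDerivAt.comp p h2.differentiableAt.hasFDerivAt).fderiv]
      exact (Filter.EventuallyEq.fderiv_eq h1).trans hasFDerivAt_fst.fderiv
    have e3 : ∀ q, fderiv ℂ φ (A p) (fderiv ℂ A p q) = q.1 := fun q =>
      congrArg (fun T : ℂ × Cn m →L[ℂ] ℂ => T q) e2
    have := h5 (fderiv ℂ A p (0, v)) (fderiv ℂ A p (1, 0))
    rw [e3, e3] at this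
    rw [e1]
    simpa using this
  have h2 := eventually_eq_fst_of_fderiv_eq_zero hΨ h1
  have hθ : AnalyticAt ℂ (fun c : ℂ => Θ (A (c, 0))) 0 :=
    AnalyticAt.comp (g := fun p => Θ (A p)) (f := fun c : ℂ => (c, (0 : Cn m))) hΨ
      (analyticAt_id.prod analyticAt_const)
  have hfz : Tendsto (fun p : ℂ × Cn m => p.1) (𝓝 0) (𝓝 0) := continuous_fst.tendsto' _ _ rfl
  have hback : ∀ {q : Cn (m + 1) → Prop}, (∀ᶠ p in 𝓝 0, q (A p)) → ∀ᶠ x in 𝓝 0, q x :=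
    fun h => ((hBt.eventually h).and hAB).mono fun x hx => by simpa [hx.2] using hx.1
  have h3 : ∀ᶠ c : ℂ in 𝓝 0, Θ (A (c, 0)) = 0 ↔ c = 0 := by
    rcases hθ.eventually_eq_zero_or_eventually_ne_zero with h | h
    · refine absurd (hback ?_) hne
      exact (h2.and (hfz.eventually h)).mono fun p hp => hp.1.trans hp.2
    · rw [eventually_nhdsWithin_iff] at h
      filter_upwards [h] with c hc
      refine ⟨fun h0 => by_contra fun hne => hc hne h0, fun h0 => ?_⟩
      rw [h0]
      exact (congrArg Θ hA0).trans hΘ0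
  refine hback ?_
  filter_upwards [h2, hfz.eventually h3, hfst] with p hp1 hp2 hp3
  rw [hp1, hp2, hp3]

end Wedge

/-! ### Descent of first integrals -/

section Descent

open Polynomial

variable {m : ℕ} {g : Cn (m + 1) → Cn (m + 1)}

/-- The trace function of a first integral of the pulled back form is again a first integral. -/
lemma FiberSections.wedge_prod_eq_zero {r y ε} {d : ℕ} {S : Fin d → Cn (m + 1) → Cn (m + 1)}
    (hS : FiberSections g r y ε S) {φ : Cn (m + 1) → ℂ} {c : Cn (m + 1) → ℂ} {ω : OneForm (m + 1)}
    (hg : ∀ x ∈ Metric.ball 0 r, AnalyticAt ℂ g x) (hφ : ∀ x ∈ Metric.ball 0 r, AnalyticAt ℂ φ x)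
    (hω : ∀ x ∈ Metric.ball 0 r, (ω (g x)).comp (fderiv ℂ g x) = c x • fderiv ℂ φ x)
    (u v : Cn (m + 1)) :
    fderiv ℂ (fun z => ∏ i, (0 - φ (S i z))) y u * ω y v =
      fderiv ℂ (fun z => ∏ i, (0 - φ (S i z))) y v * ω y u := by
  classical
  have hy := Metric.mem_ball_self (x := y) hS.pos
  let D : Fin d → Cn (m + 1) →L[ℂ] ℂ := fun i =>
    (fderiv ℂ φ (S i y)).comp (fderiv ℂ (S i) y)
  have hD : ∀ i, HasFDerivAt (fun z => 0 - φ (S i z)) (-D i) y := fun i => by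
    have := ((hφ _ (hS.mem_ball i y hy)).differentiableAt.hasFDerivAt.comp y
      (hS.analytic i y hy).differentiableAt.hasFDerivAt)
    simpa using this.const_sub 0
  have hωD : ∀ i, ω y = c (S i y) • D i := fun i => by
    have hx := hS.mem_ball i y hy
    have hcomp : (fderiv ℂ g (S i y)).comp (fderiv ℂ (S i) y) = ContinuousLinearMap.id ℂ _ := by
      have h1 := (hg _ hx).differentiableAt.hasFDerivAt.comp y
        (hS.analytic i y hy).differentiableAt.hasFDerivAt
      refine h1.unique ((hasFDerivAt_id y).congr_of_eventuallyEq ?_)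
      filter_upwards [Metric.isOpen_ball.mem_nhds hy] with z hz using hS.map_eq i z hz
    have h2 := hω _ hx
    rw [hS.map_eq i y hy] at h2
    calc ω y = (ω y).comp ((fderiv ℂ g (S i y)).comp (fderiv ℂ (S i) y)) := by rw [hcomp]; rfl
      _ = ((ω y).comp (fderiv ℂ g (S i y))).comp (fderiv ℂ (S i) y) := rfl
      _ = c (S i y) • D i := by rw [h2]; rfl
  have hw : ∀ i, D i u * ω y v = D i v * ω y u := fun i => by
    rw [hωD i]
    simp only [_root_.smul_apply, smul_eq_mul]
    ring
  have hprod := HasFDerivAt.finsetProd (u := Finset.univ) fun i _ => hD i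
  have e : fderiv ℂ (fun z => ∏ i, (0 - φ (S i z))) y = _ := hprod.fderiv
  rw [e]
  simp only [_root_.sum_apply, _root_.smul_apply, smul_eq_mul, _root_.neg_apply, Finset.sum_mul]
  refine Finset.sum_congr rfl fun i _ => ?_
  linear_combination -(∏ j ∈ Finset.univ.erase i, (0 - φ (S j y))) * hw i

theorem IsFiniteGerm.exists_first_integral_descent (hg : IsFiniteGerm g) {ω η : OneForm (m + 1)}
    {W : Set (Cn (m + 1))} {f : Cn (m + 1) → ℂ} (hF : IsFoliationOn ω W)
    (hW : (0 : Cn (m + 1)) ∈ W) (hf : AnalyticAt ℂ f 0) (hη : AnalyticAt ℂ η 0) (hη0 : η 0 ≠ 0)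
    (hpull : ∀ᶠ x in 𝓝 0, (ω (g x)).comp (fderiv ℂ g x) = f x • η x) :
    ∃ Φ φ : Cn (m + 1) → ℂ, AnalyticAt ℂ Φ 0 ∧ AnalyticAt ℂ φ 0 ∧ Φ 0 = 0 ∧ φ 0 = 0 ∧
      fderiv ℂ φ 0 ≠ 0 ∧ (∀ᶠ x in 𝓝 0, Φ (g x) = 0 ↔ φ x = 0) ∧
      ∀ᶠ y in 𝓝 0, ∀ u v, fderiv ℂ Φ y u * ω y v = fderiv ℂ Φ y v * ω y u := by
  have hω : AnalyticAt ℂ ω 0 := hF.holo 0 hW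
  have hf0 : ¬ ∀ᶠ x in 𝓝 0, f x = 0 := fun hcon => by
    have h1 := hg.eventually_form_eq_zero hω
      ((hpull.and hcon).mono fun x hx => by rw [hx.1, hx.2]; ext; simp)
    exact hF.codim.not_eventually (hF.isOpen.mem_nhds hW) (a := fun _ => (0 : ℂ))
      analyticAt_const rfl (h1.mono fun x hx _ => hx)
  have hint := eventually_integrable_pullback hg.analytic (by rwa [hg.map_zero]) hf hη hf0 hpull
    (by rw [hg.map_zero]
        filter_upwards [hF.isOpen.mem_nhds hW] with y hy using hF.integrable y hy)
  obtain ⟨φ, κ, hφ, hφ0, hκ⟩ := exists_first_integral hη hη0 hint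
  have hd : fderiv ℂ φ 0 ≠ 0 := fun h => hη0 (by rw [hκ.self_of_nhds, h]; ext; simp)
  have hgood : ∀ᶠ x in 𝓝 0, AnalyticAt ℂ φ x ∧ fderiv ℂ φ x ≠ 0 ∧ AnalyticAt ℂ ω (g x) ∧
      (ω (g x)).comp (fderiv ℂ g x) = (f x * κ x) • fderiv ℂ φ x := by
    filter_upwards [hφ.eventually_analyticAt, hφ.fderiv.continuousAt.eventually_ne hd,
      hg.tendsto.eventually hω.eventually_analyticAt, hpull, hκ] with x h1 h2 h3 h4 h5
    exact ⟨h1, h2, h3, by rw [h4, h5, smul_smul]⟩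
  obtain ⟨r, δ, hp, hO, -⟩ := hg.exists_isProperOn hgood
  have hOb := Metric.ball_subset_closedBall.trans hO
  have hgb : ∀ x ∈ Metric.ball 0 r, AnalyticAt ℂ g x := fun x hx =>
    hp.analytic x (Metric.ball_subset_closedBall hx)
  obtain ⟨d, T, P, -, -, hP, -, hPS, hP0⟩ :=
    hp.exists_charpoly hg.map_zero (f := φ) fun x hx => (hO hx).1
  set Φ : Cn (m + 1) → ℂ := fun y => (P y).eval 0 with hΦdef
  have hΦ : ∀ y ∈ Metric.ball 0 δ, AnalyticAt ℂ Φ y := fun y hy =>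
    hP.eval (u := fun y => y) (t := fun _ => 0) analyticAt_id analyticAt_const hy
  have hωb : ∀ y ∈ Metric.ball 0 δ, AnalyticAt ℂ ω y := fun y hy => by
    obtain ⟨z, hz, rfl⟩ := hp.surjOn hg.map_zero hy
    exact (hOb hz).2.2.1
  have h0δ := Metric.mem_ball_self (x := (0 : Cn (m + 1))) hp.pos_target
  have h0r := Metric.mem_ball_self (x := (0 : Cn (m + 1))) hp.pos_source
  have hΦ00 : Φ 0 = 0 := (hP0 0 h0δ 0).2 ⟨0, h0r, hg.map_zero, hφ0⟩
  have hwreg : ∀ y ∈ regularValues g r δ, ∀ u v,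
      fderiv ℂ Φ y u * ω y v = fderiv ℂ Φ y v * ω y u := by
    intro y hy u v
    obtain ⟨d', ε, S, hS, hεR⟩ := hp.exists_fiberSections hy
    have he : Φ =ᶠ[𝓝 y] fun z => ∏ i, (0 - φ (S i z)) := by
      filter_upwards [Metric.ball_mem_nhds y hS.pos] with z hz
      obtain ⟨ε', hε', hs⟩ := Metric.isOpen_iff.1 Metric.isOpen_ball z hz
      rw [hΦdef]
      simp only
      rw [(hPS z ε' d' S (hεR hz).1 (hS.mono hε' hs)).2.2, eval_prod]
      simp
    rw [he.fderiv_eq]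
    exact hS.wedge_prod_eq_zero hgb (fun x hx => (hOb hx).1) (c := fun x => f x * κ x)
      (fun x hx => (hOb hx).2.2.2) u v
  have hw : ∀ y ∈ Metric.ball 0 δ, ∀ u v, fderiv ℂ Φ y u * ω y v = fderiv ℂ Φ y v * ω y u := by
    intro y hy u v
    rw [← sub_eq_zero]
    have h1 := (hΦ y hy).fderiv.continuousAt
    have h2 := (hωb y hy).continuousAt
    refine ContinuousAt.eq_zero_of_frequently
      (f := fun y => fderiv ℂ Φ y u * ω y v - fderiv ℂ Φ y v * ω y u) (x := y) ?_ ?_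
    · exact ((h1.clm_apply continuousAt_const).mul (h2.clm_apply continuousAt_const)).sub
        ((h1.clm_apply continuousAt_const).mul (h2.clm_apply continuousAt_const))
    · rw [frequently_iff]
      intro O hO
      obtain ⟨O', hO', hOo, hyO⟩ := mem_nhds_iff.1 hO
      obtain ⟨z, hz, hzr⟩ := hp.exists_mem_regularValues hOo hyO hy
      exact ⟨z, hO' hz, sub_eq_zero.2 (hwreg z hzr u v)⟩
  have hwev : ∀ᶠ y in 𝓝 0, ∀ u v, fderiv ℂ Φ y u * ω y v = fderiv ℂ Φ y v * ω y u := by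
    filter_upwards [Metric.ball_mem_nhds 0 hp.pos_target] with y hy using hw y hy
  have hΘ : AnalyticAt ℂ (fun x => Φ (g x)) 0 :=
    AnalyticAt.comp (g := Φ) (f := g) (by rw [hg.map_zero]; exact hΦ 0 h0δ) hg.analytic
  have hne : ¬ ∀ᶠ x in 𝓝 0, Φ (g x) = 0 := by
    rw [hg.eventually_map_iff (p := fun y => Φ y = 0)]
    intro hcon
    obtain ⟨O', hO', hOo, h0O⟩ := mem_nhds_iff.1 hcon
    obtain ⟨z, hz, hzr, hzφ⟩ := hp.exists_mem_regularValues_forall_ne (q := φ)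
      (fun x hx _ => (hOb hx).1.continuousAt)
      (fun x hx _ hx0 => (hOb hx).2.1 (by
        rw [Filter.EventuallyEq.fderiv_eq (f₁ := φ) (f := fun _ => 0) hx0]; simp))
      h0δ hOo h0O
    obtain ⟨x, hx, hgx, hφx⟩ := (hP0 z hzr.1 0).1 (hO' hz)
    exact hzφ x hx hgx hφx
  refine ⟨Φ, φ, hΦ 0 h0δ, hφ, hΦ00, hφ0, hd, ?_, hwev⟩
  refine eventually_eq_zero_iff_of_wedge hΘ hφ hφ0 hd (by simp only [hg.map_zero, hΦ00]) hne ?_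
  have hmain := AnalyticAt.eventually_eq_zero_of_mul (f := f) (p := (0 : Cn (m + 1)))
    (k := fun x => fun q : Cn (m + 1) × Cn (m + 1) =>
      fderiv ℂ (fun x => Φ (g x)) x q.1 * fderiv ℂ φ x q.2 -
        fderiv ℂ (fun x => Φ (g x)) x q.2 * fderiv ℂ φ x q.1) hf ?_ ?_ hf0
  · exact hmain.mono fun x hx u v => sub_eq_zero.1 (congrFun hx (u, v))
  · filter_upwards [hΘ.eventually_analyticAt, hφ.eventually_analyticAt] with x h1 h2
    have h1 := h1.fderiv.continuousAt
    have h2 := h2.fderiv.continuousAt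
    rw [continuousAt_pi]
    intro q
    exact ((h1.clm_apply continuousAt_const).mul (h2.clm_apply continuousAt_const)).sub
        ((h1.clm_apply continuousAt_const).mul (h2.clm_apply continuousAt_const))
  · filter_upwards [hg.tendsto.eventually hwev,
      hg.tendsto.eventually (hΦ 0 h0δ).eventually_analyticAt, hg.analytic.eventually_analyticAt,
      hpull, hκ, hη.continuousAt.eventually_ne hη0] with x h1 h2 h3 h4 h5 h6 hfx
    funext q
    obtain ⟨u, v⟩ := q
    have e1 : fderiv ℂ (fun x => Φ (g x)) x = (fderiv ℂ Φ (g x)).comp (fderiv ℂ g x) :=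
      (h2.differentiableAt.hasFDerivAt.comp x h3.differentiableAt.hasFDerivAt).fderiv
    have hκx : κ x ≠ 0 := fun h => h6 (by rw [h5, h]; ext; simp)
    have e2 : ∀ u, ω (g x) (fderiv ℂ g x u) = f x * κ x * fderiv ℂ φ x u := fun u => by
      have := congrArg (fun T : Cn (m + 1) →L[ℂ] ℂ => T u) h4
      simpa [h5, mul_assoc] using this
    have := h1 (fderiv ℂ g x u) (fderiv ℂ g x v)
    rw [e2, e2] at this
    have h7 : f x * κ x * (fderiv ℂ Φ (g x) (fderiv ℂ g x u) * fderiv ℂ φ x v -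
        fderiv ℂ Φ (g x) (fderiv ℂ g x v) * fderiv ℂ φ x u) = 0 := by
      linear_combination this
    simpa [e1] using (mul_eq_zero.1 h7).resolve_left (mul_ne_zero hfx hκx)

end Descent

/-! ### Hypersurfaces from foliations -/

section Divisors

variable {m : ℕ}

lemma AnalyticAt.not_eventually_eq_zero_of_fderiv_ne_zero {E : Type} [NormedAddCommGroup E]
    [NormedSpace ℂ E] {φ : E → ℂ} {p : E} (hd : fderiv ℂ φ p ≠ 0) : ¬ ∀ᶠ x in 𝓝 p, φ x = 0 :=
  fun h => hd (by rw [Filter.EventuallyEq.fderiv_eq (f₁ := φ) (f := fun _ => 0) h]; simp)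

lemma exists_eq_pow_mul {Φ χ : Cn (m + 1) → ℂ} (hΦ : AnalyticAt ℂ Φ 0) (hχ : AnalyticAt ℂ χ 0)
    (hχ0 : χ 0 = 0) (hd : fderiv ℂ χ 0 ≠ 0) (h : ∀ᶠ x in 𝓝 0, Φ x = 0 → χ x = 0) :
    ∃ (k : ℕ) (u : Cn (m + 1) → ℂ), AnalyticAt ℂ u 0 ∧ u 0 ≠ 0 ∧
      ∀ᶠ x in 𝓝 0, Φ x = χ x ^ k * u x := by
  obtain ⟨A, B, hA, hB, hA0, hB0, hAB, hBA, hBχ⟩ := exists_straightening hχ hχ0 hd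
  have hAt : Tendsto A (𝓝 0) (𝓝 0) := by simpa [hA0] using hA.continuousAt.tendsto
  have hBt : Tendsto B (𝓝 0) (𝓝 0) := by simpa [hB0] using hB.continuousAt.tendsto
  have hΨ : AnalyticAt ℂ (fun p => Φ (A p)) 0 :=
    AnalyticAt.comp (g := Φ) (f := A) (by rwa [hA0]) hA
  obtain ⟨k, u, hu, hu0, hk⟩ := exists_eq_fst_pow_mul hΨ (by
    filter_upwards [hAt.eventually h, hBA] with p hp1 hp2 hp
    have := hp1 hp
    rwa [← hBχ, hp2] at this)
  refine ⟨k, fun x => u (B x), AnalyticAt.comp (g := u) (f := B) (by rwa [hB0]) hB,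
    by simpa [hB0] using hu0, ?_⟩
  filter_upwards [hBt.eventually hk, hAB] with x h1 h2
  rw [h2, hBχ] at h1
  exact h1

/-- The saturation of `dΦ` is regular if the reduced zero set of `Φ` is smooth. -/
lemma exists_fderiv_eq_pow_smul {Φ χ : Cn (m + 1) → ℂ} (hΦ : AnalyticAt ℂ Φ 0)
    (hΦ0 : Φ 0 = 0) (hχ : AnalyticAt ℂ χ 0)
    (hχ0 : χ 0 = 0) (hd : fderiv ℂ χ 0 ≠ 0) (h : ∀ᶠ x in 𝓝 0, Φ x = 0 → χ x = 0) :
    ∃ (k : ℕ) (ζ : OneForm (m + 1)), AnalyticAt ℂ ζ 0 ∧ ζ 0 ≠ 0 ∧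
      ∀ᶠ x in 𝓝 0, fderiv ℂ Φ x = χ x ^ k • ζ x := by
  obtain ⟨k, u, hu, hu0, hk⟩ := exists_eq_pow_mul hΦ hχ hχ0 hd h
  have hk0 : k ≠ 0 := by
    rintro rfl
    have := hk.self_of_nhds
    rw [hΦ0] at this
    simp at this
    exact hu0 this.symm
  obtain ⟨k, rfl⟩ := Nat.exists_eq_succ_of_ne_zero hk0
  refine ⟨k, fun x => (((k + 1 : ℕ) : ℂ) * u x) • fderiv ℂ χ x + χ x • fderiv ℂ u x, ?_, ?_, ?_⟩
  · exact ((analyticAt_const.fun_mul hu).smul hχ.fderiv).add (hχ.smul hu.fderiv)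
  · intro h0
    obtain ⟨v, hv⟩ : ∃ v, fderiv ℂ χ 0 v ≠ 0 := by
      by_contra! hcon
      exact hd (by ext v; simp [hcon])
    have := congrArg (fun T : Cn (m + 1) →L[ℂ] ℂ => T v) h0
    simp [hχ0, hu0, hv] at this
    norm_cast at this
  · filter_upwards [hk.eventually_nhds, hχ.eventually_analyticAt, hu.eventually_analyticAt]
      with x h1 h2 h3
    have e : fderiv ℂ Φ x = _ :=
      (Filter.EventuallyEq.fderiv_eq (f₁ := Φ) h1).trans
        ((h2.differentiableAt.hasFDerivAt.pow (k + 1)).mul h3.differentiableAt.hasFDerivAt).fderiv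
    rw [e]
    ext v
    simp
    ring

lemma not_smooth_of_wedge {Φ χ : Cn (m + 1) → ℂ} {ω : OneForm (m + 1)} {W : Set (Cn (m + 1))}
    (hF : IsFoliationOn ω W) (hW : (0 : Cn (m + 1)) ∈ W) (hω0 : ω 0 = 0)
    (hΦ : AnalyticAt ℂ Φ 0) (hΦ0 : Φ 0 = 0)
    (hw : ∀ᶠ y in 𝓝 0, ∀ u v, fderiv ℂ Φ y u * ω y v = fderiv ℂ Φ y v * ω y u)
    (hχ : AnalyticAt ℂ χ 0) (hd : fderiv ℂ χ 0 ≠ 0) : ¬ ∀ᶠ y in 𝓝 0, Φ y = 0 ↔ χ y = 0 := by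
  intro h
  have hχ0 : χ 0 = 0 := h.self_of_nhds.1 hΦ0
  obtain ⟨k, ζ, hζ, hζ0, hk⟩ :=
    exists_fderiv_eq_pow_smul hΦ hΦ0 hχ hχ0 hd (h.mono fun x hx => hx.1)
  have hω : AnalyticAt ℂ ω 0 := hF.holo 0 hW
  have hmain := AnalyticAt.eventually_eq_zero_of_mul (f := χ) (p := (0 : Cn (m + 1)))
    (k := fun x => fun q : Cn (m + 1) × Cn (m + 1) => ζ x q.1 * ω x q.2 - ζ x q.2 * ω x q.1)
    hχ ?_ ?_ (AnalyticAt.not_eventually_eq_zero_of_fderiv_ne_zero hd)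
  · obtain ⟨v, hv⟩ : ∃ v, ζ 0 v ≠ 0 := by
      by_contra! hcon
      exact hζ0 (by ext v; simp [hcon])
    have hev : ∀ (θ : OneForm (m + 1)), AnalyticAt ℂ θ 0 → AnalyticAt ℂ (fun y => θ y v) 0 :=
      fun θ hθ => ((ContinuousLinearMap.apply ℂ ℂ v).analyticAt _).comp hθ
    refine hF.codim.not_eventually (hF.isOpen.mem_nhds hW) (hev ω hω) (by simp [hω0]) ?_
    filter_upwards [hmain, (hev ζ hζ).continuousAt.eventually_ne hv] with y h1 h2 h3
    ext u
    have := congrFun h1 (u, v)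
    simp only [h3, Pi.zero_apply] at this
    simpa [h2] using this
  · filter_upwards [hζ.eventually_analyticAt, hω.eventually_analyticAt] with x h1 h2
    have h1 := h1.continuousAt
    have h2 := h2.continuousAt
    rw [continuousAt_pi]
    intro q
    exact ((h1.clm_apply continuousAt_const).mul (h2.clm_apply continuousAt_const)).sub
        ((h1.clm_apply continuousAt_const).mul (h2.clm_apply continuousAt_const))
  · filter_upwards [hw, hk] with y h1 h2 h3
    funext q
    have := h1 q.1 q.2
    rw [h2] at this
    simp only [_root_.smul_apply, smul_eq_mul] at this
    have h4 : χ y ^ k * (ζ y q.1 * ω y q.2 - ζ y q.2 * ω y q.1) = 0 := by linear_combination this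
    exact (mul_eq_zero.1 h4).resolve_left (pow_ne_zero k h3)

lemma eventually_zero_or_of_mul {φ a b : Cn (m + 1) → ℂ} (hφ : AnalyticAt ℂ φ 0)
    (hφ0 : φ 0 = 0) (hd : fderiv ℂ φ 0 ≠ 0) (ha : AnalyticAt ℂ a 0) (hb : AnalyticAt ℂ b 0)
    (h : ∀ᶠ x in 𝓝 0, φ x = 0 → a x = 0 ∨ b x = 0) :
    (∀ᶠ x in 𝓝 0, φ x = 0 → a x = 0) ∨ ∀ᶠ x in 𝓝 0, φ x = 0 → b x = 0 := by
  obtain ⟨A, B, hA, hB, hA0, hB0, hAB, hBA, hBφ⟩ := exists_straightening hφ hφ0 hd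
  have hBt : Tendsto B (𝓝 0) (𝓝 0) := by simpa [hB0] using hB.continuousAt.tendsto
  let i : Cn m → Cn (m + 1) := fun v => A (0, v)
  have hi : AnalyticAt ℂ i 0 := AnalyticAt.comp (g := A) (f := fun v : Cn m => ((0 : ℂ), v)) hA
    (analyticAt_const.prod analyticAt_id)
  have hi0 : i 0 = 0 := hA0
  have hit : Tendsto i (𝓝 0) (𝓝 0) := by simpa [hi0] using hi.continuousAt.tendsto
  have hc : ∀ a : Cn (m + 1) → ℂ, AnalyticAt ℂ a 0 → AnalyticAt ℂ (fun v => a (i v)) 0 :=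
    fun a ha => AnalyticAt.comp (g := a) (f := i) (by rwa [hi0]) hi
  have hz : Tendsto (fun v : Cn m => ((0 : ℂ), v)) (𝓝 0) (𝓝 0) :=
    (by fun_prop : Continuous fun v : Cn m => ((0 : ℂ), v)).tendsto' _ _ rfl
  have hφi : ∀ᶠ v in 𝓝 0, φ (i v) = 0 := by
    filter_upwards [hz.eventually hBA] with v hv
    rw [← hBφ, hv]
  have hback : ∀ a : Cn (m + 1) → ℂ, (∀ᶠ v in 𝓝 0, a (i v) = 0) →
      ∀ᶠ x in 𝓝 0, φ x = 0 → a x = 0 := by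
    intro a ha
    have ht : Tendsto (fun x => (B x).2) (𝓝 0) (𝓝 0) :=
      (continuous_snd.tendsto' (0 : ℂ × Cn m) 0 rfl).comp hBt
    filter_upwards [ht.eventually ha, hAB] with x h1 h2 h3
    have : i (B x).2 = x := by
      have e : ((0 : ℂ), (B x).2) = B x := Prod.ext (by rw [hBφ, h3]) rfl
      change A (0, (B x).2) = x
      rw [e, h2]
    rwa [this] at h1
  by_cases hz : ∀ᶠ v in 𝓝 0, a (i v) = 0
  · exact Or.inl (hback a hz)
  · refine Or.inr (hback b ?_)
    refine AnalyticAt.eventually_eq_zero_of_mul (hc a ha) ?_ ?_ hz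
    · exact (hc b hb).eventually_analyticAt.mono fun v hv => hv.continuousAt
    · filter_upwards [hit.eventually h, hφi] with v h1 h2 h3
      exact (h1 h2).resolve_left h3

end Divisors

section HypersurfaceOfFoliation

variable {m : ℕ} {g : Cn (m + 1) → Cn (m + 1)}

lemma IsFiniteGerm.germIrreducibleAt (hg : IsFiniteGerm g) {Φ φ : Cn (m + 1) → ℂ}
    (hφ : AnalyticAt ℂ φ 0) (hφ0 : φ 0 = 0) (hd : fderiv ℂ φ 0 ≠ 0)
    (h : ∀ᶠ x in 𝓝 0, Φ (g x) = 0 ↔ φ x = 0) {X : Set (Cn (m + 1))}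
    (hX : ∀ᶠ y in 𝓝 0, y ∈ X ↔ Φ y = 0) : GermIrreducibleAt X 0 := by
  intro V X₁ X₂ hV h0V h₁ h₂ _ _ hXV
  obtain ⟨V₁, hV₁, -, h0V₁, -, ψ₁, hψ₁, -, hz₁⟩ := h₁.2 0 h0V
  obtain ⟨V₂, hV₂, -, h0V₂, -, ψ₂, hψ₂, -, hz₂⟩ := h₂.2 0 h0V
  have hz : ∀ {Y V' : Set (Cn (m + 1))} {ψ : Cn (m + 1) → ℂ}, Y ∩ V' = {x ∈ V' | ψ x = 0} →
      ∀ y ∈ V', y ∈ Y ↔ ψ y = 0 := fun hY y hy =>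
    ⟨fun h => (hY.le ⟨h, hy⟩).2, fun h => (hY.ge ⟨hy, h⟩).1⟩
  have hc : ∀ {ψ : Cn (m + 1) → ℂ}, AnalyticAt ℂ ψ 0 → AnalyticAt ℂ (fun x => ψ (g x)) 0 :=
    fun {ψ} hψ => AnalyticAt.comp (g := ψ) (f := g) (by rwa [hg.map_zero]) hg.analytic
  have hback : ∀ {ψ : Cn (m + 1) → ℂ} {V' Y Y' : Set (Cn (m + 1))},
      (∀ᶠ x in 𝓝 0, φ x = 0 → ψ (g x) = 0) → IsOpen V' → (0 : Cn (m + 1)) ∈ V' →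
      Y ∩ V' = {x ∈ V' | ψ x = 0} → Y' ⊆ X →
      ∃ V' : Set (Cn (m + 1)), IsOpen V' ∧ (0 : Cn (m + 1)) ∈ V' ∧ Y' ∩ V' ⊆ Y := by
    intro ψ V' Y Y' hψ hV' h0 hY hY'
    have h1 : ∀ᶠ y in 𝓝 0, Φ y = 0 → ψ y = 0 := by
      rw [← hg.eventually_map_iff]
      filter_upwards [h, hψ] with x h1 h2 h3 using h2 (h1.1 h3)
    obtain ⟨O, hO, hOo, h0O⟩ := mem_nhds_iff.1 ((h1.and hX).and (hV'.mem_nhds h0))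
    refine ⟨O, hOo, h0O, fun y hy => ?_⟩
    have := hO hy.2
    exact (hz hY y this.2).2 (this.1.1 (this.1.2.1 (hY' hy.1)))
  rcases eventually_zero_or_of_mul hφ hφ0 hd (hc (hψ₁ 0 h0V₁)) (hc (hψ₂ 0 h0V₂)) (by
    filter_upwards [h, hg.tendsto.eventually hX, hg.tendsto (hV.mem_nhds h0V),
      hg.tendsto (hV₁.mem_nhds h0V₁), hg.tendsto (hV₂.mem_nhds h0V₂)] with x h1 h2 h3 h4 h5 h6
    rcases hXV.le ⟨h2.2 (h1.2 h6), h3⟩ with hx | hx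
    · exact Or.inl ((hz hz₁ _ h4).1 hx)
    · exact Or.inr ((hz hz₂ _ h5).1 hx)) with h' | h'
  · exact Or.inr (hback h' hV₁ h0V₁ hz₁ fun y hy => (hXV.ge (Or.inr hy)).1)
  · exact Or.inl (hback h' hV₂ h0V₂ hz₂ fun y hy => (hXV.ge (Or.inl hy)).1)

theorem IsFiniteGerm.exists_hypersurface (hg : IsFiniteGerm g) {U : Set (Cn (m + 1))}
    (hU : U ∈ 𝓝 0) {ω η : OneForm (m + 1)} {W : Set (Cn (m + 1))} {f : Cn (m + 1) → ℂ}
    (hF : IsFoliationOn ω W) (hW : (0 : Cn (m + 1)) ∈ W) (hω0 : ω 0 = 0)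
    (hf : AnalyticAt ℂ f 0) (hη : AnalyticAt ℂ η 0) (hη0 : η 0 ≠ 0)
    (hpull : ∀ᶠ x in 𝓝 0, (ω (g x)).comp (fderiv ℂ g x) = f x • η x) :
    ∃ (W X U' : Set (Cn (m + 1))), IsOpen W ∧ (0 : Cn (m + 1)) ∈ W ∧
      IsHypersurfaceIn W X ∧ (0 : Cn (m + 1)) ∈ X ∧ GermIrreducibleAt X 0 ∧
      ¬ SmoothPointAt X 0 ∧
      IsOpen U' ∧ (0 : Cn (m + 1)) ∈ U' ∧ U' ⊆ U ∧ MapsTo g U' W ∧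
      SmoothPointAt (U' ∩ g ⁻¹' X) 0 := by
  obtain ⟨Φ, φ, hΦ, hφ, hΦ0, hφ0, hd, hiff, hw⟩ :=
    hg.exists_first_integral_descent hF hW hf hη hη0 hpull
  obtain ⟨ρ, hρ, hsub⟩ := Metric.mem_nhds_iff.1 hΦ.eventually_analyticAt
  have hb0 : (0 : Cn (m + 1)) ∈ Metric.ball (0 : Cn (m + 1)) ρ := Metric.mem_ball_self hρ
  have hbn := Metric.ball_mem_nhds (0 : Cn (m + 1)) hρ
  have hX : ∀ᶠ y in 𝓝 0, y ∈ {y ∈ Metric.ball (0 : Cn (m + 1)) ρ | Φ y = 0} ↔ Φ y = 0 := by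
    filter_upwards [hbn] with y hy using ⟨fun h => h.2, fun h => ⟨hy, h⟩⟩
  obtain ⟨U', hU', hU'o, h0U'⟩ := mem_nhds_iff.1 (inter_mem hU (inter_mem (hg.tendsto hbn)
    (inter_mem hφ.eventually_analyticAt hiff)))
  refine ⟨Metric.ball 0 ρ, {y ∈ Metric.ball 0 ρ | Φ y = 0}, U', Metric.isOpen_ball, hb0,
    ⟨fun y hy => hy.1, fun p hp => ⟨Metric.ball 0 ρ, Metric.isOpen_ball,
      (convex_ball _ _).isPreconnected, hp, Subset.rfl, Φ, fun y hy => hsub hy, ?_, ?_⟩⟩,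
    ⟨hb0, hΦ0⟩, hg.germIrreducibleAt hφ hφ0 hd hiff hX, ?_, hU'o, h0U', fun x hx => (hU' hx).1,
    fun x hx => (hU' hx).2.1, U', φ, hU'o, h0U', fun x hx => (hU' hx).2.2.1, hd, ?_⟩
  · by_contra! hcon
    refine AnalyticAt.not_eventually_eq_zero_of_fderiv_ne_zero hd ?_
    filter_upwards [hiff, hg.tendsto hbn] with x h1 h2 using h1.1 (hcon _ h2)
  · exact inter_eq_left.2 fun y hy => hy.1
  · rintro ⟨V, χ, hV, h0V, hχ, hdχ, hVX⟩
    refine not_smooth_of_wedge hF hW hω0 hΦ hΦ0 hw (hχ 0 h0V) hdχ ?_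
    filter_upwards [hX, hV.mem_nhds h0V] with y h1 h2
    rw [← h1]
    exact ⟨fun h => (hVX.le ⟨h, h2⟩).2, fun h => (hVX.ge ⟨h2, h⟩).1⟩
  · ext x
    constructor
    · rintro ⟨⟨hx, hgx⟩, -⟩
      exact ⟨hx, (hU' hx).2.2.2.1 hgx.2⟩
    · rintro ⟨hx, hφx⟩
      exact ⟨⟨hx, (hU' hx).2.1, (hU' hx).2.2.2.2 hφx⟩, hx⟩

end HypersurfaceOfFoliation

/-! ### Reduced equations -/

section EqualMultiplicity

open Polynomial

/-- A product of linear factors all of whose roots have multiplicity `k` is the `k`-th power of a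
polynomial with simple roots, given by the power sums divided by `k`. -/
lemma polyOfPowerSums_pow_eq {d k : ℕ} (hk : k ≠ 0) (a : Fin d → ℂ)
    (ha : ∀ i, (∏ j, (X - C (a j))).rootMultiplicity (a i) = k) :
    polyOfPowerSums (d / k) (fun j => (∑ i, a i ^ j) / k) ^ k = ∏ i, (X - C (a i)) ∧
    ∀ c, (polyOfPowerSums (d / k) (fun j => (∑ i, a i ^ j) / k)).eval c = 0 →
      (derivative (polyOfPowerSums (d / k) (fun j => (∑ i, a i ^ j) / k))).eval c ≠ 0 := by
  classical
  set s := Finset.univ.image a with hs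
  have hcount : ∀ b ∈ s, (Finset.univ.filter fun i => a i = b).card = k := by
    intro b hb
    obtain ⟨i, -, rfl⟩ := Finset.mem_image.1 hb
    rw [← ha i, ← count_roots]
    have : (∏ j, (X - C (a j))).roots = Finset.univ.val.map a := by
      rw [← roots_multiset_prod_X_sub_C (Finset.univ.val.map a), Multiset.map_map]
      rfl
    rw [this, Multiset.count_map]
    simp only [eq_comm (a := a i)]
    rfl
  have hd : d = s.card * k := by
    have := Finset.card_eq_sum_card_image a Finset.univ
    rw [Finset.sum_congr rfl hcount] at this
    simpa using this
  have hdk : d / k = s.card := by rw [hd, Nat.mul_div_cancel _ (Nat.pos_of_ne_zero hk)]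
  have hsum : ∀ j : ℕ, ∑ i, a i ^ j = k * ∑ b ∈ s, b ^ j := by
    intro j
    rw [Finset.sum_comp (fun b => b ^ j) a, Finset.mul_sum]
    exact Finset.sum_congr rfl fun b hb => by rw [hcount b hb, nsmul_eq_mul]
  have hh : polyOfPowerSums (d / k) (fun j => (∑ i, a i ^ j) / k) = ∏ b ∈ s, (X - C b) := by
    rw [hdk, polyOfPowerSums_eq (a := fun i => ((s.equivFin.symm i : s) : ℂ))]
    · rw [Equiv.prod_comp s.equivFin.symm (fun b : s => (X - C (b : ℂ)))]
      exact Finset.prod_coe_sort s fun b => X - C b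
    · intro j
      rw [hsum, mul_div_cancel_left₀ _ (by exact_mod_cast hk),
        Equiv.sum_comp s.equivFin.symm (fun b : s => (b : ℂ) ^ j)]
      exact (Finset.sum_coe_sort s fun b => b ^ j).symm
  rw [hh]
  refine ⟨?_, fun c hc => ?_⟩
  · rw [← Finset.prod_pow, Finset.prod_comp (fun b => X - C b) a]
    exact Finset.prod_congr rfl fun b hb => by rw [hcount b hb]
  · have hsep : (∏ b ∈ s, (X - C b)).Separable :=
      separable_prod_X_sub_C_iff'.2 fun x _ y _ h => h
    have := hsep.aeval_derivative_ne_zero (x := c) (by rw [coe_aeval_eq_eval]; exact hc)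
    simpa using this

lemma exists_iterate_derivative_eval_ne_zero {P : ℂ[X]} (hP : P ≠ 0) {D : ℕ}
    (hD : P.natDegree ≤ D) (t : ℂ) : ∃ i ≤ D, (derivative^[i] P).eval t ≠ 0 := by
  by_contra! hcon
  have h1 := (lt_rootMultiplicity_iff_isRoot_iterate_derivative hP (t := t) (n := D)).2 hcon
  have h2 : P.rootMultiplicity t ≤ P.natDegree := by
    rw [← count_roots]
    exact (Multiset.count_le_card _ _).trans (card_roots' P)
  omega

lemma rootMultiplicity_eq_of_iterate_derivative {P : ℂ[X]} (hP : P ≠ 0) {k : ℕ} {t : ℂ}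
    (h : ∀ i < k, (derivative^[i] P).eval t = 0) (hk : (derivative^[k] P).eval t ≠ 0) :
    P.rootMultiplicity t = k := by
  refine le_antisymm ?_ ?_
  · by_contra! hlt
    exact hk ((lt_rootMultiplicity_iff_isRoot_iterate_derivative hP).1 hlt k le_rfl)
  · rcases Nat.eq_zero_or_pos k with rfl | hpos
    · exact Nat.zero_le _
    · have := (lt_rootMultiplicity_iff_isRoot_iterate_derivative hP (t := t) (n := k - 1)).2
        fun i hi => h i (by omega)
      omega

end EqualMultiplicity

section ReducedEquation

open Polynomial

variable {m : ℕ} {G : Cn m → Cn m} {τ : Cn m → ℂ}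

/-- The reduced Weierstrass polynomial of the image of `x ↦ (τ x, G x)`. -/
theorem IsFiniteGerm.exists_reduced_family (hG : IsFiniteGerm G) (hτ : AnalyticAt ℂ τ 0)
    {O : Set (Cn m)} (hO : O ∈ 𝓝 0) :
    ∃ (r δ : ℝ) (h : Cn m → ℂ[X]) (D : Set (Cn m)), 0 < r ∧ 0 < δ ∧ Metric.ball 0 r ⊆ O ∧
      AnalyticFamily h (Metric.ball 0 δ) ∧ (∀ y, h y ≠ 0) ∧
      (∀ y ∈ Metric.ball 0 δ, ∀ c, (h y).eval c = 0 ↔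
        ∃ x ∈ Metric.ball (0 : Cn m) r, G x = y ∧ τ x = c) ∧
      (∀ y ∈ Metric.ball 0 δ, ∃ᶠ z in 𝓝 y, z ∈ D) ∧
      ∀ y ∈ D, ∀ c, (h y).eval c = 0 → (derivative (h y)).eval c ≠ 0 := by
  obtain ⟨r, δ₀, hp₀, hrO, hz⟩ := hG.exists_isProperOn (inter_mem hO hτ.eventually_analyticAt)
  obtain ⟨d, T, P, hd, hT, hP, hPm, hPS, hP0⟩ :=
    hp₀.exists_charpoly hG.map_zero (f := τ) fun x hx => (hrO hx).2
  let Q : ℕ → Cn m → ℂ := fun i x => (derivative^[i] (P (G x))).eval (τ x)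
  have hQ : ∀ i, ∀ x ∈ Metric.ball 0 r, G x ∈ Metric.ball 0 δ₀ → AnalyticAt ℂ (Q i) x :=
    fun i x hx hGx => (hP.iterate_derivative i).eval
      (hp₀.analytic x (Metric.ball_subset_closedBall hx))
      (hrO (Metric.ball_subset_closedBall hx)).2 hGx
  have h0r : (0 : Cn m) ∈ Metric.ball (0 : Cn m) r := Metric.mem_ball_self hp₀.pos_source
  have h0δ : G 0 ∈ Metric.ball 0 δ₀ := by
    rw [hG.map_zero]
    exact Metric.mem_ball_self hp₀.pos_target
  have hex : ∃ i, ¬ ∀ᶠ x in 𝓝 0, Q i x = 0 := by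
    by_contra! hcon
    obtain ⟨D, hD⟩ := hP.1
    have h1 : ∀ᶠ x in 𝓝 (0 : Cn m), ∀ i ∈ Finset.range (D + 1), Q i x = 0 := by
      rw [Finset.eventually_all]
      exact fun i _ => hcon i
    obtain ⟨i, hi, hne⟩ :=
      exists_iterate_derivative_eval_ne_zero (hPm (G 0)).ne_zero (hD (G 0)) (τ 0)
    exact hne (h1.self_of_nhds i (Finset.mem_range.2 (by omega)))
  obtain ⟨k, hkne, hkmin⟩ : ∃ k, (¬ ∀ᶠ x in 𝓝 0, Q k x = 0) ∧ ∀ i < k, ∀ᶠ x in 𝓝 0, Q i x = 0 := by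
    classical
    exact ⟨Nat.find hex, Nat.find_spec hex, fun i hi => not_not.1 (Nat.find_min hex hi)⟩
  have hk : k ≠ 0 := by
    rintro rfl
    refine hkne ?_
    filter_upwards [Metric.ball_mem_nhds 0 hp₀.pos_source,
      hG.tendsto (Metric.ball_mem_nhds 0 hp₀.pos_target)] with x hx hGx
    exact (hP0 _ hGx _).2 ⟨x, hx, rfl, rfl⟩
  have hgood : ∀ᶠ x in 𝓝 (0 : Cn m), (∀ i ∈ Finset.range k, Q i x = 0) ∧
      ∃ᶠ z in 𝓝 x, Q k z ≠ 0 := by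
    refine Eventually.and ?_ ((hQ k 0 h0r h0δ).eventually_frequently_ne hkne)
    rw [Finset.eventually_all]
    exact fun i hi => hkmin i (Finset.mem_range.1 hi)
  obtain ⟨δ, hδ, hδle, hδO⟩ := hp₀.exists_preimage_subset hz hgood
  have hp := hp₀.mono hδ hδle
  have hsub : Metric.ball (0 : Cn m) δ ⊆ Metric.ball 0 δ₀ := Metric.ball_subset_ball hδle
  let h : Cn m → ℂ[X] := fun y => polyOfPowerSums (d / k) fun j => T y j / k
  have hh : AnalyticFamily h (Metric.ball 0 δ) :=
    AnalyticFamily.of_powerSums fun j y hy =>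
      (hT j y (hsub hy)).div analyticAt_const (by exact_mod_cast hk)
  set D : Set (Cn m) := {y | y ∈ regularValues G r δ ∧
    ∀ x ∈ Metric.ball (0 : Cn m) r, G x = y → Q k x ≠ 0} with hDdef
  have hdense : ∀ y ∈ Metric.ball 0 δ, ∃ᶠ z in 𝓝 y, z ∈ D := by
    intro y hy
    rw [frequently_iff]
    intro V hV
    obtain ⟨V', hV', hVo, hyV⟩ := mem_nhds_iff.1 hV
    obtain ⟨z, hz, hzr, hzQ⟩ := hp.exists_mem_regularValues_forall_ne (q := Q k)
      (fun x hx hGx => (hQ k x hx (hsub hGx)).continuousAt)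
      (fun x hx hGx hev => (hδO x hx hGx).2 (hev.mono fun z hz => not_not.2 hz)) hy hVo hyV
    exact ⟨z, hV' hz, hzr, hzQ⟩
  have hDh : ∀ y ∈ D, h y ^ k = P y ∧
      ∀ c, (h y).eval c = 0 → (derivative (h y)).eval c ≠ 0 := by
    rintro y ⟨hyr, hyQ⟩
    obtain ⟨d', ε, S, hS, hεR⟩ := hp.exists_fiberSections hyr
    have hyε := Metric.mem_ball_self (x := y) hS.pos
    obtain ⟨rfl, hTS, hPy⟩ := hPS y ε d' S (hsub hyr.1) hS
    have hmult : ∀ i, (∏ j, (X - C (τ (S j y)))).rootMultiplicity (τ (S i y)) = k := by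
      intro i
      have hx := hS.mem_ball i y hyε
      have hGx := hS.map_eq i y hyε
      rw [← hPy]
      refine rootMultiplicity_eq_of_iterate_derivative (hPm y).ne_zero (fun j hj => ?_) ?_
      · have := (hδO (S i y) hx (by rw [hGx]; exact hyr.1)).1 j (Finset.mem_range.2 hj)
        simp only [Q, hGx] at this
        exact this
      · have := hyQ (S i y) hx hGx
        simp only [Q, hGx] at this
        exact this
    have := polyOfPowerSums_pow_eq hk (fun i => τ (S i y)) hmult
    simp only [← hTS, ← hPy] at this
    exact this
  have hpow : ∀ y ∈ Metric.ball 0 δ, ∀ c, (h y).eval c ^ k = (P y).eval c := by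
    intro y hy c
    rw [← sub_eq_zero]
    refine ContinuousAt.eq_zero_of_frequently
      (f := fun y => (h y).eval c ^ k - (P y).eval c) (x := y) ?_ ?_
    · exact ((hh.eval (u := fun y => y) analyticAt_id analyticAt_const hy).continuousAt.pow k).sub
        (hP.eval (u := fun y => y) analyticAt_id analyticAt_const (hsub hy)).continuousAt
    · refine (hdense y hy).mono fun z hz => ?_
      rw [← (hDh z hz).1, eval_pow, sub_self]
  refine ⟨r, δ, h, D, hp.pos_source, hδ,
    fun x hx => (hrO (Metric.ball_subset_closedBall hx)).1, hh,
    fun y => (polyOfPowerSums_monic _ _).ne_zero, fun y hy c => ?_, hdense,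
    fun y hy => (hDh y hy).2⟩
  rw [← hP0 y (hsub hy), ← hpow y hy c, pow_eq_zero_iff hk]

/-- The zero set of a polynomial family, generically with simple roots, and of its vertical
derivative contains no hypersurface. -/
lemma not_eventually_multiple_root {h : Cn m → ℂ[X]} {δ : ℝ} {D : Set (Cn m)}
    (hne : ∀ y, h y ≠ 0) (hD : ∀ y ∈ Metric.ball 0 δ, ∃ᶠ z in 𝓝 y, z ∈ D)
    (hsimple : ∀ y ∈ D, ∀ c, (h y).eval c = 0 → (derivative (h y)).eval c ≠ 0)
    {ψ : ℂ × Cn m → ℂ} {p : ℂ × Cn m} (hp : p.2 ∈ Metric.ball 0 δ) (hψ : AnalyticAt ℂ ψ p)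
    (hψ0 : ψ p = 0) :
    ¬ ∀ᶠ q in 𝓝 p, ψ q = 0 → (h q.2).eval q.1 = 0 ∧ (derivative (h q.2)).eval q.1 = 0 := by
  intro hz
  by_cases hvert : ∀ᶠ c in 𝓝 p.1, ψ (c, p.2) = 0
  · have ht : Tendsto (fun c : ℂ => (c, p.2)) (𝓝 p.1) (𝓝 p) :=
      (by fun_prop : Continuous fun c : ℂ => (c, p.2)).tendsto' _ _ rfl
    have h1 : ∀ᶠ c in 𝓝 p.1, (h p.2).IsRoot c := by
      filter_upwards [hvert, ht.eventually hz] with c h1 h2 using (h2 h1).1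
    exact hne p.2 (eq_zero_of_infinite_isRoot _ (infinite_of_mem_nhds p.1 h1))
  · obtain ⟨ε, hε, hsub⟩ := Metric.mem_nhds_iff.1 hz
    have h1 := eventually_exists_zero hψ hψ0 hvert hε
    obtain ⟨y, hyD, ⟨c, hc, hψc⟩, hy⟩ :=
      ((hD p.2 hp).and_eventually (h1.and (Metric.ball_mem_nhds p.2 hε))).exists
    have := hsub (show (c, y) ∈ Metric.ball p ε from by
      rw [← ball_prod_same]; exact ⟨hc, hy⟩) hψc
    exact hsimple y hyD c this.1 this.2

end ReducedEquation

/-! ### Saturated equations -/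

section SaturatedEquation

open Polynomial

variable {m : ℕ} {g : Cn (m + 1) → Cn (m + 1)}

lemma exists_equiv_apply_eq {v : Cn (m + 1)} (hv : v ≠ 0) :
    ∃ L : Cn (m + 1) ≃L[ℂ] ℂ × Cn m, L v = (1, 0) := by
  obtain ⟨i, hi⟩ := Function.ne_iff.1 hv
  have hi : v i ≠ 0 := hi
  let ℓ : Cn (m + 1) →L[ℂ] ℂ :=
    (v i)⁻¹ • ContinuousLinearMap.proj (R := ℂ) (φ := fun _ : Fin (m + 1) => ℂ) i
  have hℓv : ℓ v = 1 := by simp [ℓ, hi]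
  obtain ⟨L, hL⟩ := exists_equiv_fst_eq (ℓ := ℓ) (by rintro h; simp [h] at hℓv)
  refine ⟨L.trans ((ContinuousLinearEquiv.refl ℂ ℂ).skewProd (ContinuousLinearEquiv.refl ℂ (Cn m))
    (ContinuousLinearMap.toSpanSingleton ℂ (-(L v).2))), ?_⟩
  have h1 : (L v).1 = 1 := (hL v).trans hℓv
  refine Prod.ext ?_ ?_
  · simpa using h1
  · simp [h1]

lemma exists_line_not_eventually_zero {ψ : Cn (m + 1) → ℂ} (hψ : AnalyticAt ℂ ψ 0)
    (hψ0 : ψ 0 = 0) (hne : ¬ ∀ᶠ y in 𝓝 0, ψ y = 0) :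
    ∃ v : Cn (m + 1), v ≠ 0 ∧ ∀ᶠ t : ℂ in 𝓝 0, ψ (t • v) = 0 → t = 0 := by
  obtain ⟨ρ, hρ, hsub⟩ := Metric.mem_nhds_iff.1 hψ.eventually_analyticAt
  obtain ⟨v, hv, hψv⟩ : ∃ v ∈ Metric.ball 0 ρ, ψ v ≠ 0 := by
    by_contra! hcon
    exact hne (by filter_upwards [Metric.ball_mem_nhds 0 hρ] with y hy using hcon y hy)
  refine ⟨v, fun h => hψv (h ▸ hψ0), ?_⟩
  let T : Set ℂ := (fun t : ℂ => t • v) ⁻¹' Metric.ball 0 ρ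
  have hcT : Convex ℝ T := (convex_ball (0 : Cn (m + 1)) ρ).is_linear_preimage
    ⟨fun a b => add_smul a b v, fun a b => smul_assoc a b v⟩
  have h0T : (0 : ℂ) ∈ T := by simpa [T] using hρ
  have h1T : (1 : ℂ) ∈ T := by simpa [T] using hv
  have han : AnalyticOnNhd ℂ (fun t : ℂ => ψ (t • v)) T := fun t ht =>
    AnalyticAt.comp (g := ψ) (f := fun t : ℂ => t • v) (hsub ht)
      (analyticAt_id.smul analyticAt_const)
  rcases (han 0 h0T).eventually_eq_zero_or_eventually_ne_zero with h | h
  · have := han.eqOn_zero_of_preconnected_of_eventuallyEq_zero hcT.isPreconnected h0T h h1T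
    simp only [one_smul] at this
    exact absurd this hψv
  · rw [eventually_nhdsWithin_iff] at h
    exact h.mono fun t ht h0 => by_contra fun hne => ht hne h0

theorem IsFiniteGerm.exists_saturated_equation (hg : IsFiniteGerm g) {ψ φ : Cn (m + 1) → ℂ}
    (hψ : AnalyticAt ℂ ψ 0) (hψ0 : ψ 0 = 0) (hne : ¬ ∀ᶠ y in 𝓝 0, ψ y = 0)
    (hφ : AnalyticAt ℂ φ 0) (hφ0 : φ 0 = 0) (hd : fderiv ℂ φ 0 ≠ 0)
    (hiff : ∀ᶠ x in 𝓝 0, ψ (g x) = 0 ↔ φ x = 0) :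
    ∃ (h : Cn (m + 1) → ℂ) (V : Set (Cn (m + 1))), IsOpen V ∧ (0 : Cn (m + 1)) ∈ V ∧
      AnalyticOnNhd ℂ h V ∧ (∀ᶠ y in 𝓝 0, h y = 0 ↔ ψ y = 0) ∧
      ∀ p ∈ V, ∀ χ : Cn (m + 1) → ℂ, AnalyticAt ℂ χ p → χ p = 0 →
        ¬ ∀ᶠ y in 𝓝 p, χ y = 0 → h y = 0 ∧ fderiv ℂ h y = 0 := by
  obtain ⟨v, hv, hψv⟩ := exists_line_not_eventually_zero hψ hψ0 hne
  obtain ⟨L, hL⟩ := exists_equiv_apply_eq hv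
  obtain ⟨A, B, hA, hB, hA0, hB0, hAB, hBA, hBφ⟩ := exists_straightening hφ hφ0 hd
  have hBt : Tendsto B (𝓝 0) (𝓝 0) := by simpa [hB0] using hB.continuousAt.tendsto
  have hz : Tendsto (fun x : Cn m => ((0 : ℂ), x)) (𝓝 0) (𝓝 0) :=
    (by fun_prop : Continuous fun x : Cn m => ((0 : ℂ), x)).tendsto' _ _ rfl
  let i : Cn m → Cn (m + 1) := fun x => A (0, x)
  have hi0 : i 0 = 0 := hA0
  have hi : AnalyticAt ℂ i 0 := AnalyticAt.comp (g := A) (f := fun v : Cn m => ((0 : ℂ), v)) hA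
    (analyticAt_const.prod analyticAt_id)
  have hit : Tendsto i (𝓝 0) (𝓝 0) := by simpa [hi0] using hi.continuousAt.tendsto
  have hgi : AnalyticAt ℂ (fun x => L (g (i x))) 0 :=
    L.toContinuousLinearMap.analyticAt _ |>.comp
      (AnalyticAt.comp (g := g) (f := i) (by rw [hi0]; exact hg.analytic) hi)
  let τ : Cn m → ℂ := fun x => (L (g (i x))).1
  let G : Cn m → Cn m := fun x => (L (g (i x))).2
  have hτ : AnalyticAt ℂ τ 0 := analyticAt_fst.comp hgi
  have hGa : AnalyticAt ℂ G 0 := analyticAt_snd.comp hgi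
  have hφi : ∀ᶠ x in 𝓝 0, φ (i x) = 0 := by
    filter_upwards [hz.eventually hBA] with x hx
    rw [← hBφ, hx]
  have hψi : ∀ᶠ x in 𝓝 0, ψ (g (i x)) = 0 := by
    filter_upwards [hφi, hit.eventually hiff] with x h1 h2 using h2.2 h1
  have hLs : ∀ t : ℂ, L.symm (t, 0) = t • v := fun t => by
    rw [ContinuousLinearEquiv.symm_apply_eq, map_smul, hL]
    simp
  have hG : IsFiniteGerm G := by
    refine ⟨hGa, by simp [G, hi0, hg.map_zero], ?_⟩
    have hτt : Tendsto τ (𝓝 0) (𝓝 0) := by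
      have : τ 0 = 0 := by simp [τ, hi0, hg.map_zero]
      simpa [this] using hτ.continuousAt.tendsto
    filter_upwards [hψi, hτt.eventually hψv, hit.eventually hg.eq_zero, hz.eventually hBA]
      with x h1 h2 h3 h4 hGx
    have e : g (i x) = τ x • v := by
      rw [← hLs, ← L.symm_apply_apply (g (i x))]
      exact congrArg L.symm (Prod.ext rfl hGx)
    have hτx := h2 (by rw [← e]; exact h1)
    have hix := h3 (by rw [e, hτx, zero_smul])
    have : B (i x) = (0, x) := h4
    rw [hix, hB0] at this
    exact (congrArg Prod.snd this).symm
  obtain ⟨r, δ, H, D, hr, hδ, hrO, hH, hHne, hH0, hD, hsimple⟩ := hG.exists_reduced_family hτ hψi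
  have hLt : Tendsto (fun y => (L y).2) (𝓝 0) (𝓝 0) :=
    (by fun_prop : Continuous fun y => (L y).2).tendsto' _ _ (by simp)
  have hLa : ∀ y, AnalyticAt ℂ (fun y => L y) y := fun y => L.toContinuousLinearMap.analyticAt y
  set V : Set (Cn (m + 1)) := (fun y => (L y).2) ⁻¹' Metric.ball 0 δ with hVdef
  have hVo : IsOpen V := Metric.isOpen_ball.preimage (by fun_prop)
  have h0V : (0 : Cn (m + 1)) ∈ V := by simpa [hVdef] using hδ
  set h : Cn (m + 1) → ℂ := fun y => (H (L y).2).eval (L y).1 with hdef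
  have hh : AnalyticOnNhd ℂ h V := fun y hy =>
    hH.eval (analyticAt_snd.comp (hLa y)) (analyticAt_fst.comp (hLa y)) hy
  refine ⟨h, V, hVo, h0V, hh, ?_, ?_⟩
  · have hO : {x | (B x).2 ∈ Metric.ball (0 : Cn m) r ∧ A (B x) = x ∧ (ψ (g x) = 0 ↔ φ x = 0)} ∈
        𝓝 (0 : Cn (m + 1)) := by
      have ht : Tendsto (fun x => (B x).2) (𝓝 0) (𝓝 0) :=
        (continuous_snd.tendsto' (0 : ℂ × Cn m) 0 rfl).comp hBt
      filter_upwards [ht (Metric.ball_mem_nhds 0 hr), hAB, hiff] with x h1 h2 h3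
      exact ⟨h1, h2, h3⟩
    have himg := image_mem_map (m := g) hO
    rw [hg.map_nhds] at himg
    filter_upwards [himg, hVo.mem_nhds h0V] with y hy hyV
    rw [hdef]
    simp only
    rw [hH0 _ hyV]
    constructor
    · rintro ⟨x, hx, hGx, hτx⟩
      have : g (i x) = y := L.injective (Prod.ext hτx hGx)
      rw [← this]
      exact hrO hx
    · obtain ⟨x, ⟨hx1, hx2, hx3⟩, rfl⟩ := hy
      intro hψx
      have hix : i (B x).2 = x := by
        have e : ((0 : ℂ), (B x).2) = B x := Prod.ext (by rw [hBφ, hx3.1 hψx]) rfl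
        change A (0, (B x).2) = x
        rw [e, hx2]
      exact ⟨(B x).2, hx1, by simp [G, hix], by simp [τ, hix]⟩
  · intro p hp χ hχ hχp hcon
    have hLp : L.symm (L p) = p := L.symm_apply_apply p
    have hLst : Tendsto L.symm (𝓝 (L p)) (𝓝 p) := by
      simpa [hLp] using L.symm.continuous.tendsto (L p)
    refine not_eventually_multiple_root hHne hD hsimple (ψ := fun q => χ (L.symm q)) (p := L p) hp
      (AnalyticAt.comp (g := χ) (f := L.symm) (by rwa [hLp])
        (L.symm.toContinuousLinearMap.analyticAt _)) (by simpa using hχp) ?_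
    filter_upwards [hLst.eventually hcon, hLst (hVo.mem_nhds hp)] with q hq hqV hχq
    obtain ⟨h1, h2⟩ := hq hχq
    have hqV : L.symm q ∈ V := hqV
    refine ⟨by simpa [hdef] using h1, ?_⟩
    have e1 : HasDerivAt (fun t : ℂ => L.symm q + t • v) v 0 := by
      simpa using ((hasDerivAt_id (0 : ℂ)).smul_const v).const_add (L.symm q)
    have e2 : HasDerivAt (fun t : ℂ => h (L.symm q + t • v)) (fderiv ℂ h (L.symm q) v) 0 :=
      HasFDerivAt.comp_hasDerivAt (l := h) (f := fun t : ℂ => L.symm q + t • v) 0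
        (by simpa using (hh _ hqV).differentiableAt.hasFDerivAt) e1
    have e3 : (fun t : ℂ => h (L.symm q + t • v)) = fun t : ℂ => (H q.2).eval (q.1 + t) := by
      funext t
      simp [hdef, hL]
    have e4 : HasDerivAt (fun t : ℂ => (H q.2).eval (q.1 + t)) ((derivative (H q.2)).eval q.1) 0 := by
      have := ((H q.2).hasDerivAt (q.1 + 0)).comp_const_add q.1 0
      simpa using this
    rw [e3, h2] at e2
    simpa using e4.unique e2

end SaturatedEquation

/-! ### Foliations from hypersurfaces -/

section FoliationOfHypersurface

variable {m : ℕ} {g : Cn (m + 1) → Cn (m + 1)}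

lemma formIntegrableOn_fderiv {n : ℕ} {h : Cn n → ℂ} {W : Set (Cn n)} (hh : AnalyticOnNhd ℂ h W) :
    FormIntegrableOn (fderiv ℂ h) W := by
  intro x hx u v w
  have hsymm : ∀ u v, extd (fderiv ℂ h) x u v = 0 := fun u v =>
    sub_eq_zero.2 (second_derivative_symmetric_of_eventually (𝕜 := ℂ)
      ((hh x hx).eventually_analyticAt.mono fun z hz => hz.differentiableAt.hasFDerivAt)
      (hh x hx).fderiv.differentiableAt.hasFDerivAt u v)
  simp [hsymm]

theorem IsFiniteGerm.exists_foliation (hg : IsFiniteGerm g) {U W X U' : Set (Cn (m + 1))}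
    (hU : U ∈ 𝓝 0) (hW : (0 : Cn (m + 1)) ∈ W) (hX : IsHypersurfaceIn W X)
    (h0X : (0 : Cn (m + 1)) ∈ X) (hsing : ¬ SmoothPointAt X 0) (hU'o : IsOpen U')
    (h0U' : (0 : Cn (m + 1)) ∈ U') (hsmooth : SmoothPointAt (U' ∩ g ⁻¹' X) 0) :
    ∃ (W : Set (Cn (m + 1))) (ω : OneForm (m + 1)), (0 : Cn (m + 1)) ∈ W ∧
      IsFoliationOn ω W ∧ ω 0 = 0 ∧
      ∃ (U' : Set (Cn (m + 1))) (f : Cn (m + 1) → ℂ) (η : OneForm (m + 1)),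
        IsOpen U' ∧ (0 : Cn (m + 1)) ∈ U' ∧ U' ⊆ U ∧ MapsTo g U' W ∧
        AnalyticOnNhd ℂ f U' ∧ AnalyticOnNhd ℂ η U' ∧ (∃ x ∈ U', f x ≠ 0) ∧
        (∀ x ∈ U', (ω (g x)).comp (fderiv ℂ g x) = f x • η x) ∧
        CodimAtLeastTwo {x ∈ U' | η x = 0} ∧ η 0 ≠ 0 := by
  obtain ⟨V, hV, hVc, h0V, -, ψ, hψ, ⟨z, hzV, hψz⟩, hXV⟩ := hX.2 0 hW
  obtain ⟨V', φ, hV', h0V', hφV, hd, hφX⟩ := hsmooth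
  have hφ := hφV 0 h0V'
  have hXψ : ∀ y ∈ V, y ∈ X ↔ ψ y = 0 := fun y hy =>
    ⟨fun h => (hXV.le ⟨h, hy⟩).2, fun h => (hXV.ge ⟨hy, h⟩).1⟩
  have hψ0 : ψ 0 = 0 := (hXψ 0 h0V).1 h0X
  have hψne : ¬ ∀ᶠ y in 𝓝 0, ψ y = 0 := fun h =>
    hψz (hψ.eqOn_zero_of_preconnected_of_eventuallyEq_zero hVc h0V h hzV)
  have hφ0 : φ 0 = 0 :=
    (hφX.le ⟨⟨h0U', by rw [mem_preimage, hg.map_zero]; exact h0X⟩, h0V'⟩).2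
  have hiff : ∀ᶠ x in 𝓝 0, ψ (g x) = 0 ↔ φ x = 0 := by
    filter_upwards [hU'o.mem_nhds h0U', hV'.mem_nhds h0V', hg.tendsto (hV.mem_nhds h0V)]
      with x h1 h2 h3
    rw [← hXψ _ h3]
    exact ⟨fun h => (hφX.le ⟨⟨h1, h⟩, h2⟩).2, fun h => (hφX.ge ⟨h2, h⟩).1.2⟩
  obtain ⟨h, Y, hY, h0Y, hh, hhψ, hcodim⟩ :=
    hg.exists_saturated_equation (hψ 0 h0V) hψ0 hψne hφ hφ0 hd hiff
  have hh0 : h 0 = 0 := hhψ.self_of_nhds.2 hψ0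
  have hdh : fderiv ℂ h 0 = 0 := by
    by_contra hne
    obtain ⟨O, hO, hOo, h0O⟩ := mem_nhds_iff.1 (inter_mem hhψ (inter_mem (hV.mem_nhds h0V)
      (hY.mem_nhds h0Y)))
    refine hsing ⟨O, h, hOo, h0O, fun y hy => hh y (hO hy).2.2, hne, ?_⟩
    ext y
    constructor
    · rintro ⟨hyX, hy⟩
      exact ⟨hy, (hO hy).1.2 ((hXψ y (hO hy).2.1).1 hyX)⟩
    · rintro ⟨hy, hhy⟩
      exact ⟨(hXψ y (hO hy).2.1).2 ((hO hy).1.1 hhy), hy⟩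
  have hhφ : ∀ᶠ x in 𝓝 0, h (g x) = 0 ↔ φ x = 0 := by
    filter_upwards [hiff, hg.tendsto.eventually hhψ] with x h1 h2 using h2.trans h1
  have hhg : AnalyticAt ℂ (fun x => h (g x)) 0 :=
    AnalyticAt.comp (g := h) (f := g) (by rw [hg.map_zero]; exact hh 0 h0Y) hg.analytic
  obtain ⟨k, ζ, hζ, hζ0, hk⟩ := exists_fderiv_eq_pow_smul hhg (by simp only [hg.map_zero, hh0])
    hφ hφ0 hd (hhφ.mono fun x hx => hx.1)
  have hpull : ∀ᶠ x in 𝓝 0, (fderiv ℂ h (g x)).comp (fderiv ℂ g x) = φ x ^ k • ζ x := by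
    filter_upwards [hk, hg.analytic.eventually_analyticAt, hg.tendsto (hY.mem_nhds h0Y)]
      with x h1 h2 h3
    rw [← h1]
    exact ((hh _ h3).differentiableAt.hasFDerivAt.comp x h2.differentiableAt.hasFDerivAt).fderiv.symm
  have hcrit : ∀ᶠ y in 𝓝 0, fderiv ℂ h y = 0 → h y = 0 := by
    rw [← hg.eventually_map_iff (p := fun y => fderiv ℂ h y = 0 → h y = 0)]
    filter_upwards [hpull, hhφ, hζ.continuousAt.eventually_ne hζ0] with x h1 h2 h3 h4
    rw [h4, ContinuousLinearMap.zero_comp] at h1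
    have := (smul_eq_zero.1 h1.symm).resolve_right h3
    exact h2.2 (pow_eq_zero_iff'.1 this).1
  obtain ⟨W₁, hW₁, hW₁o, h0W₁⟩ := mem_nhds_iff.1 (inter_mem hcrit (hY.mem_nhds h0Y))
  have hhW : AnalyticOnNhd ℂ h W₁ := fun y hy => hh y (hW₁ hy).2
  obtain ⟨U₁, hU₁, hU₁o, h0U₁⟩ := mem_nhds_iff.1 (inter_mem hU (inter_mem
    (hg.tendsto (hW₁o.mem_nhds h0W₁)) (inter_mem hφ.eventually_analyticAt (inter_mem
    hζ.eventually_analyticAt (inter_mem hpull (hζ.continuousAt.eventually_ne hζ0))))))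
  refine ⟨W₁, fderiv ℂ h, h0W₁, ⟨hW₁o, hhW.fderiv, formIntegrableOn_fderiv hhW, ?_⟩, hdh,
    U₁, fun x => φ x ^ k, ζ, hU₁o, h0U₁, fun x hx => (hU₁ hx).1, fun x hx => (hU₁ hx).2.1,
    fun x hx => (hU₁ hx).2.2.1.pow k, fun x hx => (hU₁ hx).2.2.2.1, ?_,
    fun x hx => (hU₁ hx).2.2.2.2.1, ?_, hζ0⟩
  · rintro ⟨q, V₂, χ, hV₂, -, hqV₂, hχ, hχq, -, hsub⟩
    refine hcodim q (hW₁ (hsub ⟨hqV₂, hχq⟩).1).2 χ (hχ q hqV₂) hχq ?_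
    filter_upwards [hV₂.mem_nhds hqV₂] with y hy hχy
    have := hsub ⟨hy, hχy⟩
    exact ⟨(hW₁ this.1).1 this.2, this.2⟩
  · by_contra! hcon
    refine AnalyticAt.not_eventually_eq_zero_of_fderiv_ne_zero hd ?_
    filter_upwards [hU₁o.mem_nhds h0U₁] with x hx using (pow_eq_zero_iff'.1 (hcon x hx)).1
  · rintro ⟨q, V₂, χ, -, -, hqV₂, -, hχq, -, hsub⟩
    have := hsub ⟨hqV₂, hχq⟩
    exact (hU₁ this.1).2.2.2.2.2 this.2

end FoliationOfHypersurface

/-- **Equivalence of Theorems A and B.**  For a fixed (representative of a) germ of a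
finite holomorphic map `g : (ℂⁿ, 0) → (ℂⁿ, 0)`, the following are equivalent:
(a) there is a germ of an irreducible analytic hypersurface `X` through `0`, singular at
`0`, such that `g⁻¹(X)` is smooth at `0`;
(b) there is a germ of a singular codimension one holomorphic foliation, given by a
one-form `ω` singular at `0`, whose pullback `g*F` (defined by a one-form `η` with
`g*ω = f • η`, `f ≢ 0` holomorphic, and zero locus of `η` of codimension `≥ 2`) is
nonsingular at `0`.
Consequently Theorem A holds if and only if Theorem B holds. -/
theorem singular_hypersurface_with_smooth_preimage_iff_singular_foliation_with_smooth_pullback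
    {n : ℕ} (g : Cn n → Cn n) (U : Set (Cn n))
    (hUopen : IsOpen U) (hU0 : (0 : Cn n) ∈ U)
    (hghol : AnalyticOnNhd ℂ g U) (hg0 : g 0 = 0)
    (hfin : U ∩ g ⁻¹' {0} = {0}) :
    (∃ (W X U' : Set (Cn n)), IsOpen W ∧ (0 : Cn n) ∈ W ∧
      IsHypersurfaceIn W X ∧ (0 : Cn n) ∈ X ∧ GermIrreducibleAt X 0 ∧
      ¬ SmoothPointAt X 0 ∧
      IsOpen U' ∧ (0 : Cn n) ∈ U' ∧ U' ⊆ U ∧ MapsTo g U' W ∧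
      SmoothPointAt (U' ∩ g ⁻¹' X) 0) ↔
    (∃ (W : Set (Cn n)) (ω : OneForm n), (0 : Cn n) ∈ W ∧
      IsFoliationOn ω W ∧ ω 0 = 0 ∧
      ∃ (U' : Set (Cn n)) (f : Cn n → ℂ) (η : OneForm n),
        IsOpen U' ∧ (0 : Cn n) ∈ U' ∧ U' ⊆ U ∧ MapsTo g U' W ∧
        AnalyticOnNhd ℂ f U' ∧ AnalyticOnNhd ℂ η U' ∧ (∃ x ∈ U', f x ≠ 0) ∧
        (∀ x ∈ U', (ω (g x)).comp (fderiv ℂ g x) = f x • η x) ∧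
        CodimAtLeastTwo {x ∈ U' | η x = 0} ∧ η 0 ≠ 0) := by
  rcases n with _ | m
  · constructor
    · rintro ⟨W, X, U', -, hW, hX, h0X, -⟩
      obtain ⟨V, -, -, h0V, -, ψ, -, ⟨x, -, hψx⟩, hXV⟩ := hX.2 0 hW
      rw [Subsingleton.elim x 0] at hψx
      exact absurd (hXV.le ⟨h0X, h0V⟩).2 hψx
    · rintro ⟨W, ω, -, -, -, U', f, η, -, -, -, -, -, -, -, -, -, hη⟩
      refine absurd ?_ hη
      ext v
      rw [Subsingleton.elim v 0, map_zero, map_zero]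
  · have hU : U ∈ 𝓝 0 := hUopen.mem_nhds hU0
    have hg : IsFiniteGerm g := ⟨hghol 0 hU0, hg0, by
      filter_upwards [hU] with x hx hgx using hfin.le ⟨hx, hgx⟩⟩
    constructor
    · rintro ⟨W, X, U', -, hW, hX, h0X, -, hsing, hU'o, h0U', -, -, hsmooth⟩
      exact hg.exists_foliation hU hW hX h0X hsing hU'o h0U' hsmooth
    · rintro ⟨W, ω, hW, hF, hω0, U', f, η, hU'o, h0U', -, -, hf, hη, -, hpull, -, hη0⟩
      refine hg.exists_hypersurface hU hF hW hω0 (hf 0 h0U') (hη 0 h0U') hη0 ?_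
      filter_upwards [hU'o.mem_nhds h0U'] with x hx using hpull x hx
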